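/- Let P ⊂ ℝ^n be a compact flat polyhedron whose support is an n-manifold with boundary, and let K₁ and K₂ be simplicial triangulations of P with a (possibly empty) common subcomplex L satisfying |L| ⊇ ∂P. Then there exists s ∈ ℕ and s-fold derived subdivisions β^s K₁ and β^s K₂, agreeing on a common s-fold derived subdivision β^s L of L, such that β^s K₁ and β^s K₂ are related by a finite sequence of geometric bistellar moves each of which keeps the subcomplex β^s L fixed. -/

import Mathlib

open Set
open scoped Classical

variable {E : Type*} [NormedAddCommGroup E] [NormedSpace ℝ E]

/-- `K'` is a subdivision of `K`: same support, and every simplex of `K'` is contained in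
some simplex of `K`. -/
def IsSubdivision (K' K : Geometry.SimplicialComplex ℝ E) : Prop :=
  K'.space = K.space ∧
    ∀ s ∈ K'.faces, ∃ t ∈ K.faces, convexHull ℝ (s : Set E) ⊆ convexHull ℝ (t : Set E)

/-- `K'` is a derived subdivision of `K`: for each simplex `A` of `K` an interior point `b A`
(in the relative interior of its convex hull; for a vertex this forces `b {x} = x`) is chosen,
and the simplices of `K'` are exactly the convex hulls of the sets `{b A₀, …, b Aₖ}` for chains
`A₀ ⊊ ⋯ ⊊ Aₖ` of simplices of `K`. -/
def IsDerivedSubdivision (K' K : Geometry.SimplicialComplex ℝ E) : Prop :=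
  ∃ b : Finset E → E,
    (∀ s ∈ K.faces, b s ∈ intrinsicInterior ℝ (convexHull ℝ (s : Set E))) ∧
    K'.faces = {S | ∃ T : Finset (Finset E), ↑T ⊆ K.faces ∧ T.Nonempty ∧
      (∀ A ∈ T, ∀ B ∈ T, A ⊆ B ∨ B ⊆ A) ∧ S = T.image b}

/-- `K'` is an `s`-fold iterated derived subdivision of `K`. -/
def IsIterDerived : ℕ → Geometry.SimplicialComplex ℝ E → Geometry.SimplicialComplex ℝ E → Prop
  | 0, K', K => K' = K
  | (s + 1), K', K => ∃ K'', IsIterDerived s K'' K ∧ IsDerivedSubdivision K' K''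

/-- The geometric bistellar move `κ(A,B)` on an `n`-dimensional complex: `A` is a simplex of `K`,
`B` is a simplex not in `K` with `dim A + dim B = n` (i.e. `card A + card B = n + 2`), the link
of `A` in `K` is the boundary complex of `B`, and `K'` is obtained from `K` by replacing
`A ⋆ ∂B` (the simplices containing `A`) with `∂A ⋆ B`; the result is again a geometric
simplicial complex with the same support. -/
def BistellarMove (n : ℕ) (K K' : Geometry.SimplicialComplex ℝ E) : Prop :=
  ∃ A B : Finset E, A ∈ K.faces ∧ B ∉ K.faces ∧ B.Nonempty ∧
    A.card + B.card = n + 2 ∧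
    {C : Finset E | C.Nonempty ∧ Disjoint A C ∧ A ∪ C ∈ K.faces} =
      {C : Finset E | C.Nonempty ∧ C ⊂ B} ∧
    K'.faces = (K.faces \ {s | A ⊆ s}) ∪ {s | ∃ A' : Finset E, A' ⊂ A ∧ s = A' ∪ B} ∧
    K'.space = K.space

/-- `h` is a regular function for the triangulation `K` of a flat `d`-dimensional polyhedron:
it is affine on each simplex of `K` and strictly convex across each codimension-one simplex,
i.e. for `x`, `y` in distinct `d`-simplices sharing a common `(d-1)`-face, the open segment
from `(x, h x)` to `(y, h y)` lies strictly above the graph of `h`. -/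
def IsRegularFunction (d : ℕ) (K : Geometry.SimplicialComplex ℝ E) (h : E → ℝ) : Prop :=
  (∀ s ∈ K.faces, ∃ g : E →ᵃ[ℝ] ℝ, ∀ x ∈ convexHull ℝ (s : Set E), h x = g x) ∧
  (∀ σ ∈ K.faces, ∀ σ' ∈ K.faces, σ ≠ σ' → σ.card = d + 1 → σ'.card = d + 1 →
    (σ ∩ σ').card = d →
    ∀ x ∈ convexHull ℝ (σ : Set E), ∀ y ∈ convexHull ℝ (σ' : Set E),
      ∀ t : ℝ, t ∈ Set.Ioo (0 : ℝ) 1 → (1 - t) • x + t • y ∈ K.space →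
        h ((1 - t) • x + t • y) < (1 - t) * h x + t * h y)

/-- `K` is a regular triangulation (of a flat `d`-dimensional polyhedron). -/
def IsRegularTriangulation (d : ℕ) (K : Geometry.SimplicialComplex ℝ E) : Prop :=
  ∃ h : E → ℝ, IsRegularFunction d K h

/-- `P` is strictly star-convex: there is an interior point `x` such that for every `y ∈ P`
the open segment from `x` to `y` lies in the interior of `P`. -/
def StrictlyStarConvex (P : Set E) : Prop :=
  ∃ x ∈ interior P, ∀ y ∈ P, ∀ t ∈ Set.Ioo (0 : ℝ) 1, (1 - t) • x + t • y ∈ interior P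

/-- `L` is a common subcomplex of `K₁` and `K₂`: every simplex of `L` is a simplex of both, and
`L` consists exactly of the simplices of `K₁` (equivalently of `K₂`) contained in `|L|`. -/
def IsCommonSubcomplex (L K₁ K₂ : Geometry.SimplicialComplex ℝ E) : Prop :=
  L.faces ⊆ K₁.faces ∧ L.faces ⊆ K₂.faces ∧
  L.faces = {s ∈ K₁.faces | convexHull ℝ (s : Set E) ⊆ L.space} ∧
  L.faces = {s ∈ K₂.faces | convexHull ℝ (s : Set E) ⊆ L.space}

/-- Affine independence of the points of a finite set. -/
abbrev AffIndep (F : Finset E) : Prop := AffineIndependent ℝ ((↑) : F → E)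

/-- An affine function evaluated at an affine combination. -/
theorem affineMap_sum_smul (g : E →ᵃ[ℝ] ℝ) {ι : Type*} (A : Finset ι) (c : ι → ℝ) (p : ι → E)
    (hc : ∑ i ∈ A, c i = 1) : g (∑ i ∈ A, c i • p i) = ∑ i ∈ A, c i * g (p i) := by
  have h : ∀ x, g x = g.linear x + g 0 := fun x => by
    have := g.map_vadd 0 x
    simpa using this
  generalize g 0 = k at h
  have h2 : ∑ i ∈ A, c i * g (p i) = ∑ i ∈ A, (c i * g.linear (p i) + c i * k) :=
    Finset.sum_congr rfl fun i _ => by rw [h (p i), mul_add]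
  rw [h, map_sum, h2, Finset.sum_add_distrib, ← Finset.sum_mul, hc, one_mul]
  simp

theorem exists_sum_smul_eq_of_mem_affineSpan {A : Finset E} {y : E}
    (hy : y ∈ affineSpan ℝ (A : Set E)) :
    ∃ c : E → ℝ, ∑ w ∈ A, c w = 1 ∧ ∑ w ∈ A, c w • w = y := by
  have hy' : y ∈ affineSpan ℝ (Set.range (fun i : A => (i : E))) := by simpa using hy
  obtain ⟨w, hw, hwy⟩ := eq_affineCombination_of_mem_affineSpan_of_fintype hy'
  rw [Finset.affineCombination_eq_linear_combination _ _ _ hw] at hwy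
  refine ⟨fun e => if h : e ∈ A then w ⟨e, h⟩ else 0, ?_, ?_⟩
  · rw [← Finset.sum_coe_sort, ← hw]
    exact Finset.sum_congr rfl fun i _ => by simp
  · rw [← Finset.sum_coe_sort, hwy]
    exact Finset.sum_congr rfl fun i _ => by simp

theorem sum_smul_mem_affineSpan {A : Finset E} {c : E → ℝ} (hc : ∑ w ∈ A, c w = 1) :
    ∑ w ∈ A, c w • w ∈ affineSpan ℝ (A : Set E) := by
  have hc' : ∑ i : A, c i = 1 := by rw [← hc]; exact Finset.sum_coe_sort A c
  have := affineCombination_mem_affineSpan hc' (fun i : A => (i : E))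
  rw [Finset.affineCombination_eq_linear_combination _ _ _ hc'] at this
  rw [← Finset.sum_coe_sort]
  simpa using this

theorem exists_sum_smul_eq_of_mem_convexHull {A : Finset E} {y : E}
    (hy : y ∈ convexHull ℝ (A : Set E)) :
    ∃ c : E → ℝ, (∀ w ∈ A, 0 ≤ c w) ∧ ∑ w ∈ A, c w = 1 ∧ ∑ w ∈ A, c w • w = y := by
  obtain ⟨c, h0, h1, h2⟩ := Finset.mem_convexHull.1 hy
  refine ⟨c, h0, h1, ?_⟩
  rwa [Finset.centerMass_eq_of_sum_1 _ _ h1] at h2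

theorem sum_smul_mem_convexHull {ι : Type*} {A : Finset ι} {c : ι → ℝ} {p : ι → E} {s : Set E}
    (h0 : ∀ i ∈ A, 0 ≤ c i) (h1 : ∑ i ∈ A, c i = 1) (hp : ∀ i ∈ A, c i ≠ 0 → p i ∈ s) :
    ∑ i ∈ A, c i • p i ∈ convexHull ℝ s := by
  rw [← Finset.sum_filter_of_ne (p := fun i => c i ≠ 0)
    (fun i _ h => fun h' => h (by simp [h']))]
  refine (convex_convexHull ℝ s).sum_mem (fun i hi => h0 i (Finset.mem_filter.1 hi).1) ?_
    (fun i hi => subset_convexHull ℝ s (hp i (Finset.mem_filter.1 hi).1 (Finset.mem_filter.1 hi).2))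
  rw [Finset.sum_filter_of_ne (fun i _ h => h), h1]

/-- An affine function that is at most `m` on a finite set is at most `m` on its convex hull. -/
theorem affineMap_le_of_mem_convexHull {s : Set E} {y : E} (hy : y ∈ convexHull ℝ s)
    (g : E →ᵃ[ℝ] ℝ) {m : ℝ} (hg : ∀ w ∈ s, g w ≤ m) : g y ≤ m := by
  have hc : Convex ℝ (g ⁻¹' Set.Iic m) := (convex_Iic m).affine_preimage g
  exact convexHull_min (fun w hw => hg w hw) hc hy

theorem affineMap_ge_of_mem_convexHull {s : Set E} {y : E} (hy : y ∈ convexHull ℝ s)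
    (g : E →ᵃ[ℝ] ℝ) {m : ℝ} (hg : ∀ w ∈ s, m ≤ g w) : m ≤ g y := by
  have hc : Convex ℝ (g ⁻¹' Set.Ici m) := (convex_Ici m).affine_preimage g
  exact convexHull_min (fun w hw => hg w hw) hc hy

theorem affineMap_eq_of_mem_affineSpan {A : Finset E} {y : E} (hy : y ∈ affineSpan ℝ (A : Set E))
    {g g' : E →ᵃ[ℝ] ℝ} (h : ∀ w ∈ A, g w = g' w) : g y = g' y := by
  obtain ⟨c, h1, rfl⟩ := exists_sum_smul_eq_of_mem_affineSpan hy
  rw [affineMap_sum_smul _ _ _ _ h1, affineMap_sum_smul _ _ _ _ h1]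
  exact Finset.sum_congr rfl fun w hw => by rw [h w hw]

theorem affineMap_eq_of_affineSpan_eq_top {A : Finset E} (hA : affineSpan ℝ (A : Set E) = ⊤)
    {g g' : E →ᵃ[ℝ] ℝ} (h : ∀ w ∈ A, g w = g' w) : g = g' :=
  AffineMap.ext fun y => affineMap_eq_of_mem_affineSpan (by rw [hA]; trivial) h

/-- Affine interpolation of arbitrary values on an affinely independent set. -/
theorem exists_affineMap_eq_on [FiniteDimensional ℝ E] {A : Finset E}
    (hA : AffIndep A) (φ : E → ℝ) :
    ∃ g : E →ᵃ[ℝ] ℝ, ∀ w ∈ A, g w = φ w := by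
  obtain ⟨t, hAt, ht, htop⟩ := exists_subset_affineIndependent_affineSpan_eq_top
    (k := ℝ) (s := (A : Set E)) hA
  have hfin : Finite t := finite_set_of_fin_dim_affineIndependent ℝ ht
  let b : AffineBasis t ℝ E := ⟨(↑), ht, by simpa using htop⟩
  have := Fintype.ofFinite t
  refine ⟨∑ i : t, φ i • b.coord i, fun w hw => ?_⟩
  have hcoe : ∀ (s : Finset t), (∑ i ∈ s, φ i • b.coord i) w = ∑ i ∈ s, φ i * b.coord i w := by
    intro s
    induction s using Finset.induction_on with
    | empty => simp
    | insert a s ha ih => rw [Finset.sum_insert ha, Finset.sum_insert ha, ← ih]; simp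
  rw [hcoe]
  have hb : ∀ i : t, b.coord i w = if i = ⟨w, hAt hw⟩ then 1 else 0 := fun i => by
    have : b ⟨w, hAt hw⟩ = w := rfl
    conv_lhs => rw [← this, b.coord_apply]
  simp [hb]

/-- The barycentric coordinate functions of a simplex, extended to affine functions. -/
theorem exists_affineMap_coord [FiniteDimensional ℝ E] {A : Finset E}
    (hA : AffIndep A) :
    ∃ u : E → (E →ᵃ[ℝ] ℝ), (∀ a, ∀ w ∈ A, u a w = if w = a then 1 else 0) ∧
      (∀ c : E → ℝ, ∑ w ∈ A, c w = 1 → ∀ a ∈ A, u a (∑ w ∈ A, c w • w) = c a) ∧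
      ∀ y ∈ affineSpan ℝ (A : Set E), ∑ a ∈ A, u a y = 1 ∧ ∑ a ∈ A, u a y • a = y := by
  have h : ∀ a : E, ∃ g : E →ᵃ[ℝ] ℝ, ∀ w ∈ A, g w = if w = a then 1 else 0 := fun a =>
    exists_affineMap_eq_on hA (fun w => if w = a then 1 else 0)
  choose u hu using h
  have key : ∀ c : E → ℝ, ∑ w ∈ A, c w = 1 → ∀ a ∈ A, u a (∑ w ∈ A, c w • w) = c a := by
    intro c hc a ha
    rw [affineMap_sum_smul _ _ _ _ hc, Finset.sum_congr rfl fun w hw => by rw [hu a w hw]]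
    simp [ha]
  refine ⟨u, hu, key, fun y hy => ?_⟩
  obtain ⟨c, h1, rfl⟩ := exists_sum_smul_eq_of_mem_affineSpan hy
  rw [Finset.sum_congr rfl (key c h1), h1,
    Finset.sum_congr rfl fun a ha => by rw [key c h1 a ha]]
  exact ⟨rfl, rfl⟩

theorem affineIndependent_insert {F : Finset E} {v : E} (hF : AffIndep F)
    (hv : v ∉ affineSpan ℝ (F : Set E)) :
    AffIndep (insert v F) := by
  let i : (insert v F : Finset E) := ⟨v, Finset.mem_insert_self v F⟩
  refine AffineIndependent.affineIndependent_of_notMem_span (i := i) ?_ ?_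
  · let e : {y : (insert v F : Finset E) // y ≠ i} → F := fun y => ⟨y, by
      have := y.1.2
      rcases Finset.mem_insert.1 this with h | h
      · exact absurd (Subtype.ext h) y.2
      · exact h⟩
    have he : Function.Injective e := fun a b h => by
      apply Subtype.ext; apply Subtype.ext
      exact congrArg (fun z : F => (z : E)) h
    exact hF.comp_embedding ⟨e, he⟩
  · refine fun h => hv (affineSpan_mono ℝ ?_ h)
    rintro _ ⟨y, hy, rfl⟩
    rcases Finset.mem_insert.1 y.2 with h | h
    · exact absurd (Subtype.ext h) hy
    · exact h

/-- A point with positive barycentric coordinates lies in the relative interior. -/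
theorem sum_smul_mem_intrinsicInterior [FiniteDimensional ℝ E] {A : Finset E}
    (hA : AffIndep A) {c : E → ℝ} (h0 : ∀ w ∈ A, 0 < c w)
    (h1 : ∑ w ∈ A, c w = 1) :
    ∑ w ∈ A, c w • w ∈ intrinsicInterior ℝ (convexHull ℝ (A : Set E)) := by
  obtain ⟨u, -, hu, hspan⟩ := exists_affineMap_coord hA
  rw [mem_intrinsicInterior]
  have hmem := sum_smul_mem_affineSpan h1
  have hAspan : affineSpan ℝ (convexHull ℝ (A : Set E)) = affineSpan ℝ (A : Set E) :=
    affineSpan_convexHull _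
  refine ⟨⟨_, hAspan ▸ hmem⟩, ?_, rfl⟩
  rw [mem_interior]
  refine ⟨⋂ a ∈ A, (fun y : affineSpan ℝ (convexHull ℝ (A : Set E)) => u a y) ⁻¹' Set.Ioi 0,
    ?_, ?_, ?_⟩
  · intro y hy
    have hy' : (y : E) ∈ affineSpan ℝ (A : Set E) := hAspan.le y.2
    obtain ⟨e1, e2⟩ := hspan y hy'
    simp only [Set.mem_iInter, Set.mem_preimage, Set.mem_Ioi] at hy
    change (y : E) ∈ convexHull ℝ (A : Set E)
    rw [← e2]
    exact sum_smul_mem_convexHull (fun a ha => (hy a ha).le) e1 (fun a ha _ => ha)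
  · refine A.finite_toSet.isOpen_biInter fun a _ => isOpen_Ioi.preimage ?_
    exact (AffineMap.continuous_of_finiteDimensional (u a)).comp continuous_subtype_val
  · simp only [Set.mem_iInter, Set.mem_preimage, Set.mem_Ioi]
    intro a ha
    change 0 < u a (∑ w ∈ A, c w • w)
    rw [hu c h1 a ha]
    exact h0 a ha

theorem exists_relation_of_not_affIndep {F : Finset E} (hF : ¬ AffIndep F) :
    ∃ c : E → ℝ, ∑ w ∈ F, c w = 0 ∧ ∑ w ∈ F, c w • w = 0 ∧ ∃ w ∈ F, c w ≠ 0 :=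
  let ⟨c, h1, h0, h2⟩ := exists_nontrivial_relation_sum_zero_of_not_affine_ind hF
  ⟨c, h0, h1, h2⟩

/-- An affine relation is respected by affine functions. -/
theorem affineMap_sum_mul_eq_zero (g : E →ᵃ[ℝ] ℝ) {F : Finset E} {c : E → ℝ}
    (h0 : ∑ w ∈ F, c w = 0) (h1 : ∑ w ∈ F, c w • w = 0) : ∑ w ∈ F, c w * g w = 0 := by
  have h : ∀ x, g x = g.linear x + g 0 := fun x => by
    have := g.map_vadd 0 x
    simpa using this
  generalize g 0 = k at h
  have h2 : ∑ w ∈ F, c w * g w = g.linear (∑ w ∈ F, c w • w) + (∑ w ∈ F, c w) * k := by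
    rw [map_sum, Finset.sum_mul, ← Finset.sum_add_distrib]
    exact Finset.sum_congr rfl fun w _ => by rw [h w, mul_add]; simp
  rw [h2, h0, h1]; simp

/-- Finitely many strict inequalities survive a small perturbation. -/
theorem exists_pos_forall_add_mul_pos {ι : Type*} (V : Finset ι) (f h : ι → ℝ) :
    ∃ ε > 0, ∀ t : ℝ, |t| ≤ ε → ∀ w ∈ V, 0 < f w → 0 < f w + t * h w := by
  induction V using Finset.induction_on with
  | empty => exact ⟨1, one_pos, by simp⟩
  | insert a s ha ih =>
    obtain ⟨ε, hε, H⟩ := ih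
    by_cases hfa : 0 < f a
    · refine ⟨min ε (f a / (|h a| + 1)), by positivity, fun t ht w hw hfw => ?_⟩
      rcases Finset.mem_insert.1 hw with rfl | hw
      · have h1 : |t| ≤ f w / (|h w| + 1) := ht.trans (min_le_right _ _)
        rw [le_div_iff₀ (by positivity)] at h1
        have h2 : -(|t| * |h w|) ≤ t * h w := by
          rw [← abs_mul]; exact neg_abs_le _
        by_cases ht0 : t = 0
        · simpa [ht0] using hfw
        · have : 0 < |t| := abs_pos.2 ht0
          nlinarith
      · exact H t (ht.trans (min_le_left _ _)) w hw hfw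
    · refine ⟨ε, hε, fun t ht w hw hfw => ?_⟩
      rcases Finset.mem_insert.1 hw with rfl | hw
      · exact absurd hfw hfa
      · exact H t ht w hw hfw

/-- `g` is an affine function agreeing with `Ψ` on `F` and strictly below it on the rest of `V`. -/
def StrictSupport (V : Finset E) (Ψ : E → ℝ) (F : Finset E) (g : E →ᵃ[ℝ] ℝ) : Prop :=
  (∀ w ∈ F, g w = Ψ w) ∧ ∀ w ∈ V, w ∉ F → g w < Ψ w

/-- `F` spans a face of the lower hull of the lifting `Ψ` of the points `V`. -/
def Supported (V : Finset E) (Ψ : E → ℝ) (F : Finset E) : Prop :=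
  F ⊆ V ∧ ∃ g, StrictSupport V Ψ F g

/-- The simplices of `K` are the lower faces of the lifting `Ψ` of `V` that lie in `P`. -/
def IsRegularIn (V : Finset E) (Ψ : E → ℝ) (P : Set E)
    (K : Geometry.SimplicialComplex ℝ E) : Prop :=
  K.faces = {F | F.Nonempty ∧ Supported V Ψ F ∧ convexHull ℝ (F : Set E) ⊆ P}

theorem StrictSupport.le {V F : Finset E} {Ψ : E → ℝ} {g : E →ᵃ[ℝ] ℝ}
    (h : StrictSupport V Ψ F g) {w : E} (hw : w ∈ V) : g w ≤ Ψ w := by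
  by_cases hF : w ∈ F
  · exact (h.1 w hF).le
  · exact (h.2 w hw hF).le

theorem Supported.mono [FiniteDimensional ℝ E] {V F F' : Finset E} {Ψ : E → ℝ}
    (hF : AffIndep F) (h : Supported V Ψ F) (hF' : F' ⊆ F) : Supported V Ψ F' := by
  obtain ⟨hV, g, hg⟩ := h
  obtain ⟨u, hu⟩ := exists_affineMap_eq_on hF (fun w => if w ∈ F' then 0 else 1)
  obtain ⟨ε, hε, H⟩ := exists_pos_forall_add_mul_pos V (fun w => Ψ w - g w) u
  refine ⟨hF'.trans hV, g - ε • u, fun w hw => ?_, fun w hw hwF' => ?_⟩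
  · simp [hg.1 w (hF' hw), hu w (hF' hw), hw]
  · by_cases hwF : w ∈ F
    · have := hu w hwF
      simp only [hwF', if_false] at this
      simp [hg.1 w hwF, this, hε]
    · have := H ε (abs_of_pos hε).le w hw (sub_pos.2 (hg.2 w hw hwF))
      simp only [AffineMap.coe_sub, AffineMap.coe_smul, Pi.sub_apply, Pi.smul_apply, smul_eq_mul]
      linarith

/-- If a point of a supported `F` with coordinates `c` lies in the hull of a supported `G`, then
only vertices of `F ∩ G` have nonzero coordinates. -/
theorem Supported.coord_eq_zero {V F G : Finset E} {Ψ : E → ℝ} (hF : Supported V Ψ F)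
    (hG : Supported V Ψ G) {c : E → ℝ} (h0 : ∀ w ∈ F, 0 ≤ c w) (h1 : ∑ w ∈ F, c w = 1)
    (hy : ∑ w ∈ F, c w • w ∈ convexHull ℝ (G : Set E)) {w : E} (hw : w ∈ F) (hwG : w ∉ G) :
    c w = 0 := by
  obtain ⟨hFV, f, hf⟩ := hF
  obtain ⟨hGV, g, hg⟩ := hG
  obtain ⟨d, d0, d1, d2⟩ := exists_sum_smul_eq_of_mem_convexHull hy
  have e1 : f (∑ w ∈ F, c w • w) = ∑ w ∈ F, c w * Ψ w := by
    rw [affineMap_sum_smul _ _ _ _ h1]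
    exact Finset.sum_congr rfl fun w hw => by rw [hf.1 w hw]
  have e2 : g (∑ w ∈ F, c w • w) = ∑ w ∈ G, d w * Ψ w := by
    rw [← d2, affineMap_sum_smul _ _ _ _ d1]
    exact Finset.sum_congr rfl fun w hw => by rw [hg.1 w hw]
  have e3 : f (∑ w ∈ F, c w • w) ≤ ∑ w ∈ G, d w * Ψ w := by
    rw [← d2, affineMap_sum_smul _ _ _ _ d1]
    exact Finset.sum_le_sum fun w hw => mul_le_mul_of_nonneg_left (hf.le (hGV hw)) (d0 w hw)
  have e4 : g (∑ w ∈ F, c w • w) = ∑ w ∈ F, c w * g w := affineMap_sum_smul _ _ _ _ h1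
  have hnn : ∀ w ∈ F, 0 ≤ c w * Ψ w - c w * g w := fun w hw => by
    have := mul_le_mul_of_nonneg_left (hg.le (hFV hw)) (h0 w hw)
    linarith
  have hs : ∑ w ∈ F, (c w * Ψ w - c w * g w) = 0 := by
    refine le_antisymm ?_ (Finset.sum_nonneg hnn)
    rw [Finset.sum_sub_distrib]; linarith
  have := (Finset.sum_eq_zero_iff_of_nonneg hnn).1 hs w hw
  have h3 := hg.2 w (hFV hw) hwG
  have : c w * (Ψ w - g w) = 0 := by linarith
  rcases mul_eq_zero.1 this with h | h
  · exact h
  · linarith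

theorem Supported.inter_subset {V F G : Finset E} {Ψ : E → ℝ} (hF : Supported V Ψ F)
    (hG : Supported V Ψ G) :
    convexHull ℝ (F : Set E) ∩ convexHull ℝ (G : Set E) ⊆ convexHull ℝ (F ∩ G : Set E) := by
  rintro y ⟨hyF, hyG⟩
  obtain ⟨c, h0, h1, rfl⟩ := exists_sum_smul_eq_of_mem_convexHull hyF
  refine sum_smul_mem_convexHull h0 h1 fun w hw hcw => ⟨hw, ?_⟩
  by_contra hwG
  exact hcw (hF.coord_eq_zero hG h0 h1 hyG hw hwG)

/-- The complex of supported simplices inside `P`. -/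
theorem exists_isRegularIn [FiniteDimensional ℝ E] {V : Finset E} {Ψ : E → ℝ} (P : Set E)
    (hI : ∀ F, Supported V Ψ F → AffIndep F) :
    ∃ K : Geometry.SimplicialComplex ℝ E, IsRegularIn V Ψ P K :=
  ⟨{ faces := {F | F.Nonempty ∧ Supported V Ψ F ∧ convexHull ℝ (F : Set E) ⊆ P}
     isRelLowerSet_faces := fun F hF => ⟨hF.1, fun F' h hne =>
       ⟨hne, hF.2.1.mono (hI F hF.2.1) h,
        (convexHull_mono (by exact_mod_cast h)).trans hF.2.2⟩⟩
     indep := fun {s} hs => hI s hs.2.1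
     inter_subset_convexHull := fun hs ht => hs.2.1.inter_subset ht.2.1 }, rfl⟩

/-- If `F` and its facets are all supported, then `F` is affinely independent. -/
theorem affIndep_of_supported {V F : Finset E} {Ψ : E → ℝ} (hF : Supported V Ψ F)
    (hF' : ∀ w ∈ F, Supported V Ψ (F.erase w)) : AffIndep F := by
  by_contra hind
  obtain ⟨c, h0, h1, a, ha, hca⟩ := exists_relation_of_not_affIndep hind
  obtain ⟨hFV, f, hf⟩ := hF
  obtain ⟨-, g, hg⟩ := hF' a ha
  have e1 := affineMap_sum_mul_eq_zero f h0 h1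
  have e2 := affineMap_sum_mul_eq_zero g h0 h1
  have e3 : ∑ w ∈ F, c w * (f w - g w) = 0 := by
    simp_rw [mul_sub]; rw [Finset.sum_sub_distrib, e1, e2, sub_zero]
  rw [Finset.sum_eq_single_of_mem a ha] at e3
  · have := hg.2 a (hFV ha) (Finset.notMem_erase a F)
    rw [hf.1 a ha] at e3
    rcases mul_eq_zero.1 e3 with h | h
    · exact hca h
    · linarith
  · intro w hw hwa
    rw [hf.1 w hw, hg.1 w (Finset.mem_erase.2 ⟨hwa, hw⟩), sub_self, mul_zero]

/-- Radon-type exchange: the hull of a circuit is covered by the facets opposite to its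
positive vertices. -/
theorem exists_mem_convexHull_erase {Z : Finset E} {c : E → ℝ} (h0 : ∑ w ∈ Z, c w = 0)
    (h1 : ∑ w ∈ Z, c w • w = 0) (hpos : ∃ a ∈ Z, 0 < c a) {y : E}
    (hy : y ∈ convexHull ℝ (Z : Set E)) :
    ∃ a ∈ Z, 0 < c a ∧ y ∈ convexHull ℝ ((Z.erase a : Finset E) : Set E) := by
  obtain ⟨l, l0, l1, rfl⟩ := exists_sum_smul_eq_of_mem_convexHull hy
  obtain ⟨a, ha, hmin⟩ := Finset.exists_min_image (Z.filter fun a => 0 < c a) (fun w => l w / c w)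
    (by obtain ⟨a, ha, hca⟩ := hpos; exact ⟨a, Finset.mem_filter.2 ⟨ha, hca⟩⟩)
  rw [Finset.mem_filter] at ha
  refine ⟨a, ha.1, ha.2, ?_⟩
  set t := l a / c a with ht
  have ht0 : 0 ≤ t := div_nonneg (l0 a ha.1) ha.2.le
  have e1 : ∑ w ∈ Z, (l w - t * c w) = 1 := by
    rw [Finset.sum_sub_distrib, ← Finset.mul_sum, h0, l1]; simp
  have e2 : ∑ w ∈ Z, l w • w = ∑ w ∈ Z, (l w - t * c w) • w := by
    simp_rw [sub_smul, mul_smul]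
    rw [Finset.sum_sub_distrib, ← Finset.smul_sum, h1]; simp
  rw [e2]
  refine sum_smul_mem_convexHull (fun w hw => ?_) e1 fun w hw hne => ?_
  · by_cases hcw : 0 < c w
    · have := hmin w (Finset.mem_filter.2 ⟨hw, hcw⟩)
      rw [le_div_iff₀ hcw] at this
      linarith
    · have := l0 w hw
      nlinarith
  · refine Finset.mem_coe.2 (Finset.mem_erase.2 ⟨fun h => hne ?_, hw⟩)
    subst h
    rw [ht, div_mul_cancel₀ _ ha.2.ne', sub_self]

theorem BistellarMove.symm {n : ℕ} {K K' : Geometry.SimplicialComplex ℝ E}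
    (h : BistellarMove n K K') : BistellarMove n K' K := by
  obtain ⟨A, B, hA, hB, hBne, hcard, hlink, hfaces, hspace⟩ := h
  have hAne : A.Nonempty := K.nonempty_of_mem_faces hA
  have hl : ∀ C : Finset E, (C.Nonempty ∧ Disjoint A C ∧ A ∪ C ∈ K.faces) ↔
      (C.Nonempty ∧ C ⊂ B) := fun C => by
    have := Set.ext_iff.1 hlink C
    simpa using this
  have hf : ∀ s, s ∈ K'.faces ↔ (s ∈ K.faces ∧ ¬ A ⊆ s) ∨ ∃ A' : Finset E, A' ⊂ A ∧ s = A' ∪ B :=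
    fun s => by rw [hfaces]; rfl
  have hdis : Disjoint A B := by
    rw [Finset.disjoint_right]
    intro b hb hbA
    by_cases hs : ({b} : Finset E) ⊂ B
    · have := ((hl {b}).2 ⟨Finset.singleton_nonempty b, hs⟩).2.1
      exact Finset.disjoint_right.1 this (Finset.mem_singleton_self b) hbA
    · have hBb : B = {b} := by
        by_contra hne
        exact hs ((Finset.singleton_subset_iff.2 hb).ssubset_of_ne (Ne.symm hne))
      refine hB (K.down_closed hA ?_ hBne)
      rw [hBb]; exact Finset.singleton_subset_iff.2 hbA
  have hnB : ∀ s ∈ K.faces, ¬ B ⊆ s := fun s hs h => hB (K.down_closed hs h hBne)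
  refine ⟨B, A, ?_, ?_, hAne, by omega, ?_, ?_, hspace.symm⟩
  · rw [hf]; right
    exact ⟨∅, Finset.empty_ssubset.2 hAne, by simp⟩
  · rw [hf]
    rintro (h | ⟨A', -, h⟩)
    · exact h.2 subset_rfl
    · exact hnB A hA (by rw [h]; exact Finset.subset_union_right)
  · ext C
    constructor
    · rintro ⟨hC, hd, h⟩
      rcases (hf _).1 h with h | ⟨A', hA', h⟩
      · exact absurd Finset.subset_union_left (hnB _ h.1)
      · refine ⟨hC, ?_⟩
        have : C = A' := by
          have hd' : Disjoint A' B := hdis.mono_left hA'.subset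
          ext x
          have hx := Finset.ext_iff.1 h x
          simp only [Finset.mem_union] at hx
          have h1 : x ∈ B → x ∉ C := fun a b => Finset.disjoint_left.1 hd a b
          have h2 : x ∈ A' → x ∉ B := fun a b => Finset.disjoint_left.1 hd' a b
          tauto
        rw [this]; exact hA'
    · rintro ⟨hC, hCA⟩
      exact ⟨hC, hdis.symm.mono_right hCA.subset, (hf _).2 (Or.inr ⟨C, hCA, Finset.union_comm _ _⟩)⟩
  · ext s
    constructor
    · intro hs
      by_cases hAs : A ⊆ s
      · right
        have hun : A ∪ (s \ A) = s := Finset.union_sdiff_of_subset hAs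
        by_cases hne : (s \ A).Nonempty
        · refine ⟨s \ A, ((hl _).1 ⟨hne, Finset.disjoint_sdiff, by rwa [hun]⟩).2, ?_⟩
          rw [Finset.union_comm, hun]
        · refine ⟨∅, Finset.empty_ssubset.2 hBne, ?_⟩
          rw [Finset.not_nonempty_iff_eq_empty] at hne
          rw [hne] at hun
          rw [← hun]; simp
      · exact Or.inl ⟨(hf s).2 (Or.inl ⟨hs, hAs⟩), hnB s hs⟩
    · rintro (⟨hs, hBs⟩ | ⟨B', hB', rfl⟩)
      · rcases (hf s).1 hs with h | ⟨A', -, rfl⟩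
        · exact h.1
        · exact absurd Finset.subset_union_right hBs
      · rcases B'.eq_empty_or_nonempty with rfl | hne
        · simpa using hA
        · rw [Finset.union_comm]
          exact ((hl B').2 ⟨hne, hB'⟩).2.2

/-- Two complexes are related by bistellar moves fixing `M`. -/
def BistellarEquiv (n : ℕ) (M : Geometry.SimplicialComplex ℝ E) :
    Geometry.SimplicialComplex ℝ E → Geometry.SimplicialComplex ℝ E → Prop :=
  Relation.ReflTransGen
    (fun X Y => BistellarMove n X Y ∧ M.faces ⊆ X.faces ∧ M.faces ⊆ Y.faces)

theorem BistellarEquiv.symm {n : ℕ} {M X Y : Geometry.SimplicialComplex ℝ E}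
    (h : BistellarEquiv n M X Y) : BistellarEquiv n M Y X := by
  induction h with
  | refl => exact Relation.ReflTransGen.refl
  | tail _ h ih => exact Relation.ReflTransGen.head ⟨h.1.symm, h.2.2, h.2.1⟩ ih

/-- A point outside an affine span is separated from it by an affine function. -/
theorem exists_affineMap_vanishing [FiniteDimensional ℝ E] {C : Finset E} {p : E}
    (hp : p ∉ affineSpan ℝ (C : Set E)) :
    ∃ u : E →ᵃ[ℝ] ℝ, (∀ w ∈ C, u w = 0) ∧ u p = 1 := by
  obtain ⟨t, htC, hspan, hind⟩ := exists_affineIndependent ℝ E (C : Set E)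
  have hfin : t.Finite := C.finite_toSet.subset htC
  lift t to Finset E using hfin
  obtain ⟨u, hu⟩ := exists_affineMap_eq_on (affineIndependent_insert (v := p) (F := t) hind
    (by rwa [hspan])) (fun w => if w = p then 1 else 0)
  refine ⟨u, fun w hw => ?_, by simpa using hu p (Finset.mem_insert_self _ _)⟩
  have hw' : w ∈ affineSpan ℝ (t : Set E) := by
    rw [hspan]; exact subset_affineSpan ℝ _ hw
  have hpt : ∀ x ∈ t, x ≠ p := fun x hx h => hp (by
    rw [← hspan, ← h]; exact subset_affineSpan ℝ _ hx)
  have := affineMap_eq_of_mem_affineSpan hw' (g := u) (g' := AffineMap.const ℝ E 0)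
    (fun x hx => by simpa [hpt x hx] using hu x (Finset.mem_insert_of_mem hx))
  simpa using this

/-- A linear program over the weak supports of a lifting attains its bound at a support whose
contact set is full-dimensional. -/
theorem exists_full_support [FiniteDimensional ℝ E] {V : Finset E} {Ψ : E → ℝ}
    (hV : affineSpan ℝ (V : Set E) = ⊤) {F : Finset E} (hFV : F ⊆ V) (v : E) {κ m : ℝ}
    (hbd : ∀ g : E →ᵃ[ℝ] ℝ, (∀ w ∈ V, g w ≤ Ψ w) → (∀ w ∈ F, g w = Ψ w) → m ≤ κ * g v)
    (g₀ : E →ᵃ[ℝ] ℝ) (h₀ : ∀ w ∈ V, g₀ w ≤ Ψ w) (h₀F : ∀ w ∈ F, g₀ w = Ψ w) :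
    ∃ (σ : Finset E) (g : E →ᵃ[ℝ] ℝ), σ ⊆ V ∧ StrictSupport V Ψ σ g ∧
      affineSpan ℝ (σ : Set E) = ⊤ ∧ F ⊆ σ ∧ m ≤ κ * g v ∧ κ * g v ≤ κ * g₀ v := by
  induction hk : (V.filter fun w => g₀ w < Ψ w).card using Nat.strong_induction_on
    generalizing g₀ with
  | _ k ih =>
  by_cases htop : affineSpan ℝ ((V.filter fun w => g₀ w = Ψ w : Finset E) : Set E) = ⊤
  · refine ⟨_, g₀, Finset.filter_subset _ _, ⟨fun w hw => (Finset.mem_filter.1 hw).2,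
      fun w hw hwC => lt_of_le_of_ne (h₀ w hw) fun h => hwC (Finset.mem_filter.2 ⟨hw, h⟩)⟩, htop,
      fun w hw => Finset.mem_filter.2 ⟨hFV hw, h₀F w hw⟩, hbd _ h₀ h₀F, le_rfl⟩
  obtain ⟨p, hp⟩ : ∃ p, p ∉ affineSpan ℝ ((V.filter fun w => g₀ w = Ψ w : Finset E) : Set E) := by
    by_contra! h
    exact htop (eq_top_iff.2 fun x _ => h x)
  obtain ⟨u₀, hu₀, hu₀p⟩ := exists_affineMap_vanishing hp
  obtain ⟨w₀, hw₀V, hw₀⟩ : ∃ w ∈ V, u₀ w ≠ 0 := by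
    by_contra! h
    have := affineMap_eq_of_affineSpan_eq_top hV (g := u₀) (g' := AffineMap.const ℝ E 0)
      (by simpa using h)
    rw [this] at hu₀p
    simp at hu₀p
  obtain ⟨u, hu, huv, w₁, hw₁V, hw₁⟩ : ∃ u : E →ᵃ[ℝ] ℝ, (∀ w ∈ V, g₀ w = Ψ w → u w = 0) ∧
      κ * u v ≤ 0 ∧ ∃ w ∈ V, 0 < u w := by
    have hneg : ∀ u : E →ᵃ[ℝ] ℝ, (∀ w ∈ V, g₀ w = Ψ w → u w = 0) → κ * u v < 0 →
        ∃ w ∈ V, 0 < u w := by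
      intro u hu huv
      by_contra! hle
      obtain ⟨t, ht0, ht⟩ : ∃ t : ℝ, 0 ≤ t ∧ κ * g₀ v + t * (κ * u v) < m := by
        refine ⟨(|κ * g₀ v| + |m| + 1) / -(κ * u v), by
          have : 0 < -(κ * u v) := by linarith
          positivity, ?_⟩
        have : (|κ * g₀ v| + |m| + 1) / -(κ * u v) * (κ * u v) = -(|κ * g₀ v| + |m| + 1) := by
          rw [div_neg, neg_mul, div_mul_cancel₀ _ huv.ne]
        rw [this]
        linarith [le_abs_self (κ * g₀ v), neg_abs_le m]
      have := hbd (g₀ + t • u)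
        (fun w hw => by
          have := mul_nonneg ht0 (sub_nonneg.2 (hle w hw))
          simp only [AffineMap.coe_add, AffineMap.coe_smul, Pi.add_apply, Pi.smul_apply,
            smul_eq_mul]
          linarith [h₀ w hw])
        (fun w hw => by
          simp [h₀F w hw, hu w (hFV hw) (h₀F w hw)])
      simp only [AffineMap.coe_add, AffineMap.coe_smul, Pi.add_apply, Pi.smul_apply,
            smul_eq_mul] at this
      linarith
    have hu₀' : ∀ w ∈ V, g₀ w = Ψ w → u₀ w = 0 := fun w hw h =>
      hu₀ w (Finset.mem_filter.2 ⟨hw, h⟩)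
    have hu₀n : ∀ w ∈ V, g₀ w = Ψ w → (-u₀) w = 0 := fun w hw h => by
      simp [hu₀' w hw h]
    rcases lt_trichotomy (κ * u₀ v) 0 with h | h | h
    · exact ⟨u₀, hu₀', h.le, hneg _ hu₀' h⟩
    · rcases lt_or_gt_of_ne hw₀ with h' | h'
      · exact ⟨-u₀, hu₀n, by simp [h], w₀, hw₀V, by simpa using h'⟩
      · exact ⟨u₀, hu₀', h.le, w₀, hw₀V, h'⟩
    · have h' : κ * (-u₀) v < 0 := by simpa using h
      exact ⟨-u₀, hu₀n, h'.le, hneg _ hu₀n h'⟩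
  obtain ⟨a, ha, hmin⟩ := Finset.exists_min_image (V.filter fun w => 0 < u w)
    (fun w => (Ψ w - g₀ w) / u w) ⟨w₁, Finset.mem_filter.2 ⟨hw₁V, hw₁⟩⟩
  rw [Finset.mem_filter] at ha
  set t := (Ψ a - g₀ a) / u a with ht
  have ht0 : 0 ≤ t := div_nonneg (sub_nonneg.2 (h₀ a ha.1)) ha.2.le
  have hev : ∀ w, (g₀ + t • u) w = g₀ w + t * u w := fun w => by simp
  have hle : ∀ w ∈ V, (g₀ + t • u) w ≤ Ψ w := fun w hw => by
    rw [hev]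
    by_cases huw : 0 < u w
    · have := hmin w (Finset.mem_filter.2 ⟨hw, huw⟩)
      rw [le_div_iff₀ huw] at this
      linarith
    · have := h₀ w hw
      nlinarith
  have hla : (g₀ + t • u) a = Ψ a := by
    rw [hev, ht, div_mul_cancel₀ _ ha.2.ne']; ring
  have haC : g₀ a < Ψ a := lt_of_le_of_ne (h₀ a ha.1) fun h => by
    have := hu a ha.1 h
    linarith [ha.2]
  obtain ⟨σ, g, h1, h2, h3, h4, h5, h6⟩ := ih _ (by
    rw [← hk]
    refine Finset.card_lt_card ⟨fun w hw => ?_, fun h => ?_⟩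
    · rw [Finset.mem_filter] at hw ⊢
      refine ⟨hw.1, lt_of_le_of_ne (h₀ w hw.1) fun h => ?_⟩
      have := hw.2
      rw [hev, hu w hw.1 h, h] at this
      simp at this
    · have := h (Finset.mem_filter.2 ⟨ha.1, haC⟩)
      rw [Finset.mem_filter, hla] at this
      exact lt_irrefl _ this.2) (g₀ + t • u) hle
    (fun w hw => by rw [hev, h₀F w hw, hu w (hFV hw) (h₀F w hw)]; simp) rfl
  refine ⟨σ, g, h1, h2, h3, h4, h5, h6.trans ?_⟩
  rw [hev]
  nlinarith

/-- Subsets of `V` whose lifts lie on the graph of an affine function are affinely independent. -/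
def GeneralPosition (V : Finset E) (Ψ : E → ℝ) : Prop :=
  ∀ F ⊆ V, ∀ g : E →ᵃ[ℝ] ℝ, (∀ w ∈ F, g w = Ψ w) → AffIndep F

/-- `σ` is a full-dimensional lower face of the lifting, supported by `g`. -/
def FullSupport (V : Finset E) (Ψ : E → ℝ) (σ : Finset E) (g : E →ᵃ[ℝ] ℝ) : Prop :=
  σ ⊆ V ∧ StrictSupport V Ψ σ g ∧ affineSpan ℝ (σ : Set E) = ⊤

/-- The heights at which a lift of `v` lies on the hyperplane of a full-dimensional lower face. -/
def criticalHeights (V : Finset E) (Ψ : E → ℝ) (v : E) : Set ℝ :=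
  {c | ∃ σ g, FullSupport V Ψ σ g ∧ c = g v}

/-- `v` is in general position with respect to `V` and `Ψ`. -/
structure GenericPoint (V : Finset E) (Ψ : E → ℝ) (v : E) : Prop where
  notMem_affineSpan : ∀ F ⊆ V, affineSpan ℝ (F : Set E) ≠ ⊤ → v ∉ affineSpan ℝ (F : Set E)
  eq_of_apply_eq : ∀ σ τ g h, FullSupport V Ψ σ g → FullSupport V Ψ τ h → g v = h v → σ = τ

theorem FullSupport.unique {V : Finset E} {Ψ : E → ℝ} {σ : Finset E} {g h : E →ᵃ[ℝ] ℝ}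
    (hg : FullSupport V Ψ σ g) (hh : FullSupport V Ψ σ h) : g = h :=
  affineMap_eq_of_affineSpan_eq_top hg.2.2 fun w hw => by rw [hg.2.1.1 w hw, hh.2.1.1 w hw]

theorem finite_setOf_fullSupport (V : Finset E) (Ψ : E → ℝ) :
    {g : E →ᵃ[ℝ] ℝ | ∃ σ, FullSupport V Ψ σ g}.Finite := by
  have : {g : E →ᵃ[ℝ] ℝ | ∃ σ, FullSupport V Ψ σ g} ⊆
      ⋃ σ ∈ V.powerset, {g | FullSupport V Ψ σ g} := by
    rintro g ⟨σ, hg⟩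
    simp only [Set.mem_iUnion]
    exact ⟨σ, Finset.mem_powerset.2 hg.1, hg⟩
  refine Set.Finite.subset (V.powerset.finite_toSet.biUnion fun σ _ => ?_) this
  exact Set.Subsingleton.finite fun g hg h hh => FullSupport.unique hg hh

theorem finite_criticalHeights (V : Finset E) (Ψ : E → ℝ) (v : E) :
    (criticalHeights V Ψ v).Finite := by
  refine ((finite_setOf_fullSupport V Ψ).image fun g => g v).subset ?_
  rintro c ⟨σ, g, hg, rfl⟩
  exact ⟨g, ⟨σ, hg⟩, rfl⟩

theorem strictSupport_insert_iff {V F : Finset E} {Ψ : E → ℝ} {v : E} (hv : v ∉ V)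
    {z : ℝ} {g : E →ᵃ[ℝ] ℝ} :
    (F ⊆ insert v V ∧ StrictSupport (insert v V) (Function.update Ψ v z) F g) ↔
      F.erase v ⊆ V ∧ StrictSupport V Ψ (F.erase v) g ∧ (v ∈ F → g v = z) ∧
        (v ∉ F → g v < z) := by
  have hne : ∀ w ∈ V, w ≠ v := fun w hw h => hv (h ▸ hw)
  constructor
  · rintro ⟨hF, h1, h2⟩
    refine ⟨Finset.subset_insert_iff.1 hF, ⟨fun w hw => ?_, fun w hw hwF => ?_⟩, fun h => ?_,
      fun h => ?_⟩
    · rw [Finset.mem_erase] at hw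
      simpa [Function.update_of_ne hw.1] using h1 w hw.2
    · have := h2 w (Finset.mem_insert_of_mem hw) fun h => hwF (Finset.mem_erase.2 ⟨hne w hw, h⟩)
      simpa [Function.update_of_ne (hne w hw)] using this
    · simpa using h1 v h
    · simpa using h2 v (Finset.mem_insert_self _ _) h
  · rintro ⟨hF, ⟨h1, h2⟩, h3, h4⟩
    refine ⟨Finset.subset_insert_iff.2 hF, fun w hw => ?_, fun w hw hwF => ?_⟩
    · by_cases hwv : w = v
      · subst hwv; simpa using h3 hw
      · rw [Function.update_of_ne hwv]; exact h1 w (Finset.mem_erase.2 ⟨hwv, hw⟩)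
    · by_cases hwv : w = v
      · subst hwv; simpa using h4 hwF
      · rw [Function.update_of_ne hwv]
        exact h2 w ((Finset.mem_insert.1 hw).resolve_left hwv)
          fun h => hwF (Finset.mem_of_mem_erase h)

/-- `F` is a lower face after adding `v` at height `z`. -/
def SupportedAt (V : Finset E) (Ψ : E → ℝ) (v : E) (z : ℝ) (F : Finset E) : Prop :=
  Supported (insert v V) (Function.update Ψ v z) F

theorem supportedAt_iff {V F : Finset E} {Ψ : E → ℝ} {v : E} (hv : v ∉ V) {z : ℝ} :
    SupportedAt V Ψ v z F ↔ ∃ g, F.erase v ⊆ V ∧ StrictSupport V Ψ (F.erase v) g ∧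
      (v ∈ F → g v = z) ∧ (v ∉ F → g v < z) := by
  rw [SupportedAt, Supported, ← exists_and_left]
  exact exists_congr fun g => strictSupport_insert_iff hv

theorem SupportedAt.affIndep [FiniteDimensional ℝ E] {V F : Finset E} {Ψ : E → ℝ} {v : E}
    (hv : v ∉ V) (hGP : GeneralPosition V Ψ) (hgen : GenericPoint V Ψ v) {z : ℝ}
    (hz : z ∉ criticalHeights V Ψ v) (hF : SupportedAt V Ψ v z F) : AffIndep F := by
  obtain ⟨g, hFV, hg, h1, h2⟩ := (supportedAt_iff hv).1 hF
  have hind := hGP _ hFV g hg.1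
  by_cases hvF : v ∈ F
  · by_cases htop : affineSpan ℝ ((F.erase v : Finset E) : Set E) = ⊤
    · exact absurd ⟨_, g, ⟨hFV, hg, htop⟩, (h1 hvF).symm⟩ hz
    · have := affineIndependent_insert hind (hgen.notMem_affineSpan _ hFV htop)
      rwa [Finset.insert_erase hvF] at this
  · rwa [Finset.erase_eq_of_notMem hvF] at hind

/-- Convex combinations of a weak support with a strict support are strict. -/
theorem StrictSupport.mix {V F : Finset E} {Ψ : E → ℝ} {g g' : E →ᵃ[ℝ] ℝ}
    (hg : StrictSupport V Ψ F g) (h' : ∀ w ∈ V, g' w ≤ Ψ w) (h'F : ∀ w ∈ F, g' w = Ψ w) {s : ℝ}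
    (hs0 : 0 < s) (hs1 : s ≤ 1) : StrictSupport V Ψ F ((1 - s) • g' + s • g) := by
  refine ⟨fun w hw => ?_, fun w hw hwF => ?_⟩
  · simp only [AffineMap.coe_add, AffineMap.coe_smul, Pi.add_apply, Pi.smul_apply, smul_eq_mul]
    rw [hg.1 w hw, h'F w hw]; ring
  · simp only [AffineMap.coe_add, AffineMap.coe_smul, Pi.add_apply, Pi.smul_apply, smul_eq_mul]
    have h1 := hg.2 w hw hwF
    have h2 := h' w hw
    nlinarith

theorem exists_mix_lt {x y a : ℝ} (hx : x < a) : ∃ s : ℝ, 0 < s ∧ s ≤ 1 ∧ (1 - s) * x + s * y < a := by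
  refine ⟨min 1 ((a - x) / (2 * (|y - x| + 1))), by
    have : 0 < a - x := by linarith
    positivity, min_le_left _ _, ?_⟩
  set s := min 1 ((a - x) / (2 * (|y - x| + 1))) with hs
  have h1 : s ≤ (a - x) / (2 * (|y - x| + 1)) := min_le_right _ _
  have h0 : 0 < s := by
    have : 0 < a - x := by linarith
    positivity
  rw [le_div_iff₀ (by positivity)] at h1
  have := le_abs_self (y - x)
  nlinarith

theorem exists_mix_eq {x y a : ℝ} (hx : x < a ∧ a ≤ y ∨ a < x ∧ y ≤ a) :
    ∃ s : ℝ, 0 < s ∧ s ≤ 1 ∧ (1 - s) * x + s * y = a := by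
  refine ⟨(a - x) / (y - x), ?_, ?_, ?_⟩
  · rcases hx with h | h
    · exact div_pos (by linarith) (by linarith)
    · exact div_pos_of_neg_of_neg (by linarith) (by linarith)
  · rcases hx with h | h
    · rw [div_le_one (by linarith)]; linarith
    · rw [div_le_one_of_neg (by linarith)]; linarith
  · have : y - x ≠ 0 := by rcases hx with h | h <;> intro h' <;> linarith
    field_simp
    ring

/-- If a face changes between two heights, it lies in the join of `v` and a full-dimensional
face whose critical height is in between. -/
theorem exists_fullSupport_of_change [FiniteDimensional ℝ E] {V F : Finset E} {Ψ : E → ℝ} {v : E}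
    (hv : v ∉ V) (hV : affineSpan ℝ (V : Set E) = ⊤) {a b : ℝ} (hab : a < b)
    (hF : ¬ (SupportedAt V Ψ v a F ↔ SupportedAt V Ψ v b F)) :
    ∃ σ g, FullSupport V Ψ σ g ∧ F ⊆ insert v σ ∧ a ≤ g v ∧ g v ≤ b := by
  have hev : ∀ (s : ℝ) (g g' : E →ᵃ[ℝ] ℝ) (w : E),
      ((1 - s) • g' + s • g) w = (1 - s) * g' w + s * g w := fun s g g' w => by simp
  by_cases hb : SupportedAt V Ψ v b F
  · have ha : ¬ SupportedAt V Ψ v a F := fun h => hF (by simp [h, hb])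
    obtain ⟨g, hFV, hg, h1, h2⟩ := (supportedAt_iff hv).1 hb
    have hgb : g v ≤ b := by
      by_cases h : v ∈ F
      · exact (h1 h).le
      · exact (h2 h).le
    obtain ⟨σ, g', h3, h4, h5, h6, h7, h8⟩ := exists_full_support hV hFV v (κ := 1) (m := a)
      (fun g'' h'' h''F => by
        by_contra! hlt
        rw [one_mul] at hlt
        refine ha ((supportedAt_iff hv).2 ?_)
        by_cases hvF : v ∈ F
        · obtain ⟨s, hs0, hs1, hs⟩ := exists_mix_eq (x := g'' v) (y := g v) (a := a)
            (Or.inl ⟨hlt, by rw [h1 hvF]; exact hab.le⟩)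
          exact ⟨_, hFV, hg.mix h'' h''F hs0 hs1, fun _ => by rw [hev]; exact hs,
            fun h => absurd hvF h⟩
        · obtain ⟨s, hs0, hs1, hs⟩ := exists_mix_lt (x := g'' v) (y := g v) (a := a) hlt
          exact ⟨_, hFV, hg.mix h'' h''F hs0 hs1, fun h => absurd h hvF,
            fun _ => by rw [hev]; exact hs⟩)
      g (fun w hw => hg.le hw) hg.1
    exact ⟨σ, g', ⟨h3, h4, h5⟩, Finset.subset_insert_iff.2 h6, by linarith, by linarith⟩
  · have ha : SupportedAt V Ψ v a F := by
      by_contra h; exact hF (by simp [h, hb])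
    obtain ⟨g, hFV, hg, h1, h2⟩ := (supportedAt_iff hv).1 ha
    have hvF : v ∈ F := by
      by_contra hvF
      exact hb ((supportedAt_iff hv).2 ⟨g, hFV, hg, fun h => absurd h hvF,
        fun h => (h2 h).trans hab⟩)
    obtain ⟨σ, g', h3, h4, h5, h6, h7, h8⟩ := exists_full_support hV hFV v (κ := -1) (m := -b)
      (fun g'' h'' h''F => by
        by_contra! hlt
        refine hb ((supportedAt_iff hv).2 ?_)
        obtain ⟨s, hs0, hs1, hs⟩ := exists_mix_eq (x := g'' v) (y := g v) (a := b)
            (Or.inr ⟨by linarith, by rw [h1 hvF]; exact hab.le⟩)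
        exact ⟨_, hFV, hg.mix h'' h''F hs0 hs1, fun _ => by rw [hev]; exact hs,
            fun h => absurd hvF h⟩)
      g (fun w hw => hg.le hw) hg.1
    have := h1 hvF
    exact ⟨σ, g', ⟨h3, h4, h5⟩, Finset.subset_insert_iff.2 h6, by linarith, by linarith⟩

/-- Two complexes that agree outside the subsets of a circuit `A ∪ B` and contain the two
triangulations of that circuit are related by a bistellar move. -/
theorem bistellarMove_of_circuit {n : ℕ} {K K' : Geometry.SimplicialComplex ℝ E} {A B : Finset E}
    (hA : A.Nonempty) (hB : B.Nonempty) (hAB : Disjoint A B) (hcard : A.card + B.card = n + 2)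
    (hout : ∀ F, ¬ F ⊆ A ∪ B → (F ∈ K.faces ↔ F ∈ K'.faces))
    (hK : ∀ F ⊆ A ∪ B, F.Nonempty → (F ∈ K.faces ↔ ¬ B ⊆ F))
    (hK' : ∀ F ⊆ A ∪ B, F.Nonempty → (F ∈ K'.faces ↔ ¬ A ⊆ F))
    {c : E → ℝ} (h0 : ∑ w ∈ A ∪ B, c w = 0) (h1 : ∑ w ∈ A ∪ B, c w • w = 0)
    (hcA : ∀ w ∈ A, 0 < c w) (hcB : ∀ w ∈ B, c w < 0) : BistellarMove n K K' := by
  have hBA : ∀ C, B ⊆ A ∪ C → B ⊆ C := fun C h b hb =>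
    (Finset.mem_union.1 (h hb)).resolve_left (Finset.disjoint_right.1 hAB hb)
  have hAB' : ∀ C, A ⊆ C ∪ B → A ⊆ C := fun C h b hb =>
    (Finset.mem_union.1 (h hb)).resolve_right (Finset.disjoint_left.1 hAB hb)
  have hAK : A ∈ K.faces := (hK A Finset.subset_union_left hA).2 fun h => by
    obtain ⟨b, hb⟩ := hB
    exact Finset.disjoint_right.1 hAB hb (h hb)
  have hBK : B ∉ K.faces := fun h => (hK B Finset.subset_union_right hB).1 h subset_rfl
  have hBK' : B ∈ K'.faces := (hK' B Finset.subset_union_right hB).2 fun h => by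
    obtain ⟨b, hb⟩ := hA
    exact Finset.disjoint_left.1 hAB hb (h hb)
  have hAK' : A ∉ K'.faces := fun h => (hK' A Finset.subset_union_left hA).1 h subset_rfl
  have hsubA : ∀ F ∈ K.faces, A ⊆ F → F ⊆ A ∪ B := fun F hF hAF => by
    by_contra h
    exact hAK' (K'.down_closed ((hout F h).1 hF) hAF hA)
  have hsubB : ∀ F ∈ K'.faces, B ⊆ F → F ⊆ A ∪ B := fun F hF hBF => by
    by_contra h
    exact hBK (K.down_closed ((hout F h).2 hF) hBF hB)
  refine ⟨A, B, hAK, hBK, hB, hcard, ?_, ?_, ?_⟩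
  · ext C
    constructor
    · rintro ⟨hC, hd, hF⟩
      have hs := hsubA _ hF Finset.subset_union_left
      refine ⟨hC, fun x hx => ?_, fun h => ?_⟩
      · exact (Finset.mem_union.1 (hs (Finset.mem_union_right _ hx))).resolve_left
          (Finset.disjoint_right.1 hd hx)
      · exact (hK _ hs (hA.mono Finset.subset_union_left)).1 hF
          (h.trans Finset.subset_union_right)
    · rintro ⟨hC, hCB⟩
      refine ⟨hC, hAB.mono_right hCB.subset, (hK _ (Finset.union_subset_union_right hCB.subset)
        (hA.mono Finset.subset_union_left)).2 fun h => hCB.2 (hBA C h)⟩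
  · ext F
    constructor
    · intro hF
      by_cases hBF : B ⊆ F
      · have hs := hsubB F hF hBF
        refine Or.inr ⟨F \ B, ⟨fun x hx => ?_, fun h => ?_⟩,
          (Finset.sdiff_union_of_subset hBF).symm⟩
        · rw [Finset.mem_sdiff] at hx
          exact (Finset.mem_union.1 (hs hx.1)).resolve_right hx.2
        · exact (hK' F hs (hB.mono hBF)).1 hF (h.trans Finset.sdiff_subset)
      · refine Or.inl ?_
        by_cases hs : F ⊆ A ∪ B
        · exact ⟨(hK F hs (K'.nonempty_of_mem_faces hF)).2 hBF,
            (hK' F hs (K'.nonempty_of_mem_faces hF)).1 hF⟩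
        · exact ⟨(hout F hs).2 hF, fun h => hAK' (K'.down_closed hF h hA)⟩
    · rintro (⟨hF, hAF⟩ | ⟨A', hA', rfl⟩)
      · by_cases hs : F ⊆ A ∪ B
        · exact (hK' F hs (K.nonempty_of_mem_faces hF)).2 hAF
        · exact (hout F hs).1 hF
      · exact (hK' _ (Finset.union_subset_union_left hA'.subset)
          (hB.mono Finset.subset_union_right)).2 fun h => hA'.2 (hAB' A' h)
  · ext y
    simp only [Geometry.SimplicialComplex.mem_space_iff]
    constructor
    · rintro ⟨F, hF, hy⟩
      by_cases hs : F ⊆ A ∪ B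
      · obtain ⟨b, hb, hcb, hyb⟩ := exists_mem_convexHull_erase (Z := A ∪ B) (c := fun w => - c w)
          (by simp [h0]) (by simp [h1])
          (by obtain ⟨b, hb⟩ := hB
              exact ⟨b, Finset.mem_union_right _ hb, by have := hcB b hb; linarith⟩)
          (convexHull_mono (by exact_mod_cast hs) hy)
        have hbB : b ∈ B := (Finset.mem_union.1 hb).resolve_left fun h => by
          have := hcA b h; linarith
        have hbA : b ∉ A := Finset.disjoint_right.1 hAB hbB
        refine ⟨_, (hK _ (Finset.erase_subset _ _) ?_).2 fun h =>
          Finset.notMem_erase b _ (h hbB), hyb⟩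
        obtain ⟨a, ha⟩ := hA
        exact ⟨a, Finset.mem_erase.2 ⟨fun h => hbA (h ▸ ha), Finset.mem_union_left _ ha⟩⟩
      · exact ⟨F, (hout F hs).2 hF, hy⟩
    · rintro ⟨F, hF, hy⟩
      by_cases hs : F ⊆ A ∪ B
      · obtain ⟨a, ha, hca, hya⟩ := exists_mem_convexHull_erase (Z := A ∪ B) h0 h1
          (by obtain ⟨b, hb⟩ := hA
              exact ⟨b, Finset.mem_union_left _ hb, hcA b hb⟩)
          (convexHull_mono (by exact_mod_cast hs) hy)
        have haA : a ∈ A := (Finset.mem_union.1 ha).resolve_right fun h => by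
          have := hcB a h; linarith
        have haB : a ∉ B := Finset.disjoint_left.1 hAB haA
        refine ⟨_, (hK' _ (Finset.erase_subset _ _) ?_).2 fun h =>
          Finset.notMem_erase a _ (h haA), hya⟩
        obtain ⟨b, hb⟩ := hB
        exact ⟨b, Finset.mem_erase.2 ⟨fun h => haB (h ▸ hb), Finset.mem_union_right _ hb⟩⟩
      · exact ⟨F, (hout F hs).1 hF, hy⟩

/-- The affine relation between a point and a full-dimensional simplex. -/
theorem GenericPoint.exists_coords [FiniteDimensional ℝ E] {V σ : Finset E} {Ψ : E → ℝ} {v : E}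
    {g : E →ᵃ[ℝ] ℝ} (hGP : GeneralPosition V Ψ) (hgen : GenericPoint V Ψ v)
    (hσ : FullSupport V Ψ σ g) :
    ∃ (l : E → ℝ) (u : E → E →ᵃ[ℝ] ℝ), (∀ a, ∀ w ∈ σ, u a w = if w = a then 1 else 0) ∧
      ∑ w ∈ σ, l w = 1 ∧ ∑ w ∈ σ, l w • w = v ∧ (∀ w ∈ σ, l w ≠ 0) ∧ ∀ w ∈ σ, u w v = l w := by
  obtain ⟨u, hu, hcoord, -⟩ := exists_affineMap_coord (hGP σ hσ.1 g hσ.2.1.1)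
  have hv : v ∈ affineSpan ℝ (σ : Set E) := by rw [hσ.2.2]; trivial
  obtain ⟨l, l1, rfl⟩ := exists_sum_smul_eq_of_mem_affineSpan hv
  refine ⟨l, u, hu, l1, rfl, fun w hw hlw => ?_, hcoord l l1⟩
  refine hgen.notMem_affineSpan (σ.erase w) ((Finset.erase_subset _ _).trans hσ.1) (fun htop => ?_) ?_
  · have := affineMap_eq_of_affineSpan_eq_top htop (g := u w) (g' := AffineMap.const ℝ E 0)
      fun x hx => by
        rw [Finset.mem_erase] at hx
        simp [hu w x hx.2, hx.1]
    have h1 := hu w w hw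
    rw [this] at h1
    simp at h1
  · rw [← Finset.add_sum_erase σ _ hw, hlw, zero_smul, zero_add]
    rw [← Finset.add_sum_erase σ _ hw, hlw, zero_add] at l1
    exact sum_smul_mem_affineSpan l1

/-- Slightly above and below a critical height, the facets of the corresponding circuit are
supported. -/
theorem exists_supportedAt_near [FiniteDimensional ℝ E] {V σ : Finset E} {Ψ : E → ℝ} {v : E}
    {g : E →ᵃ[ℝ] ℝ} (hv : v ∉ V) (hσ : FullSupport V Ψ σ g) {l : E → ℝ} {u : E → E →ᵃ[ℝ] ℝ}
    (hu : ∀ a, ∀ w ∈ σ, u a w = if w = a then 1 else 0) (huv : ∀ w ∈ σ, u w v = l w)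
    {e : ℝ} (he : 0 < e) :
    ∃ t : ℝ, 0 < t ∧ t < e ∧
      (∀ w ∈ σ, l w < 0 → SupportedAt V Ψ v (g v + t) ((insert v σ).erase w)) ∧
      (∀ w ∈ σ, 0 < l w → SupportedAt V Ψ v (g v - t) ((insert v σ).erase w)) := by
  have hex : ∃ ε > 0, ∀ a ∈ σ, ∀ t : ℝ, |t| ≤ ε → ∀ w ∈ V, 0 < Ψ w - g w →
      0 < Ψ w - g w + t * u a w := by
    choose ε hε H using fun a => exists_pos_forall_add_mul_pos V (fun w => Ψ w - g w) (u a)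
    have : ∀ s : Finset E, ∃ δ > 0, ∀ a ∈ s, δ ≤ ε a := fun s => by
      induction s using Finset.induction_on with
      | empty => exact ⟨1, one_pos, by simp⟩
      | insert a s ha ih =>
        obtain ⟨δ, hδ, h⟩ := ih
        refine ⟨min δ (ε a), lt_min hδ (hε a), fun x hx => ?_⟩
        rcases Finset.mem_insert.1 hx with rfl | hx
        · exact min_le_right _ _
        · exact (min_le_left _ _).trans (h x hx)
    obtain ⟨δ, hδ, h⟩ := this σ
    exact ⟨δ, hδ, fun a ha t ht => H a t (ht.trans (h a ha))⟩
  obtain ⟨ε, hε, H⟩ := hex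
  have hm : ∃ m > 0, ∀ a ∈ σ, l a ≠ 0 → m ≤ |l a| := by
    have : ∀ s : Finset E, ∃ δ > 0, ∀ a ∈ s, l a ≠ 0 → δ ≤ |l a| := fun s => by
      induction s using Finset.induction_on with
      | empty => exact ⟨1, one_pos, by simp⟩
      | insert a s ha ih =>
        obtain ⟨δ, hδ, h⟩ := ih
        by_cases hl : l a = 0
        · refine ⟨δ, hδ, fun x hx hx0 => ?_⟩
          rcases Finset.mem_insert.1 hx with rfl | hx
          · exact absurd hl hx0
          · exact h x hx hx0
        · refine ⟨min δ |l a|, lt_min hδ (abs_pos.2 hl), fun x hx hx0 => ?_⟩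
          rcases Finset.mem_insert.1 hx with rfl | hx
          · exact min_le_right _ _
          · exact (min_le_left _ _).trans (h x hx hx0)
    exact this σ
  obtain ⟨m, hm, hml⟩ := hm
  have hne : ∀ w ∈ σ, w ≠ v := fun w hw h => hv (h ▸ hσ.1 hw)
  have main : ∀ w ∈ σ, ∀ s : ℝ, 0 < s → s ≤ ε → ∀ z, z = g v - s * l w →
      SupportedAt V Ψ v z ((insert v σ).erase w) := by
    intro w hw s hs0 hsε z hz
    have herase : ((insert v σ).erase w).erase v = σ.erase w := by
      ext x
      have := hne
      simp only [Finset.mem_erase, Finset.mem_insert]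
      constructor
      · rintro ⟨h1, h2, h3⟩; exact ⟨h2, h3.resolve_left h1⟩
      · rintro ⟨h1, h2⟩; exact ⟨hne x h2, h1, Or.inr h2⟩
    have hev : ∀ x, (g - s • u w) x = g x - s * u w x := fun x => by simp
    refine (supportedAt_iff hv).2 ⟨g - s • u w, ?_, ⟨fun x hx => ?_, fun x hx hxF => ?_⟩,
      fun _ => ?_, fun h => ?_⟩
    · rw [herase]; exact (Finset.erase_subset _ _).trans hσ.1
    · rw [herase, Finset.mem_erase] at hx
      rw [hev, hu w x hx.2, if_neg hx.1, hσ.2.1.1 x hx.2]; ring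
    · rw [herase] at hxF
      rw [hev]
      by_cases hxσ : x ∈ σ
      · have hxw : x = w := by
          by_contra h; exact hxF (Finset.mem_erase.2 ⟨h, hxσ⟩)
        subst hxw
        rw [hu x x hxσ, if_pos rfl, hσ.2.1.1 x hxσ]; linarith
      · have := H w hw (-s) (by rw [abs_neg, abs_of_pos hs0]; exact hsε) x hx
          (sub_pos.2 (hσ.2.1.2 x hx hxσ))
        have := H w hw s (by rw [abs_of_pos hs0]; exact hsε) x hx
          (sub_pos.2 (hσ.2.1.2 x hx hxσ))
        linarith
    · rw [hev, huv w hw, hz]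
    · exact absurd (Finset.mem_erase.2 ⟨(hne w hw).symm, Finset.mem_insert_self _ _⟩) h
  refine ⟨min (e / 2) (ε * m), by positivity, lt_of_le_of_lt (min_le_left _ _) (by linarith), ?_, ?_⟩
  · intro w hw hlw
    have h1 := hml w hw hlw.ne
    rw [abs_of_neg hlw] at h1
    have hpos : 0 < min (e / 2) (ε * m) := by positivity
    refine main w hw (min (e / 2) (ε * m) / -l w) (div_pos hpos (by linarith)) ?_ _ ?_
    · rw [div_le_iff₀ (by linarith)]
      exact (min_le_right _ _).trans (by nlinarith)
    · rw [div_neg, neg_mul, div_mul_cancel₀ _ hlw.ne]; ring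
  · intro w hw hlw
    have h1 := hml w hw hlw.ne'
    rw [abs_of_pos hlw] at h1
    have hpos : 0 < min (e / 2) (ε * m) := by positivity
    refine main w hw (min (e / 2) (ε * m) / l w) (div_pos hpos (by linarith)) ?_ _ ?_
    · rw [div_le_iff₀ (by linarith)]
      exact (min_le_right _ _).trans (by nlinarith)
    · rw [div_mul_cancel₀ _ hlw.ne']

/-- Faces do not change between heights with no critical height in between. -/
theorem supportedAt_congr [FiniteDimensional ℝ E] {V F : Finset E} {Ψ : E → ℝ} {v : E}
    (hv : v ∉ V) (hV : affineSpan ℝ (V : Set E) = ⊤) {a b : ℝ} (hab : a ≤ b)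
    (h : ∀ σ g, FullSupport V Ψ σ g → a ≤ g v → g v ≤ b → ¬ F ⊆ insert v σ) :
    SupportedAt V Ψ v a F ↔ SupportedAt V Ψ v b F := by
  rcases hab.eq_or_lt with rfl | hab
  · rfl
  by_contra hne
  obtain ⟨σ, g, hσ, hF, h1, h2⟩ := exists_fullSupport_of_change hv hV hab hne
  exact h σ g hσ h1 h2 hF

/-- Moving `v` across exactly one critical height is a bistellar move. -/
theorem bistellarMove_of_crossing [FiniteDimensional ℝ E] {n : ℕ} (hn : Module.finrank ℝ E = n)
    {V : Finset E} {Ψ : E → ℝ} {v : E} (hv : v ∉ V) (hV : affineSpan ℝ (V : Set E) = ⊤)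
    (hGP : GeneralPosition V Ψ) (hgen : GenericPoint V Ψ v) {P : Set E} {a b : ℝ}
    {σ : Finset E} {g : E →ᵃ[ℝ] ℝ} (hσ : FullSupport V Ψ σ g) (hac : a < g v) (hcb : g v < b)
    (ha : a ∉ criticalHeights V Ψ v) (hb : b ∉ criticalHeights V Ψ v)
    (honly : ∀ c ∈ criticalHeights V Ψ v, a ≤ c → c ≤ b → c = g v)
    {Ka Kb : Geometry.SimplicialComplex ℝ E}
    (hKa : IsRegularIn (insert v V) (Function.update Ψ v a) P Ka)
    (hKb : IsRegularIn (insert v V) (Function.update Ψ v b) P Kb)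
    (hP : ∀ F, v ∈ F → SupportedAt V Ψ v a F → convexHull ℝ (F : Set E) ⊆ P) :
    BistellarMove n Kb Ka := by
  have hKa' : ∀ F, F ∈ Ka.faces ↔ F.Nonempty ∧ SupportedAt V Ψ v a F ∧
      convexHull ℝ (F : Set E) ⊆ P := fun F => by rw [hKa]; rfl
  have hKb' : ∀ F, F ∈ Kb.faces ↔ F.Nonempty ∧ SupportedAt V Ψ v b F ∧
      convexHull ℝ (F : Set E) ⊆ P := fun F => by rw [hKb]; rfl
  obtain ⟨l, u, hu, l1, lv, l0, huv⟩ := hgen.exists_coords hGP hσ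
  obtain ⟨t, ht0, hte, hBt, hAt⟩ := exists_supportedAt_near hv hσ hu huv
    (e := min (g v - a) (b - g v)) (lt_min (by linarith) (by linarith))
  have hta := hte.trans_le (min_le_left _ _)
  have htb := hte.trans_le (min_le_right _ _)
  have hvσ : v ∉ σ := fun h => hv (hσ.1 h)
  have hne : ∀ w ∈ σ, w ≠ v := fun w hw h => hvσ (h ▸ hw)
  -- no other critical heights
  have hca : ∀ F, SupportedAt V Ψ v a F ↔ SupportedAt V Ψ v (g v - t) F := fun F =>
    supportedAt_congr hv hV (by linarith) fun τ h hτ h1 h2 _ => by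
      have := honly (h v) ⟨τ, h, hτ, rfl⟩ h1 (by linarith)
      linarith
  have hcb' : ∀ F, SupportedAt V Ψ v (g v + t) F ↔ SupportedAt V Ψ v b F := fun F =>
    supportedAt_congr hv hV (by linarith) fun τ h hτ h1 h2 _ => by
      have := honly (h v) ⟨τ, h, hτ, rfl⟩ (by linarith) h2
      linarith
  have hab : ∀ F, ¬ F ⊆ insert v σ → (SupportedAt V Ψ v a F ↔ SupportedAt V Ψ v b F) := fun F hF =>
    supportedAt_congr hv hV (by linarith) fun τ h hτ h1 h2 h3 => by
      have := honly (h v) ⟨τ, h, hτ, rfl⟩ h1 h2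
      exact hF ((hgen.eq_of_apply_eq τ σ h g hτ hσ this) ▸ h3)
  have hmono : ∀ {z : ℝ}, z ∉ criticalHeights V Ψ v → ∀ {F F' : Finset E}, SupportedAt V Ψ v z F →
      F' ⊆ F → SupportedAt V Ψ v z F' := fun hz F F' hF hF' =>
    Supported.mono (SupportedAt.affIndep hv hGP hgen hz hF) hF hF'
  -- the circuit
  set A := σ.filter fun w => 0 < l w with hA
  set N := σ.filter fun w => l w < 0 with hN
  have hAN : A ∪ N = σ := by
    ext w
    simp only [hA, hN, Finset.mem_union, Finset.mem_filter]
    constructor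
    · rintro (h | h) <;> exact h.1
    · intro h
      rcases lt_or_gt_of_ne (l0 w h) with h' | h'
      · exact Or.inr ⟨h, h'⟩
      · exact Or.inl ⟨h, h'⟩
  have hdAN : Disjoint A N := Finset.disjoint_left.2 fun w h1 h2 => by
    have h1 := (Finset.mem_filter.1 h1).2
    have h2 := (Finset.mem_filter.1 h2).2
    linarith
  have hvA : v ∉ A := fun h => hvσ (Finset.mem_filter.1 h).1
  have hvN : v ∉ N := fun h => hvσ (Finset.mem_filter.1 h).1
  have hAB : A ∪ insert v N = insert v σ := by rw [Finset.union_insert, hAN]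
  have hdAB : Disjoint A (insert v N) := Finset.disjoint_insert_right.2 ⟨hvA, hdAN⟩
  have hAne : A.Nonempty := by
    by_contra h
    rw [Finset.not_nonempty_iff_eq_empty] at h
    have : ∑ w ∈ σ, l w ≤ 0 := Finset.sum_nonpos fun w hw => by
      by_contra! hpos
      have : w ∈ A := Finset.mem_filter.2 ⟨hw, hpos⟩
      rw [h] at this
      exact absurd this (Finset.notMem_empty _)
    linarith
  have hσsum : ∀ h : E →ᵃ[ℝ] ℝ, h v = ∑ w ∈ σ, l w * h w := fun h => by
    rw [← lv, affineMap_sum_smul _ _ _ _ l1]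
  have hgv : g v = ∑ w ∈ σ, l w * Ψ w := by
    rw [hσsum]; exact Finset.sum_congr rfl fun w hw => by rw [hσ.2.1.1 w hw]
  have hBb : ¬ SupportedAt V Ψ v b (insert v N) := fun h => by
    obtain ⟨h, h1, h2, h3, -⟩ := (supportedAt_iff hv).1 h
    rw [Finset.erase_insert hvN] at h1 h2
    have h3 := h3 (Finset.mem_insert_self _ _)
    have : h v ≤ g v := by
      rw [hgv, hσsum h]
      refine Finset.sum_le_sum fun w hw => ?_
      by_cases hwN : w ∈ N
      · rw [h2.1 w hwN]
      · have : 0 ≤ l w := by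
          by_contra! hlt; exact hwN (Finset.mem_filter.2 ⟨hw, hlt⟩)
        exact mul_le_mul_of_nonneg_left (h2.le (hσ.1 hw)) this
    linarith
  have hAa : ¬ SupportedAt V Ψ v a A := fun h => by
    obtain ⟨h, h1, h2, -, h3⟩ := (supportedAt_iff hv).1 h
    rw [Finset.erase_eq_of_notMem hvA] at h1 h2
    have h3 := h3 hvA
    have : g v ≤ h v := by
      rw [hgv, hσsum h]
      refine Finset.sum_le_sum fun w hw => ?_
      by_cases hwA : w ∈ A
      · rw [h2.1 w hwA]
      · have : l w ≤ 0 := by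
          by_contra! hlt; exact hwA (Finset.mem_filter.2 ⟨hw, hlt⟩)
        exact mul_le_mul_of_nonpos_left (h2.le (hσ.1 hw)) this
    linarith
  have hbF : ∀ F ⊆ insert v σ, (SupportedAt V Ψ v b F ↔ ¬ insert v N ⊆ F) := fun F hF => by
    refine ⟨fun h h' => hBb (hmono hb h h'), fun h => ?_⟩
    obtain ⟨w, hw, hwF⟩ := Finset.not_subset.1 h
    refine hmono hb ((hcb' _).1 ?_) (Finset.subset_erase.2 ⟨hF, hwF⟩)
    rcases Finset.mem_insert.1 hw with rfl | hw
    · rw [Finset.erase_insert hvσ]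
      refine (supportedAt_iff hv).2 ⟨g, ?_, ?_, fun h => absurd h hvσ, fun _ => by linarith⟩
      · rw [Finset.erase_eq_of_notMem hvσ]; exact hσ.1
      · rw [Finset.erase_eq_of_notMem hvσ]; exact hσ.2.1
    · exact hBt w (Finset.mem_filter.1 hw).1 (Finset.mem_filter.1 hw).2
  have haF : ∀ F ⊆ insert v σ, (SupportedAt V Ψ v a F ↔ ¬ A ⊆ F) := fun F hF => by
    refine ⟨fun h h' => hAa (hmono ha h h'), fun h => ?_⟩
    obtain ⟨w, hw, hwF⟩ := Finset.not_subset.1 h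
    exact hmono ha ((hca _).2 (hAt w (Finset.mem_filter.1 hw).1 (Finset.mem_filter.1 hw).2))
      (Finset.subset_erase.2 ⟨hF, hwF⟩)
  set c : E → ℝ := fun w => if w = v then -1 else l w with hc
  have hcσ : ∀ w ∈ σ, c w = l w := fun w hw => if_neg (hne w hw)
  have c0 : ∑ w ∈ insert v σ, c w = 0 := by
    rw [Finset.sum_insert hvσ, Finset.sum_congr rfl hcσ, l1]; simp [hc]
  have c1 : ∑ w ∈ insert v σ, c w • w = 0 := by
    rw [Finset.sum_insert hvσ, Finset.sum_congr rfl fun w hw => by rw [hcσ w hw], lv]; simp [hc]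
  have hcA : ∀ w ∈ A, 0 < c w := fun w hw => by
    rw [hcσ w (Finset.mem_filter.1 hw).1]; exact (Finset.mem_filter.1 hw).2
  have hcB : ∀ w ∈ insert v N, c w < 0 := fun w hw => by
    rcases Finset.mem_insert.1 hw with rfl | hw
    · simp [hc]
    · rw [hcσ w (Finset.mem_filter.1 hw).1]; exact (Finset.mem_filter.1 hw).2
  have hZP : convexHull ℝ ((insert v σ : Finset E) : Set E) ⊆ P := fun y hy => by
    obtain ⟨w, hw, hcw, hyw⟩ := exists_mem_convexHull_erase c0 c1
      (by obtain ⟨w, hw⟩ := hAne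
          exact ⟨w, Finset.mem_insert_of_mem (Finset.mem_filter.1 hw).1, hcA w hw⟩) hy
    have hwv : w ≠ v := fun h => by
      subst h; simp only [hc, if_true] at hcw; linarith
    have hwσ := (Finset.mem_insert.1 hw).resolve_left hwv
    have hwA : w ∈ A := Finset.mem_filter.2 ⟨hwσ, by rwa [hcσ w hwσ] at hcw⟩
    exact hP _ (Finset.mem_erase.2 ⟨hwv.symm, Finset.mem_insert_self _ _⟩)
      ((haF _ (Finset.erase_subset _ _)).2 fun h => Finset.notMem_erase w _ (h hwA)) hyw
  have hFP : ∀ F ⊆ insert v σ, convexHull ℝ (F : Set E) ⊆ P := fun F hF =>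
    (convexHull_mono (by exact_mod_cast hF)).trans hZP
  refine bistellarMove_of_circuit hAne (Finset.insert_nonempty v N) hdAB ?_ ?_ ?_ ?_ (c := c)
    (by rw [hAB]; exact c0) (by rw [hAB]; exact c1) hcA hcB
  · rw [← Finset.card_union_of_disjoint hdAB, hAB, Finset.card_insert_of_notMem hvσ]
    have hind : AffIndep σ := hGP σ hσ.1 g hσ.2.1.1
    have := (hind.affineSpan_eq_top_iff_card_eq_finrank_add_one).1 (by simpa using hσ.2.2)
    rw [Fintype.card_coe] at this
    omega
  · intro F hF
    rw [hAB] at hF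
    rw [hKa', hKb', hab F hF]
  · intro F hF hFne
    rw [hAB] at hF
    rw [hKb', hbF F hF]
    simp [hFne, hFP F hF]
  · intro F hF hFne
    rw [hAB] at hF
    rw [hKa', haF F hF]
    simp [hFne, hFP F hF]

theorem exists_mem_segment_frontier {P : Set E} {v x : E} (hv : v ∈ P) (hx : x ∉ P) :
    ∃ y ∈ segment ℝ v x, y ∈ frontier P := by
  by_contra! h
  have hvi : v ∈ interior P := by
    by_contra hvi
    exact h v (left_mem_segment ℝ v x) ⟨subset_closure hv, hvi⟩
  have hxc : x ∉ closure P := fun hxc =>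
    h x (right_mem_segment ℝ v x) ⟨hxc, fun hi => hx (interior_subset hi)⟩
  obtain ⟨y, -, h1, h2⟩ := (convex_segment (𝕜 := ℝ) v x).isPreconnected (interior P) (closure P)ᶜ
    isOpen_interior isClosed_closure.isOpen_compl
    (fun y hy => by
      by_cases hyi : y ∈ interior P
      · exact Or.inl hyi
      · exact Or.inr fun hc => h y hy ⟨hc, hyi⟩)
    ⟨v, left_mem_segment ℝ v x, hvi⟩ ⟨x, right_mem_segment ℝ v x, hxc⟩
  exact h2 (subset_closure (interior_subset h1))

/-- A supported simplex with a vertex in `P` off the complex `M ⊇ ∂P` stays inside `P`. -/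
theorem Supported.convexHull_subset {W F : Finset E} {Φ : E → ℝ} {P : Set E} (hPc : IsClosed P)
    {M : Geometry.SimplicialComplex ℝ E} (hM : ∀ G ∈ M.faces, Supported W Φ G)
    (hfr : frontier P ⊆ M.space) {v : E} (hvP : v ∈ P) (hvM : ∀ G ∈ M.faces, v ∉ G) (hvF : v ∈ F)
    (hF : Supported W Φ F) : convexHull ℝ (F : Set E) ⊆ P := by
  intro x hx
  by_contra hxP
  obtain ⟨y, hys, hyfr⟩ := exists_mem_segment_frontier hvP hxP
  obtain ⟨s, t, hs, ht, hst, rfl⟩ := hys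
  have hs0 : s ≠ 0 := by
    rintro rfl
    have ht1 : t = 1 := by linarith
    subst ht1
    have := hPc.frontier_subset hyfr
    simp at this
    exact hxP this
  obtain ⟨c, c0, c1, rfl⟩ := exists_sum_smul_eq_of_mem_convexHull hx
  obtain ⟨G, hG, hyG⟩ := Geometry.SimplicialComplex.mem_space_iff.1 (hfr hyfr)
  have e1 : s • v + t • ∑ w ∈ F, c w • w = ∑ w ∈ F, ((if w = v then s else 0) + t * c w) • w := by
    simp_rw [add_smul, mul_smul]
    rw [Finset.sum_add_distrib, ← Finset.smul_sum]
    simp [ite_smul, hvF]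
  have e2 : ∑ w ∈ F, ((if w = v then s else 0) + t * c w) = 1 := by
    rw [Finset.sum_add_distrib, ← Finset.mul_sum, c1]
    simp [hvF, hst]
  rw [e1] at hyG
  have := hF.coord_eq_zero (hM G hG) (fun w hw => by
    have := mul_nonneg ht (c0 w hw)
    split_ifs <;> linarith) e2 hyG hvF (hvM G hG)
  have h2 := mul_nonneg ht (c0 v hvF)
  rw [if_pos rfl] at this
  exact hs0 (by linarith)

theorem SupportedAt.of_le {V F : Finset E} {Ψ : E → ℝ} {v : E} (hv : v ∉ V) {a b : ℝ}
    (hab : a ≤ b) (hvF : v ∉ F) (h : SupportedAt V Ψ v a F) : SupportedAt V Ψ v b F := by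
  obtain ⟨g, h1, h2, -, h3⟩ := (supportedAt_iff hv).1 h
  exact (supportedAt_iff hv).2 ⟨g, h1, h2, fun h => absurd h hvF, fun h => (h3 h).trans_le hab⟩

/-- Lowering the lift of a vertex through finitely many critical heights. -/
theorem bistellarEquiv_of_heights [FiniteDimensional ℝ E] {n : ℕ} (hn : Module.finrank ℝ E = n)
    {V : Finset E} {Ψ : E → ℝ} {v : E} (hv : v ∉ V) (hV : affineSpan ℝ (V : Set E) = ⊤)
    (hGP : GeneralPosition V Ψ) (hgen : GenericPoint V Ψ v) {P : Set E} (hPc : IsClosed P)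
    (hvP : v ∈ P) {M : Geometry.SimplicialComplex ℝ E}
    (hMP : ∀ F ∈ M.faces, convexHull ℝ (F : Set E) ⊆ P) (hfr : frontier P ⊆ M.space)
    (hvM : ∀ F ∈ M.faces, v ∉ F) {a b : ℝ} (hab : a ≤ b) (ha : a ∉ criticalHeights V Ψ v)
    (hb : b ∉ criticalHeights V Ψ v) (hM : ∀ F ∈ M.faces, SupportedAt V Ψ v a F)
    {Ka Kb : Geometry.SimplicialComplex ℝ E}
    (hKa : IsRegularIn (insert v V) (Function.update Ψ v a) P Ka)
    (hKb : IsRegularIn (insert v V) (Function.update Ψ v b) P Kb) :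
    BistellarEquiv n M Kb Ka := by
  have hfin : (criticalHeights V Ψ v ∩ Set.Icc a b).Finite :=
    (finite_criticalHeights V Ψ v).inter_of_left _
  induction hk : hfin.toFinset.card using Nat.strong_induction_on generalizing a Ka with
  | _ k ih =>
  by_cases hemp : (criticalHeights V Ψ v ∩ Set.Icc a b).Nonempty
  · obtain ⟨c, hcmem, hmin⟩ := hfin.toFinset.exists_min_image id
      (by obtain ⟨c, hc⟩ := hemp; exact ⟨c, hfin.mem_toFinset.2 hc⟩)
    rw [hfin.mem_toFinset] at hcmem
    obtain ⟨hc, hac, hcb⟩ := hcmem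
    have hac' : a < c := lt_of_le_of_ne hac fun h => ha (h ▸ hc)
    have hcb' : c < b := lt_of_le_of_ne hcb fun h => hb (h ▸ hc)
    obtain ⟨d, hcd, hdb, hd⟩ : ∃ d, c < d ∧ d ≤ b ∧ ∀ e ∈ criticalHeights V Ψ v, c < e → ¬ e ≤ d := by
      obtain ⟨m, hm, hmin⟩ := (insert b (hfin.toFinset.filter fun e => c < e)).exists_min_image id
        (Finset.insert_nonempty _ _)
      have hcm : c < m := by
        rcases Finset.mem_insert.1 hm with rfl | hm
        · exact hcb'
        · exact (Finset.mem_filter.1 hm).2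
      have hmb : m ≤ b := hmin b (Finset.mem_insert_self _ _)
      refine ⟨(c + m) / 2, by linarith, by linarith, fun e he hce hed => ?_⟩
      have : m ≤ e := hmin e (Finset.mem_insert_of_mem (Finset.mem_filter.2
        ⟨hfin.mem_toFinset.2 ⟨he, by linarith, by linarith⟩, hce⟩))
      linarith
    have hdcrit : d ∉ criticalHeights V Ψ v := fun h => hd d h hcd le_rfl
    obtain ⟨σ, g, hσ, rfl⟩ := hc
    obtain ⟨Kd, hKd⟩ := exists_isRegularIn P fun F (hF : Supported (insert v V)
      (Function.update Ψ v d) F) => SupportedAt.affIndep hv hGP hgen hdcrit hF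
    have hMd : ∀ F ∈ M.faces, SupportedAt V Ψ v d F := fun F hF =>
      (hM F hF).of_le hv (by linarith) (hvM F hF)
    have hmove : BistellarMove n Kd Ka := by
      refine bistellarMove_of_crossing hn hv hV hGP hgen hσ hac' hcd ha hdcrit ?_ hKa hKd ?_
      · intro e he hae hed
        by_contra hne
        rcases lt_or_gt_of_ne hne with h | h
        · have := hmin e (hfin.mem_toFinset.2 ⟨he, hae, by linarith⟩)
          simp only [id] at this
          linarith
        · exact hd e he h hed
      · exact fun F hvF hF => Supported.convexHull_subset hPc hM hfr hvP hvM hvF hF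
    have hfin' : (criticalHeights V Ψ v ∩ Set.Icc d b).Finite :=
      (finite_criticalHeights V Ψ v).inter_of_left _
    have hlt : hfin'.toFinset.card < k := by
      rw [← hk]
      refine Finset.card_lt_card ⟨fun e he => ?_, fun h => ?_⟩
      · rw [hfin'.mem_toFinset] at he
        exact hfin.mem_toFinset.2 ⟨he.1, by linarith [he.2.1], he.2.2⟩
      · have := hfin'.mem_toFinset.1 (h (hfin.mem_toFinset.2 ⟨⟨σ, g, hσ, rfl⟩, hac, hcb⟩))
        linarith [this.2.1]
    have := ih _ hlt hdb hdcrit hMd hKd hfin' rfl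
    refine Relation.ReflTransGen.tail this ⟨hmove, fun F hF => ?_, fun F hF => ?_⟩
    · rw [hKd]; exact ⟨M.nonempty_of_mem_faces hF, hMd F hF, hMP F hF⟩
    · rw [hKa]; exact ⟨M.nonempty_of_mem_faces hF, hM F hF, hMP F hF⟩
  · have : Ka = Kb := by
      ext F
      rw [hKa, hKb]
      have : SupportedAt V Ψ v a F ↔ SupportedAt V Ψ v b F :=
        supportedAt_congr hv hV hab fun σ g hσ h1 h2 _ =>
          hemp ⟨g v, ⟨σ, g, hσ, rfl⟩, h1, h2⟩
      exact and_congr_right fun _ => and_congr_left fun _ => this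
    rw [this]
    exact Relation.ReflTransGen.refl

/-- An open set is not covered by finitely many hyperplanes. -/
theorem exists_mem_forall_affineMap_ne_zero [FiniteDimensional ℝ E] (S : Finset (E →ᵃ[ℝ] ℝ))
    (hS : ∀ u ∈ S, u ≠ 0) {U : Set E} (hU : IsOpen U) (hne : U.Nonempty) :
    ∃ x ∈ U, ∀ u ∈ S, u x ≠ 0 := by
  induction S using Finset.induction_on generalizing U with
  | empty => obtain ⟨x, hx⟩ := hne; exact ⟨x, hx, by simp⟩
  | insert u S hu ih =>
    have hcont : Continuous u := AffineMap.continuous_of_finiteDimensional u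
    have hne' : (U ∩ {x | u x ≠ 0}).Nonempty := by
      obtain ⟨x, hx⟩ := hne
      by_cases hux : u x = 0
      · obtain ⟨p, hp⟩ : ∃ p, u p ≠ 0 := by
          by_contra! h
          exact hS u (Finset.mem_insert_self _ _) (AffineMap.ext h)
        have hc : Continuous fun t : ℝ => AffineMap.lineMap x p t :=
          AffineMap.lineMap_continuous
        have hmem : (fun t : ℝ => (AffineMap.lineMap x p t : E)) ⁻¹' U ∈ nhds (0 : ℝ) :=
          (hU.preimage hc).mem_nhds (by simpa using hx)
        obtain ⟨ε, hε, hball⟩ := Metric.mem_nhds_iff.1 hmem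
        refine ⟨AffineMap.lineMap x p (ε / 2), hball ?_, ?_⟩
        · rw [Metric.mem_ball, Real.dist_eq, sub_zero, abs_of_pos (by linarith)]; linarith
        · change u _ ≠ 0
          rw [AffineMap.apply_lineMap, hux, AffineMap.lineMap_apply]
          simp [hε.ne', hp]
      · exact ⟨x, hx, hux⟩
    obtain ⟨x, hx, hxS⟩ := ih (fun u hu => hS u (Finset.mem_insert_of_mem hu))
      (hU.inter (isOpen_ne.preimage hcont)) hne'
    refine ⟨x, hx.1, fun u' hu' => ?_⟩
    rcases Finset.mem_insert.1 hu' with rfl | h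
    · exact hx.2
    · exact hxS u' h

theorem FullSupport.eq_filter {V : Finset E} {Ψ : E → ℝ} {σ : Finset E} {g : E →ᵃ[ℝ] ℝ}
    (h : FullSupport V Ψ σ g) : σ = V.filter fun w => g w = Ψ w := by
  ext w
  rw [Finset.mem_filter]
  refine ⟨fun hw => ⟨h.1 hw, h.2.1.1 w hw⟩, fun hw => ?_⟩
  by_contra hwσ
  exact (h.2.1.2 w hw.1 hwσ).ne hw.2

/-- Points off finitely many hyperplanes are generic. -/
theorem exists_finset_genericPoint [FiniteDimensional ℝ E] (V : Finset E) (Ψ : E → ℝ) :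
    ∃ S : Finset (E →ᵃ[ℝ] ℝ), (∀ u ∈ S, u ≠ 0) ∧
      ∀ x, (∀ u ∈ S, u x ≠ 0) → GenericPoint V Ψ x := by
  have h1 : ∀ F : Finset E, ∃ u : E →ᵃ[ℝ] ℝ, u ≠ 0 ∧
      (affineSpan ℝ (F : Set E) ≠ ⊤ → ∀ w ∈ F, u w = 0) := fun F => by
    by_cases htop : affineSpan ℝ (F : Set E) = ⊤
    · refine ⟨AffineMap.const ℝ E 1, fun h => ?_, fun h => absurd htop h⟩
      have := congrArg (fun u : E →ᵃ[ℝ] ℝ => u 0) h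
      simp at this
    · obtain ⟨p, hp⟩ : ∃ p, p ∉ affineSpan ℝ (F : Set E) := by
        by_contra! h
        exact htop (eq_top_iff.2 fun x _ => h x)
      obtain ⟨u, hu, hup⟩ := exists_affineMap_vanishing hp
      exact ⟨u, fun h => by rw [h] at hup; simp at hup, fun _ => hu⟩
  choose u hu0 hu using h1
  set G := (finite_setOf_fullSupport V Ψ).toFinset with hG
  refine ⟨V.powerset.image u ∪ ((G ×ˢ G).filter fun p => p.1 ≠ p.2).image fun p => p.1 - p.2,
    fun f hf => ?_, fun x hx => ⟨fun F hF htop hxF => ?_, fun σ τ g h hg hh hgh => ?_⟩⟩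
  · rcases Finset.mem_union.1 hf with hf | hf
    · obtain ⟨F, -, rfl⟩ := Finset.mem_image.1 hf
      exact hu0 F
    · obtain ⟨p, hp, rfl⟩ := Finset.mem_image.1 hf
      exact sub_ne_zero.2 (Finset.mem_filter.1 hp).2
  · refine hx (u F) (Finset.mem_union_left _ (Finset.mem_image_of_mem _ (Finset.mem_powerset.2 hF)))
      ?_
    have := affineMap_eq_of_mem_affineSpan hxF (g := u F) (g' := 0)
      (fun w hw => by simpa using hu F htop w hw)
    simpa using this
  · have hgh' : g = h := by
      by_contra hne
      refine hx (g - h) (Finset.mem_union_right _ (Finset.mem_image.2 ⟨(g, h),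
        Finset.mem_filter.2 ⟨Finset.mem_product.2 ⟨?_, ?_⟩, hne⟩, rfl⟩)) ?_
      · exact (finite_setOf_fullSupport V Ψ).mem_toFinset.2 ⟨σ, hg⟩
      · exact (finite_setOf_fullSupport V Ψ).mem_toFinset.2 ⟨τ, hh⟩
      · simp [hgh]
    rw [hg.eq_filter, hh.eq_filter, hgh']

theorem GeneralPosition.mono {V W : Finset E} {Ψ : E → ℝ} (h : GeneralPosition V Ψ) (hW : W ⊆ V) :
    GeneralPosition W Ψ := fun F hF => h F (hF.trans hW)

theorem GeneralPosition.affIndep {V F : Finset E} {Ψ : E → ℝ} (h : GeneralPosition V Ψ)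
    (hF : Supported V Ψ F) : AffIndep F := by
  obtain ⟨hFV, g, hg⟩ := hF
  exact h F hFV g hg.1

theorem exists_max_lift {ι : Type*} (V : Finset ι) (Ψ : ι → ℝ) : ∃ m, ∀ w ∈ V, Ψ w ≤ m := by
  obtain ⟨m, hm⟩ := (V.image Ψ).bddAbove
  exact ⟨m, fun w hw => hm (Finset.mem_coe.2 (Finset.mem_image_of_mem _ hw))⟩

theorem notMem_criticalHeights_of_lt {V : Finset E} {Ψ : E → ℝ} {v : E}
    (hv : v ∈ convexHull ℝ (V : Set E)) {m z : ℝ} (hm : ∀ w ∈ V, Ψ w ≤ m) (hz : m < z) :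
    z ∉ criticalHeights V Ψ v := by
  rintro ⟨σ, g, hσ, rfl⟩
  have := affineMap_le_of_mem_convexHull hv g fun w hw => (hσ.2.1.le hw).trans (hm w hw)
  linarith

/-- A point lifted very high does not contribute to the lower hull. -/
theorem supportedAt_iff_supported {V F : Finset E} {Ψ : E → ℝ} {v : E} (hvV : v ∉ V)
    (hv : v ∈ convexHull ℝ (V : Set E)) {m z : ℝ} (hm : ∀ w ∈ V, Ψ w ≤ m) (hz : m < z) :
    SupportedAt V Ψ v z F ↔ Supported V Ψ F := by
  rw [supportedAt_iff hvV]
  constructor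
  · rintro ⟨g, h1, h2, h3, h4⟩
    have hgv := affineMap_le_of_mem_convexHull hv g fun w hw => (h2.le hw).trans (hm w hw)
    have hvF : v ∉ F := fun h => by linarith [h3 h]
    rw [Finset.erase_eq_of_notMem hvF] at h1 h2
    exact ⟨h1, g, h2⟩
  · rintro ⟨h1, g, h2⟩
    have hgv := affineMap_le_of_mem_convexHull hv g fun w hw => (h2.le hw).trans (hm w hw)
    have hvF : v ∉ F := fun h => hvV (h1 h)
    rw [Finset.erase_eq_of_notMem hvF]
    exact ⟨g, h1, h2, fun h => absurd h hvF, fun _ => by linarith⟩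

/-- Removing an interior vertex from a regular complex. -/
theorem bistellarEquiv_erase [FiniteDimensional ℝ E] [Nontrivial E] {n : ℕ}
    (hn : Module.finrank ℝ E = n) {V : Finset E} {Ψ : E → ℝ} {v : E} (hvV : v ∈ V)
    (hGP : GeneralPosition V Ψ) {P : Set E} (hPc : IsClosed P) (hvP : v ∈ interior P)
    (hPW : P ⊆ convexHull ℝ ((V.erase v : Finset E) : Set E))
    {M : Geometry.SimplicialComplex ℝ E}
    (hMP : ∀ F ∈ M.faces, convexHull ℝ (F : Set E) ⊆ P) (hfr : frontier P ⊆ M.space)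
    (hvM : ∀ F ∈ M.faces, v ∉ F) (hM : ∀ F ∈ M.faces, Supported V Ψ F)
    {K K' : Geometry.SimplicialComplex ℝ E} (hK : IsRegularIn V Ψ P K)
    (hK' : IsRegularIn (V.erase v) Ψ P K') : BistellarEquiv n M K K' := by
  set W := V.erase v with hW
  have hWV : W ⊆ V := Finset.erase_subset _ _
  have hvW : v ∉ W := Finset.notMem_erase v V
  have hvint : v ∈ interior (convexHull ℝ (W : Set E)) := interior_mono hPW hvP
  have hWtop : affineSpan ℝ (W : Set E) = ⊤ :=
    interior_convexHull_nonempty_iff_affineSpan_eq_top.1 ⟨v, hvint⟩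
  have hVtop : affineSpan ℝ (V : Set E) = ⊤ :=
    top_le_iff.1 (hWtop ▸ affineSpan_mono ℝ (by exact_mod_cast hWV))
  obtain ⟨m, hm⟩ := exists_max_lift V Ψ
  have hmW : ∀ w ∈ W, Ψ w ≤ m := fun w hw => hm w (hWV hw)
  -- room below the lift of `v` for the supports of `M`
  have hex : ∃ δ > 0, ∃ U : Set E, IsOpen U ∧ v ∈ U ∧ ∀ F ∈ M.faces, ∃ g, F ⊆ V ∧
      StrictSupport V Ψ F g ∧ ∀ x ∈ U, g x < Ψ v - δ := by
    have hfin : M.faces.Finite := V.powerset.finite_toSet.subset fun F hF =>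
      Finset.mem_coe.2 (Finset.mem_powerset.2 (hM F hF).1)
    have : ∀ S : Finset (Finset E), (∀ F ∈ S, F ∈ M.faces) → ∃ δ > 0, ∃ U : Set E, IsOpen U ∧
        v ∈ U ∧ ∀ F ∈ S, ∃ g, F ⊆ V ∧ StrictSupport V Ψ F g ∧ ∀ x ∈ U, g x < Ψ v - δ := by
      intro S
      induction S using Finset.induction_on with
      | empty => exact fun _ => ⟨1, one_pos, Set.univ, isOpen_univ, trivial, by simp⟩
      | insert F S _ ih =>
        intro hS
        obtain ⟨δ, hδ, U, hU, hvU, H⟩ := ih fun F hF => hS F (Finset.mem_insert_of_mem hF)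
        have hFM := hS F (Finset.mem_insert_self _ _)
        obtain ⟨hFV, g, hg⟩ := hM F hFM
        have hgv := hg.2 v hvV (hvM F hFM)
        have hcont : Continuous g := AffineMap.continuous_of_finiteDimensional g
        refine ⟨min δ ((Ψ v - g v) / 2), lt_min hδ (by linarith),
          U ∩ {x | g x < Ψ v - (Ψ v - g v) / 2}, hU.inter (isOpen_lt hcont continuous_const),
          ⟨hvU, by change g v < _; linarith⟩, fun F' hF' => ?_⟩
        rcases Finset.mem_insert.1 hF' with rfl | hF'
        · refine ⟨g, hFV, hg, fun x hx => ?_⟩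
          have := hx.2
          have h2 := min_le_right δ ((Ψ v - g v) / 2)
          change g x < _ at this
          linarith
        · obtain ⟨g', h1, h2, h3⟩ := H F' hF'
          refine ⟨g', h1, h2, fun x hx => (h3 x hx.1).trans_le ?_⟩
          linarith [min_le_left δ ((Ψ v - g v) / 2)]
    obtain ⟨δ, hδ, U, hU, hvU, H⟩ := this hfin.toFinset fun F hF => hfin.mem_toFinset.1 hF
    exact ⟨δ, hδ, U, hU, hvU, fun F hF => H F (hfin.mem_toFinset.2 hF)⟩
  obtain ⟨δ, hδ, U, hU, hvU, hMg⟩ := hex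
  obtain ⟨r, hr, hball⟩ := Metric.mem_nhds_iff.1 (mem_interior_iff_mem_nhds.1 hvint)
  obtain ⟨s, hs0, hs1, hs⟩ : ∃ s : ℝ, 0 < s ∧ s ≤ 1 ∧ s * (|m - Ψ v| + δ) < δ / 2 := by
    obtain ⟨s, h0, h1, h2⟩ := exists_mix_lt (x := 0) (y := |m - Ψ v| + δ) (a := δ / 2)
      (by linarith)
    exact ⟨s, h0, h1, by linarith⟩
  -- the generic replacement of `v`
  obtain ⟨S, hS0, hS⟩ := exists_finset_genericPoint V Ψ
  obtain ⟨S', hS'0, hS'⟩ := exists_finset_genericPoint W Ψ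
  obtain ⟨v', ⟨⟨hv'U, hv'P⟩, hv'r⟩, hv'S⟩ := exists_mem_forall_affineMap_ne_zero (S ∪ S')
    (fun u hu => (Finset.mem_union.1 hu).elim (hS0 u) (hS'0 u))
    ((hU.inter isOpen_interior).inter (Metric.isOpen_ball (x := v) (ε := r * s)))
    ⟨v, ⟨hvU, hvP⟩, Metric.mem_ball_self (by positivity)⟩
  have hgV : GenericPoint V Ψ v' := hS v' fun u hu => hv'S u (Finset.mem_union_left _ hu)
  have hgW : GenericPoint W Ψ v' := hS' v' fun u hu => hv'S u (Finset.mem_union_right _ hu)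
  have hv'V : v' ∉ V := fun h => by
    refine hgV.notMem_affineSpan {v'} (Finset.singleton_subset_iff.2 h) (fun htop => ?_)
      (subset_affineSpan ℝ _ (by simp))
    have : Subsingleton E := AffineSubspace.subsingleton_of_subsingleton_span_eq_top
      (k := ℝ) (s := ({v'} : Set E)) Set.subsingleton_singleton (by simpa using htop)
    exact not_subsingleton E this
  have hv'W : v' ∉ W := fun h => hv'V (hWV h)
  have hv'v : v ≠ v' := fun h => hv'V (h ▸ hvV)
  have hv'P' : v' ∈ P := interior_subset hv'P
  have hv'cW : v' ∈ convexHull ℝ (W : Set E) := hPW hv'P'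
  have hv'cV : v' ∈ convexHull ℝ (V : Set E) :=
    convexHull_mono (by exact_mod_cast hWV) hv'cW
  obtain ⟨a, ha1, ha2, haV, haW⟩ : ∃ a, Ψ v - δ < a ∧ a < Ψ v - δ / 2 ∧
      a ∉ criticalHeights V Ψ v' ∧ a ∉ criticalHeights W Ψ v' := by
    have hfin := (finite_criticalHeights V Ψ v').union (finite_criticalHeights W Ψ v')
    obtain ⟨a, ha, hac⟩ := ((Set.Ioo_infinite (show Ψ v - δ < Ψ v - δ / 2 by linarith)).sdiff
      hfin).nonempty
    exact ⟨a, ha.1, ha.2, fun h => hac (Or.inl h), fun h => hac (Or.inr h)⟩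
  have key : ∀ g : E →ᵃ[ℝ] ℝ, (∀ w ∈ W, g w ≤ Ψ w) → g v' ≤ a → g v < Ψ v := by
    intro g hg hgv'
    set y := v' + s⁻¹ • (v - v') with hy
    have hyv : v = (1 - s) • v' + s • y := by
      rw [hy, smul_add, smul_smul, mul_inv_cancel₀ hs0.ne', sub_smul, one_smul, one_smul]; abel
    have hyball : y ∈ Metric.ball v r := by
      have : y - v = ((1 - s) * s⁻¹) • (v - v') := by
        rw [hy, sub_mul, sub_smul, one_mul, mul_inv_cancel₀ hs0.ne', one_smul]; abel
      rw [Metric.mem_ball, dist_eq_norm, this, norm_smul, Real.norm_eq_abs,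
        abs_of_nonneg (mul_nonneg (by linarith) (by positivity))]
      rw [Metric.mem_ball, dist_eq_norm, norm_sub_rev] at hv'r
      have h1 : (1 - s) * s⁻¹ * ‖v - v'‖ ≤ s⁻¹ * ‖v - v'‖ := by
        refine mul_le_mul_of_nonneg_right ?_ (norm_nonneg _)
        have : 0 < s⁻¹ := by positivity
        nlinarith
      have h2 : s⁻¹ * ‖v - v'‖ < s⁻¹ * (r * s) := mul_lt_mul_of_pos_left hv'r (by positivity)
      have h3 : s⁻¹ * (r * s) = r := by field_simp
      linarith
    have hgy : g y ≤ m := affineMap_le_of_mem_convexHull (hball hyball) g fun w hw =>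
      (hg w hw).trans (hmW w hw)
    have hgv : g v = (1 - s) * g v' + s * g y := by
      conv_lhs => rw [hyv]
      have := Convex.combo_affine_apply (x := v') (y := y) (a := 1 - s) (b := s) (f := g) (by ring)
      simpa using this
    have := le_abs_self (m - Ψ v)
    nlinarith
  have hswap : ∀ F, SupportedAt V Ψ v' a F ↔ SupportedAt W Ψ v' a F := by
    intro F
    rw [supportedAt_iff hv'V, supportedAt_iff hv'W]
    constructor
    · rintro ⟨g, h1, h2, h3, h4⟩
      have hga : g v' ≤ a := by
        by_cases h : v' ∈ F
        · exact (h3 h).le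
        · exact (h4 h).le
      have hvF : v ∉ F.erase v' := fun h => by
        have := key g (fun w hw => h2.le (hWV hw)) hga
        linarith [h2.1 v h]
      exact ⟨g, Finset.subset_erase.2 ⟨h1, hvF⟩, ⟨h2.1, fun w hw => h2.2 w (hWV hw)⟩, h3, h4⟩
    · rintro ⟨g, h1, h2, h3, h4⟩
      have hga : g v' ≤ a := by
        by_cases h : v' ∈ F
        · exact (h3 h).le
        · exact (h4 h).le
      refine ⟨g, h1.trans hWV, ⟨h2.1, fun w hw hwF => ?_⟩, h3, h4⟩
      by_cases hwv : w = v
      · subst hwv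
        exact key g (fun w hw => h2.le hw) hga
      · exact h2.2 w (Finset.mem_erase.2 ⟨hwv, hw⟩) hwF
  have hv'M : ∀ F ∈ M.faces, v' ∉ F := fun F hF h => hv'V ((hM F hF).1 h)
  have hMV : ∀ F ∈ M.faces, SupportedAt V Ψ v' a F := fun F hF => by
    obtain ⟨g, h1, h2, h3⟩ := hMg F hF
    refine (supportedAt_iff hv'V).2 ⟨g, ?_, ?_, fun h => absurd h (hv'M F hF),
      fun _ => (h3 v' hv'U).trans ha1⟩
    · rwa [Finset.erase_eq_of_notMem (hv'M F hF)]
    · rwa [Finset.erase_eq_of_notMem (hv'M F hF)]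
  have hMW : ∀ F ∈ M.faces, SupportedAt W Ψ v' a F := fun F hF => (hswap F).1 (hMV F hF)
  obtain ⟨Ka, hKa⟩ := exists_isRegularIn P fun F (hF : Supported (insert v' V)
      (Function.update Ψ v' a) F) => SupportedAt.affIndep hv'V hGP hgV haV hF
  have hKaW : IsRegularIn (insert v' W) (Function.update Ψ v' a) P Ka := by
    rw [IsRegularIn, hKa]
    ext F
    exact and_congr_right fun _ => and_congr_left fun _ => hswap F
  set b := max (m + 1) a with hb
  have hmb : m < b := lt_of_lt_of_le (by linarith) (le_max_left _ _)
  have hab : a ≤ b := le_max_right _ _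
  have hKb : IsRegularIn (insert v' V) (Function.update Ψ v' b) P K := by
    rw [IsRegularIn, hK]
    ext F
    exact and_congr_right fun _ => and_congr_left fun _ =>
      (supportedAt_iff_supported hv'V hv'cV hm hmb).symm
  have hK'b : IsRegularIn (insert v' W) (Function.update Ψ v' b) P K' := by
    rw [IsRegularIn, hK']
    ext F
    exact and_congr_right fun _ => and_congr_left fun _ =>
      (supportedAt_iff_supported hv'W hv'cW hmW hmb).symm
  have h1 := bistellarEquiv_of_heights hn hv'V hVtop hGP hgV hPc hv'P' hMP hfr hv'M hab haV
    (notMem_criticalHeights_of_lt hv'cV hm hmb) hMV hKa hKb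
  have h2 := bistellarEquiv_of_heights hn hv'W hWtop (hGP.mono hWV) hgW hPc hv'P' hMP hfr hv'M hab
    haW (notMem_criticalHeights_of_lt hv'cW hmW hmb) hMW hKaW hK'b
  exact Relation.ReflTransGen.trans h1 h2.symm

/-- Removing all vertices outside `N` from a regular complex. -/
theorem bistellarEquiv_of_subset [FiniteDimensional ℝ E] [Nontrivial E] {n : ℕ}
    (hn : Module.finrank ℝ E = n) {V N : Finset E} {Ψ : E → ℝ} (hNV : N ⊆ V)
    (hGP : GeneralPosition V Ψ) {P : Set E} (hPc : IsClosed P)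
    (hVP : ∀ v ∈ V, v ∉ N → v ∈ interior P) (hPN : P ⊆ convexHull ℝ (N : Set E))
    {M : Geometry.SimplicialComplex ℝ E}
    (hMP : ∀ F ∈ M.faces, convexHull ℝ (F : Set E) ⊆ P) (hfr : frontier P ⊆ M.space)
    (hMN : ∀ F ∈ M.faces, F ⊆ N) (hM : ∀ F ∈ M.faces, Supported V Ψ F)
    {K K' : Geometry.SimplicialComplex ℝ E} (hK : IsRegularIn V Ψ P K)
    (hK' : IsRegularIn N Ψ P K') : BistellarEquiv n M K K' := by
  induction hk : (V \ N).card generalizing V K with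
  | zero =>
    have hVN : V = N := by
      rw [Finset.card_eq_zero, Finset.sdiff_eq_empty_iff_subset] at hk
      exact hk.antisymm hNV
    subst hVN
    have : K = K' := by
      ext F; rw [hK, hK']
    rw [this]
    exact Relation.ReflTransGen.refl
  | succ k ih =>
    obtain ⟨v, hv⟩ : (V \ N).Nonempty := Finset.card_pos.1 (by omega)
    rw [Finset.mem_sdiff] at hv
    have hNW : N ⊆ V.erase v := Finset.subset_erase.2 ⟨hNV, hv.2⟩
    have hWV := Finset.erase_subset v V
    have hMW : ∀ F ∈ M.faces, Supported (V.erase v) Ψ F := fun F hF => by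
      obtain ⟨-, g, hg⟩ := hM F hF
      exact ⟨(hMN F hF).trans hNW, g, hg.1, fun w hw => hg.2 w (hWV hw)⟩
    obtain ⟨KW, hKW⟩ := exists_isRegularIn P fun F (hF : Supported (V.erase v) Ψ F) =>
      (hGP.mono hWV).affIndep hF
    have h1 := bistellarEquiv_erase hn hv.1 hGP hPc (hVP v hv.1 hv.2)
      (hPN.trans (convexHull_mono (by exact_mod_cast hNW))) hMP hfr
      (fun F hF h => hv.2 (hMN F hF h)) hM hK hKW
    have h2 := ih hNW (hGP.mono hWV) (fun w hw => hVP w (hWV hw)) hMW hKW (by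
      rw [Finset.erase_sdiff_comm, Finset.card_erase_of_mem (Finset.mem_sdiff.2 hv), hk]; rfl)
    exact Relation.ReflTransGen.trans h1 h2

/-- A choice of positive barycentric weights on every nonempty finite set. -/
def IsWeights {ι : Type*} (c : Finset ι → ι → ℝ) : Prop :=
  ∀ A : Finset ι, A.Nonempty → (∀ w ∈ A, 0 < c A w) ∧ ∑ w ∈ A, c A w = 1

/-- The interior point of a simplex prescribed by a choice of weights. -/
def weightedPoint (c : Finset E → E → ℝ) (A : Finset E) : E := ∑ w ∈ A, c A w • w

/-- A finite family of finite sets is a chain under inclusion. -/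
def IsNested {ι : Type*} (T : Finset (Finset ι)) : Prop := ∀ A ∈ T, ∀ B ∈ T, A ⊆ B ∨ B ⊆ A

theorem IsNested.mono {ι : Type*} {T T' : Finset (Finset ι)} (h : IsNested T) (hT : T' ⊆ T) :
    IsNested T' := fun A hA B hB => h A (hT hA) B (hT hB)

theorem IsNested.exists_top {ι : Type*} {T : Finset (Finset ι)} (h : IsNested T) (hne : T.Nonempty) :
    ∃ D ∈ T, ∀ A ∈ T, A ⊆ D := by
  obtain ⟨D, hD, hmax⟩ := T.exists_max_image Finset.card hne
  refine ⟨D, hD, fun A hA => ?_⟩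
  rcases h A hA D hD with h1 | h1
  · exact h1
  · exact (Finset.eq_of_subset_of_card_le h1 (hmax A hA)).ge

theorem IsWeights.affineMap_weightedPoint {c : Finset E → E → ℝ} (hc : IsWeights c)
    {A : Finset E} (hA : A.Nonempty) (g : E →ᵃ[ℝ] ℝ) :
    g (weightedPoint c A) = ∑ w ∈ A, c A w * g w :=
  affineMap_sum_smul g A _ _ (hc A hA).2

theorem IsWeights.weightedPoint_mem {c : Finset E → E → ℝ} (hc : IsWeights c)
    {A : Finset E} (hA : A.Nonempty) : weightedPoint c A ∈ convexHull ℝ (A : Set E) :=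
  sum_smul_mem_convexHull (fun w hw => ((hc A hA).1 w hw).le) (hc A hA).2
    fun _ hw _ => hw

/-- If a convex combination of points on which a function is nonnegative vanishes, the function
vanishes at all of these points. -/
theorem IsWeights.eq_zero_of_nonneg {c : Finset E → E → ℝ} (hc : IsWeights c)
    {A : Finset E} (hA : A.Nonempty) {g : E →ᵃ[ℝ] ℝ} (hg : ∀ w ∈ A, 0 ≤ g w)
    (h0 : g (weightedPoint c A) = 0) : ∀ w ∈ A, g w = 0 := by
  rw [hc.affineMap_weightedPoint hA,
    Finset.sum_eq_zero_iff_of_nonneg fun w hw => mul_nonneg ((hc A hA).1 w hw).le (hg w hw)] at h0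
  intro w hw
  exact (mul_eq_zero.1 (h0 w hw)).resolve_left ((hc A hA).1 w hw).ne'

/-- An affine function vanishing on the face `D'` of a simplex `D` and positive on the other
vertices. -/
theorem exists_affineMap_face [FiniteDimensional ℝ E] {D : Finset E} (hD : AffIndep D)
    (D' : Finset E) :
    ∃ u : E →ᵃ[ℝ] ℝ, (∀ w ∈ D, w ∈ D' → u w = 0) ∧ ∀ w ∈ D, w ∉ D' → u w = 1 := by
  obtain ⟨u, hu⟩ := exists_affineMap_eq_on hD fun w => if w ∈ D' then 0 else 1
  exact ⟨u, fun w hw h => by simp [hu w hw, h], fun w hw h => by simp [hu w hw, h]⟩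

theorem mem_convexHull_face {D D' : Finset E}
    {x : E} (hx : x ∈ convexHull ℝ (D : Set E)) {u : E →ᵃ[ℝ] ℝ}
    (hu : ∀ w ∈ D, 0 ≤ u w) (hu' : ∀ w ∈ D, w ∉ D' → 0 < u w) (hux : u x = 0) :
    x ∈ convexHull ℝ ((D ∩ D' : Finset E) : Set E) := by
  obtain ⟨d, hd0, hd1, rfl⟩ := exists_sum_smul_eq_of_mem_convexHull hx
  refine sum_smul_mem_convexHull hd0 hd1 fun w hw hdw => ?_
  rw [affineMap_sum_smul u D _ _ hd1,
    Finset.sum_eq_zero_iff_of_nonneg fun w hw => mul_nonneg (hd0 w hw) (hu w hw)] at hux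
  by_contra hwD
  have hwD' : w ∉ D' := fun h => hwD (by simpa using ⟨hw, h⟩)
  exact (mul_eq_zero.1 (hux w hw)).elim hdw (hu' w hw hwD').ne'

/-- If the interior point of a simplex `B`, contained in the simplex `D`, lies in the face of `D`
spanned by `D'`, then so does `B`. -/
theorem IsWeights.subset_convexHull_face [FiniteDimensional ℝ E] {c : Finset E → E → ℝ}
    (hc : IsWeights c) {B D D' : Finset E} (hB : B.Nonempty) (hD : AffIndep D)
    (hBD : (B : Set E) ⊆ convexHull ℝ (D : Set E)) (hD' : D' ⊆ D)
    (h : weightedPoint c B ∈ convexHull ℝ (D' : Set E)) :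
    (B : Set E) ⊆ convexHull ℝ (D' : Set E) := by
  obtain ⟨u, hu0, hu1⟩ := exists_affineMap_face hD D'
  have hu : ∀ w ∈ D, 0 ≤ u w := fun w hw => by
    by_cases h : w ∈ D'
    · exact (hu0 w hw h).ge
    · rw [hu1 w hw h]; norm_num
  have hub : u (weightedPoint c B) = 0 := by
    refine le_antisymm (affineMap_le_of_mem_convexHull h u fun w hw => (hu0 w (hD' hw) hw).le)
      (affineMap_ge_of_mem_convexHull h u fun w hw => (hu0 w (hD' hw) hw).ge)
  have h0 := hc.eq_zero_of_nonneg hB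
    (fun w hw => affineMap_ge_of_mem_convexHull (hBD hw) u fun w hw => hu w hw) hub
  intro w hw
  have := mem_convexHull_face (D' := D') (hBD hw) hu
    (fun w hw h => by rw [hu1 w hw h]; norm_num) (h0 w hw)
  rwa [Finset.inter_eq_right.2 hD'] at this

theorem AffIndep.subset_of_subset_convexHull [FiniteDimensional ℝ E] {D B D' : Finset E}
    (hD : AffIndep D) (hB : B ⊆ D) (hD' : D' ⊆ D)
    (h : (B : Set E) ⊆ convexHull ℝ (D' : Set E)) : B ⊆ D' := by
  obtain ⟨u, hu0, hu1⟩ := exists_affineMap_face hD D'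
  intro w hw
  by_contra hwD
  have := affineMap_le_of_mem_convexHull (h hw) u fun w hw => (hu0 w (hD' hw) hw).le
  rw [hu1 w (hB hw) hwD] at this
  norm_num at this

/-- In a simplicial complex, the interior point of a simplex `B` lies only in the simplices
containing `B`. -/
theorem IsWeights.subset_of_weightedPoint_mem [FiniteDimensional ℝ E] {c : Finset E → E → ℝ}
    (hc : IsWeights c) {K : Geometry.SimplicialComplex ℝ E} {A B : Finset E}
    (hA : A ∈ K.faces) (hB : B ∈ K.faces)
    (h : weightedPoint c B ∈ convexHull ℝ (A : Set E)) : B ⊆ A := by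
  have hBne := K.nonempty_of_mem_faces hB
  have h1 := K.inter_subset_convexHull hB hA ⟨hc.weightedPoint_mem hBne, h⟩
  rw [← Finset.coe_inter] at h1
  have h2 := hc.subset_convexHull_face hBne (K.indep hB) (subset_convexHull ℝ _)
    Finset.inter_subset_left h1
  exact (AffIndep.subset_of_subset_convexHull (K.indep hB) Subset.rfl Finset.inter_subset_left h2).trans
    Finset.inter_subset_right

theorem IsWeights.injOn [FiniteDimensional ℝ E] {c : Finset E → E → ℝ} (hc : IsWeights c)
    (K : Geometry.SimplicialComplex ℝ E) : Set.InjOn (weightedPoint c) K.faces := by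
  intro A hA B hB h
  refine Finset.Subset.antisymm (hc.subset_of_weightedPoint_mem hB hA ?_)
    (hc.subset_of_weightedPoint_mem hA hB ?_)
  · rw [h]; exact hc.weightedPoint_mem (K.nonempty_of_mem_faces hB)
  · rw [← h]; exact hc.weightedPoint_mem (K.nonempty_of_mem_faces hA)

/-- Weights such that the interior point of every simplex crossing the hyperplane `ℓ = 0` lies
on this hyperplane. -/
theorem exists_isWeights {ι : Type*} (ℓ : ι → ℝ) : ∃ c : Finset ι → ι → ℝ, IsWeights c ∧
    ∀ A : Finset ι, (∃ w ∈ A, ℓ w < 0) → (∃ w ∈ A, 0 < ℓ w) → ∑ w ∈ A, c A w * ℓ w = 0 := by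
  have key : ∀ A : Finset ι, ∃ c : ι → ℝ, A.Nonempty →
      (∀ w ∈ A, 0 < c w) ∧ ∑ w ∈ A, c w = 1 ∧
      ((∃ w ∈ A, ℓ w < 0) → (∃ w ∈ A, 0 < ℓ w) → ∑ w ∈ A, c w * ℓ w = 0) := by
    intro A
    obtain ⟨r, hr, hr0⟩ : ∃ r : ι → ℝ, (∀ w ∈ A, 0 < r w) ∧
        ((∃ w ∈ A, ℓ w < 0) → (∃ w ∈ A, 0 < ℓ w) → ∑ w ∈ A, r w * ℓ w = 0) := by
      by_cases h : (∃ w ∈ A, ℓ w < 0) ∧ (∃ w ∈ A, 0 < ℓ w)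
      · obtain ⟨⟨a, ha, hal⟩, b, hb, hbl⟩ := h
        set m := ∑ w ∈ A, max (-ℓ w) 0 with hm
        set p := ∑ w ∈ A, max (ℓ w) 0 with hp
        have hm0 : 0 < m := Finset.sum_pos' (fun w _ => le_max_right _ _)
          ⟨a, ha, lt_max_of_lt_left (by linarith)⟩
        have hp0 : 0 < p := Finset.sum_pos' (fun w _ => le_max_right _ _)
          ⟨b, hb, lt_max_of_lt_left hbl⟩
        refine ⟨fun w => if 0 < ℓ w then m else p, fun w _ => ?_, fun _ _ => ?_⟩
        · dsimp only; split_ifs <;> assumption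
        · have : ∀ w ∈ A, (if 0 < ℓ w then m else p) * ℓ w
              = m * max (ℓ w) 0 - p * max (-ℓ w) 0 := by
            intro w _
            split_ifs with h
            · rw [max_eq_left h.le, max_eq_right (by linarith)]; ring
            · rw [max_eq_right (not_lt.1 h), max_eq_left (by linarith)]; ring
          rw [Finset.sum_congr rfl this, Finset.sum_sub_distrib, ← Finset.mul_sum,
            ← Finset.mul_sum]
          ring
      · exact ⟨fun _ => 1, fun _ _ => one_pos, fun h1 h2 => absurd ⟨h1, h2⟩ h⟩
    refine ⟨fun w => (∑ w ∈ A, r w)⁻¹ * r w, fun hA => ?_⟩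
    have hs : 0 < ∑ w ∈ A, r w := Finset.sum_pos hr hA
    refine ⟨fun w hw => mul_pos (inv_pos.2 hs) (hr w hw), ?_, fun h1 h2 => ?_⟩
    · rw [← Finset.mul_sum, inv_mul_cancel₀ hs.ne']
    · simp only [mul_assoc]
      rw [← Finset.mul_sum, hr0 h1 h2, mul_zero]
  choose c hc using key
  refine ⟨c, fun A hA => ⟨(hc A hA).1, (hc A hA).2.1⟩, fun A h1 h2 => (hc A ?_).2.2 h1 h2⟩
  obtain ⟨w, hw, -⟩ := h1
  exact ⟨w, hw⟩

/-- A simplex is the union of the simplices of its derived subdivision. -/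
theorem IsWeights.exists_nested_of_mem {c : Finset E → E → ℝ} (hc : IsWeights c) (A : Finset E)
    {x : E} (hx : x ∈ convexHull ℝ (A : Set E)) :
    ∃ T : Finset (Finset E), T.Nonempty ∧ IsNested T ∧ (∀ B ∈ T, B.Nonempty ∧ B ⊆ A) ∧
      x ∈ convexHull ℝ ((T.image (weightedPoint c) : Finset E) : Set E) := by
  induction A using Finset.strongInduction generalizing x with
  | H A ih =>
  have hA : A.Nonempty := by
    by_contra h
    rw [Finset.not_nonempty_iff_eq_empty] at h
    simp [h] at hx
  obtain ⟨d, hd0, hd1, hdx⟩ := exists_sum_smul_eq_of_mem_convexHull hx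
  obtain ⟨hc0, hc1⟩ := hc A hA
  obtain ⟨a, ha, hmin⟩ := A.exists_min_image (fun w => d w / c A w) hA
  set t := d a / c A a with ht
  have ht0 : 0 ≤ t := div_nonneg (hd0 a ha) (hc0 a ha).le
  have hle : ∀ w ∈ A, 0 ≤ d w - t * c A w := fun w hw => by
    have := (le_div_iff₀ (hc0 w hw)).1 (hmin w hw)
    linarith
  have hae : d a - t * c A a = 0 := by
    rw [ht, div_mul_cancel₀ _ (hc0 a ha).ne', sub_self]
  have hsum : ∑ w ∈ A, (d w - t * c A w) = 1 - t := by
    rw [Finset.sum_sub_distrib, hd1, ← Finset.mul_sum, hc1, mul_one]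
  have hxeq : x = t • weightedPoint c A + ∑ w ∈ A, (d w - t * c A w) • w := by
    simp only [sub_smul, Finset.sum_sub_distrib, mul_smul, weightedPoint, Finset.smul_sum]
    rw [hdx]; abel
  have ht1 : t ≤ 1 := by linarith [Finset.sum_nonneg hle]
  rcases ht1.eq_or_lt with h1 | h1
  · have hz : ∀ w ∈ A, d w - t * c A w = 0 :=
      (Finset.sum_eq_zero_iff_of_nonneg hle).1 (by rw [hsum, h1, sub_self])
    refine ⟨{A}, Finset.singleton_nonempty _, ?_, ?_, ?_⟩
    · intro B hB C hC
      rw [Finset.mem_singleton.1 hB, Finset.mem_singleton.1 hC]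
      exact Or.inl Subset.rfl
    · intro B hB
      rw [Finset.mem_singleton.1 hB]
      exact ⟨hA, Subset.rfl⟩
    · rw [hxeq, Finset.sum_eq_zero fun w hw => by rw [hz w hw, zero_smul], h1]
      simp
  · have h1' : 0 < 1 - t := by linarith
    have hy : ∑ w ∈ A.erase a, ((1 - t)⁻¹ * (d w - t * c A w)) • w
        ∈ convexHull ℝ ((A.erase a : Finset E) : Set E) := by
      refine sum_smul_mem_convexHull (fun w hw => mul_nonneg (by positivity)
        (hle w (Finset.mem_of_mem_erase hw))) ?_ fun w hw _ => hw
      rw [← Finset.mul_sum, Finset.sum_erase (f := fun w => d w - t * c A w) _ hae, hsum, inv_mul_cancel₀ h1'.ne']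
    obtain ⟨T, hTne, hT, hTA, hyT⟩ := ih _ (Finset.erase_ssubset ha) hy
    refine ⟨insert A T, Finset.insert_nonempty _ _, ?_, ?_, ?_⟩
    · intro B hB C hC
      rcases Finset.mem_insert.1 hB with rfl | hB'
      · rcases Finset.mem_insert.1 hC with rfl | hC'
        · exact Or.inl Subset.rfl
        · exact Or.inr ((hTA C hC').2.trans (Finset.erase_subset _ _))
      · rcases Finset.mem_insert.1 hC with rfl | hC'
        · exact Or.inl ((hTA B hB').2.trans (Finset.erase_subset _ _))
        · exact hT B hB' C hC'
    · intro B hB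
      rcases Finset.mem_insert.1 hB with rfl | hB'
      · exact ⟨hA, Subset.rfl⟩
      · exact ⟨(hTA B hB').1, (hTA B hB').2.trans (Finset.erase_subset _ _)⟩
    · have hyeq : x = t • weightedPoint c A
          + (1 - t) • ∑ w ∈ A.erase a, ((1 - t)⁻¹ * (d w - t * c A w)) • w := by
        rw [Finset.smul_sum, Finset.sum_congr rfl fun w _ => by
          rw [smul_smul, mul_inv_cancel_left₀ h1'.ne'],
          Finset.sum_erase _ (by rw [hae, zero_smul])]
        exact hxeq
      rw [hyeq]
      refine (convex_convexHull ℝ _) (subset_convexHull ℝ _ ?_)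
        (convexHull_mono ?_ hyT) ht0 h1'.le (by ring)
      · simp
      · exact_mod_cast Finset.image_subset_image (Finset.subset_insert _ _)

theorem exists_forall_sub_mul_lt {ι : Type*} (S : Finset ι) (f g u : ι → ℝ)
    (hu : ∀ i ∈ S, 0 < u i) : ∃ k, ∀ k' ≥ k, ∀ i ∈ S, f i - k' * u i < g i := by
  obtain ⟨m, hm⟩ := exists_max_lift S fun i => (f i - g i) / u i
  refine ⟨m + 1, fun k' hk' i hi => ?_⟩
  have h := (div_le_iff₀ (hu i hi)).1 (hm i hi)
  nlinarith [hu i hi]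

/-- On the interior points of the faces of `D` belonging to `𝒦`, the affine function `h` lies
below the height prescribed by `η`, touching it exactly at the members of `T`. -/
def TouchesAt (c : Finset E → E → ℝ) (𝒦 : Set (Finset E)) (η : ℕ → ℝ) (D : Finset E)
    (T : Finset (Finset E)) (h : E →ᵃ[ℝ] ℝ) : Prop :=
  (∀ A ∈ T, h (weightedPoint c A) = η A.card) ∧
    ∀ B ∈ 𝒦, B ⊆ D → B ∉ T → h (weightedPoint c B) < η B.card

/-- Heights depending only on the dimension which make the derived subdivision of every simplex
of a finite family regular. -/
theorem IsWeights.exists_heights [FiniteDimensional ℝ E] {c : Finset E → E → ℝ}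
    (hc : IsWeights c) {𝒦 : Set (Finset E)} (hfin : 𝒦.Finite)
    (hne : ∀ B ∈ 𝒦, B.Nonempty) (hI : ∀ D ∈ 𝒦, AffIndep D) :
    ∃ η : ℕ → ℝ, ∀ D ∈ 𝒦, ∀ T : Finset (Finset E), ↑T ⊆ 𝒦 → IsNested T → (∀ A ∈ T, A ⊆ D) →
      ∃ h, TouchesAt c 𝒦 η D T h := by
  suffices H : ∀ N : ℕ, ∃ η : ℕ → ℝ, ∀ D ∈ 𝒦, D.card ≤ N → ∀ T : Finset (Finset E), ↑T ⊆ 𝒦 →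
      IsNested T → (∀ A ∈ T, A ⊆ D) → ∃ h, TouchesAt c 𝒦 η D T h by
    obtain ⟨η, hη⟩ := H (hfin.toFinset.sup Finset.card)
    exact ⟨η, fun D hD => hη D hD (Finset.le_sup (hfin.mem_toFinset.2 hD))⟩
  intro N
  induction N with
  | zero =>
    refine ⟨0, fun D hD hD0 => ?_⟩
    exact absurd (hne D hD).card_pos (by omega)
  | succ N ih =>
    obtain ⟨η, hη⟩ := ih
    have key : ∀ p : Finset E × Finset (Finset E), ∃ m, p.1 ∈ 𝒦 → p.1.card = N + 1 →
        ↑p.2 ⊆ 𝒦 → IsNested p.2 → (∀ A ∈ p.2, A ⊆ p.1) →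
        ∀ e ≤ m, ∃ h, TouchesAt c 𝒦 (Function.update η (N + 1) e) p.1 p.2 h := by
      rintro ⟨D, T⟩
      by_cases hp : D ∈ 𝒦 ∧ D.card = N + 1 ∧ ↑T ⊆ 𝒦 ∧ IsNested T ∧ ∀ A ∈ T, A ⊆ D
      swap
      · exact ⟨0, fun h1 h2 h3 h4 h5 => absurd ⟨h1, h2, h3, h4, h5⟩ hp⟩
      obtain ⟨hD, hDN, hT𝒦, hT, hTD⟩ := hp
      obtain ⟨D', h', hD'D, hD'ne, hTD', hh'⟩ : ∃ (D' : Finset E) (h' : E →ᵃ[ℝ] ℝ), D' ⊆ D ∧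
          D' ≠ D ∧ (∀ A ∈ T.erase D, A ⊆ D') ∧ TouchesAt c 𝒦 η D' (T.erase D) h' := by
        rcases (T.erase D).eq_empty_or_nonempty with h | h
        · refine ⟨∅, AffineMap.const ℝ E 0, Finset.empty_subset _, ?_, by simp [h], by simp [h], ?_⟩
          · exact (hne D hD).ne_empty.symm
          · intro B hB hB0
            exact absurd (Finset.subset_empty.1 hB0) (hne B hB).ne_empty
        · obtain ⟨D', hD', htop⟩ := (hT.mono (Finset.erase_subset D T)).exists_top h
          have hD'T := Finset.mem_of_mem_erase hD'
          have hne' : D' ≠ D := Finset.ne_of_mem_erase hD'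
          have hlt : D'.card < D.card :=
            Finset.card_lt_card (lt_of_le_of_ne (hTD D' hD'T) hne')
          obtain ⟨h', hh'⟩ := hη D' (hT𝒦 hD'T) (by omega) (T.erase D)
            (fun A hA => hT𝒦 (Finset.mem_of_mem_erase hA)) (hT.mono (Finset.erase_subset _ _)) htop
          exact ⟨D', h', hTD D' hD'T, hne', htop, hh'⟩
      obtain ⟨u, hu0, hu1⟩ := exists_affineMap_face (hI D hD) D'
      have hub0 : ∀ B ∈ 𝒦, B ⊆ D' → u (weightedPoint c B) = 0 := fun B hB hBD' => by
        rw [hc.affineMap_weightedPoint (hne B hB)]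
        exact Finset.sum_eq_zero fun w hw => by
          rw [hu0 w (hD'D (hBD' hw)) (hBD' hw), mul_zero]
      have hub1 : ∀ B ∈ 𝒦, B ⊆ D → ¬ B ⊆ D' → 0 < u (weightedPoint c B) := by
        intro B hB hBD hBD'
        have h0 : ∀ w ∈ B, 0 ≤ u w := fun w hw => by
          by_cases h : w ∈ D'
          · exact (hu0 w (hBD hw) h).ge
          · rw [hu1 w (hBD hw) h]; norm_num
        refine lt_of_le_of_ne (affineMap_ge_of_mem_convexHull
          (hc.weightedPoint_mem (hne B hB)) u h0) fun h => hBD' fun w hw => ?_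
        by_contra hwD'
        have := hc.eq_zero_of_nonneg (hne B hB) h0 h.symm w hw
        rw [hu1 w (hBD hw) hwD'] at this
        norm_num at this
      have hDD' : ¬ D ⊆ D' := fun h => hD'ne (Finset.Subset.antisymm hD'D h)
      obtain ⟨k, hk⟩ := exists_forall_sub_mul_lt
        (hfin.toFinset.filter fun B => B ⊆ D ∧ ¬ B ⊆ D')
        (fun B => h' (weightedPoint c B)) (fun B => η B.card) (fun B => u (weightedPoint c B))
        (fun B hB => by
          rw [Finset.mem_filter, hfin.mem_toFinset] at hB
          exact hub1 B hB.1 hB.2.1 hB.2.2)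
      have huD := hub1 D hD Subset.rfl hDD'
      refine ⟨h' (weightedPoint c D) - k * u (weightedPoint c D), fun _ _ _ _ _ e he => ?_⟩
      have hupd : ∀ B, B ⊆ D → B ≠ D → Function.update η (N + 1) e B.card = η B.card := by
        intro B hB hBD
        have := Finset.card_lt_card (lt_of_le_of_ne hB hBD)
        exact Function.update_of_ne (by omega) _ _
      have hupdD : Function.update η (N + 1) e D.card = e := by rw [hDN]; simp
      obtain ⟨k', hk', hDin, hDout⟩ : ∃ k' ≥ k,
          (D ∈ T → h' (weightedPoint c D) - k' * u (weightedPoint c D) = e) ∧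
          (D ∉ T → h' (weightedPoint c D) - k' * u (weightedPoint c D) < e) := by
        have hkey : k ≤ (h' (weightedPoint c D) - e) / u (weightedPoint c D) := by
          rw [le_div_iff₀ huD]; linarith
        by_cases hDT : D ∈ T
        · refine ⟨_, hkey, fun _ => ?_, fun h => absurd hDT h⟩
          rw [div_mul_cancel₀ _ huD.ne']; ring
        · refine ⟨(h' (weightedPoint c D) - e) / u (weightedPoint c D) + 1, by linarith,
            fun h => absurd h hDT, fun _ => ?_⟩
          rw [add_mul, div_mul_cancel₀ _ huD.ne']; linarith
      have hval : ∀ x, (h' - k' • u) x = h' x - k' * u x := fun x => by simp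
      refine ⟨h' - k' • u, fun A hA => ?_, fun B hB hBD hBT => ?_⟩
      · rw [hval]
        by_cases hAD : A = D
        · rw [hAD] at hA ⊢
          rw [hupdD, hDin hA]
        · have hA' := Finset.mem_erase.2 ⟨hAD, hA⟩
          rw [hupd A (hTD A hA) hAD, hub0 A (hT𝒦 hA) (hTD' A hA'), hh'.1 A hA']; ring
      · rw [hval]
        by_cases hBeq : B = D
        · rw [hBeq] at hBT ⊢
          rw [hupdD]
          exact hDout hBT
        · rw [hupd B hBD hBeq]
          by_cases hBD' : B ⊆ D'
          · rw [hub0 B hB hBD', mul_zero, sub_zero]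
            exact hh'.2 B hB hBD' fun h => hBT (Finset.mem_of_mem_erase h)
          · exact hk k' hk' B (by
              rw [Finset.mem_filter, hfin.mem_toFinset]
              exact ⟨hB, hBD, hBD'⟩)
    choose m hm using key
    obtain ⟨e, he⟩ := ((hfin.toFinset ×ˢ hfin.toFinset.powerset).image m).bddBelow
    refine ⟨Function.update η (N + 1) e, fun D hD hDN T hT𝒦 hT hTD => ?_⟩
    rcases hDN.lt_or_eq with h | h
    · obtain ⟨h', hh'⟩ := hη D hD (by omega) T hT𝒦 hT hTD
      have hupd : ∀ B, B ⊆ D → Function.update η (N + 1) e B.card = η B.card := by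
        intro B hB
        have := Finset.card_le_card hB
        exact Function.update_of_ne (by omega) _ _
      refine ⟨h', fun A hA => ?_, fun B hB hBD hBT => ?_⟩
      · rw [hupd A (hTD A hA), hh'.1 A hA]
      · rw [hupd B hBD]; exact hh'.2 B hB hBD hBT
    · refine hm (D, T) hD h hT𝒦 hT hTD e (he (Finset.mem_coe.2 (Finset.mem_image_of_mem _ ?_)))
      rw [Finset.mem_product, Finset.mem_powerset, hfin.mem_toFinset]
      exact ⟨hD, fun A hA => hfin.mem_toFinset.2 (hT𝒦 hA)⟩

/-- The simplices of the derived subdivision prescribed by `c`. -/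
def derivedFaces (c : Finset E → E → ℝ) (𝒦 : Set (Finset E)) : Set (Finset E) :=
  {S | ∃ T : Finset (Finset E), ↑T ⊆ 𝒦 ∧ T.Nonempty ∧ IsNested T ∧
    S = T.image (weightedPoint c)}

theorem IsWeights.exists_supported [FiniteDimensional ℝ E] {c : Finset E → E → ℝ}
    (hc : IsWeights c) (K : Geometry.SimplicialComplex ℝ E) (hfin : K.faces.Finite) :
    ∃ Ψ : E → ℝ, ∀ D ∈ K.faces, ∀ T : Finset (Finset E), ↑T ⊆ K.faces → IsNested T →
      (∀ A ∈ T, A ⊆ D) →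
      Supported ((hfin.toFinset.filter fun B => B ⊆ D).image (weightedPoint c)) Ψ
        (T.image (weightedPoint c)) := by
  obtain ⟨η, hη⟩ := hc.exists_heights hfin (fun B hB => K.nonempty_of_mem_faces hB)
    fun D hD => K.indep hD
  have hinv := (hc.injOn K).leftInvOn_invFunOn
  refine ⟨fun v => η (Function.invFunOn (weightedPoint c) K.faces v).card,
    fun D hD T hTK hT hTD => ?_⟩
  obtain ⟨h, h1, h2⟩ := hη D hD T hTK hT hTD
  refine ⟨Finset.image_subset_image fun A hA => ?_, h, fun w hw => ?_, fun w hw hwT => ?_⟩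
  · rw [Finset.mem_filter, hfin.mem_toFinset]
    exact ⟨hTK hA, hTD A hA⟩
  · obtain ⟨A, hA, rfl⟩ := Finset.mem_image.1 hw
    dsimp only
    rw [hinv (hTK hA), h1 A hA]
  · obtain ⟨B, hB, rfl⟩ := Finset.mem_image.1 hw
    rw [Finset.mem_filter, hfin.mem_toFinset] at hB
    dsimp only
    rw [hinv hB.1]
    exact h2 B hB.1 hB.2 fun hBT => hwT (Finset.mem_image_of_mem _ hBT)

theorem IsWeights.image_subset_convexHull {c : Finset E → E → ℝ} (hc : IsWeights c)
    {T : Finset (Finset E)} {D : Finset E} (hT : ∀ A ∈ T, A.Nonempty ∧ A ⊆ D) :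
    ((T.image (weightedPoint c) : Finset E) : Set E) ⊆ convexHull ℝ (D : Set E) := by
  intro w hw
  obtain ⟨A, hA, rfl⟩ := Finset.mem_image.1 (Finset.mem_coe.1 hw)
  exact convexHull_mono (by exact_mod_cast (hT A hA).2) (hc.weightedPoint_mem (hT A hA).1)

/-- A point of a simplex of the derived subdivision lying in a face `D` of the ambient simplex
lies in the part of this simplex contained in `D`. -/
theorem IsWeights.mem_convexHull_filter [FiniteDimensional ℝ E] {c : Finset E → E → ℝ}
    (hc : IsWeights c) {T : Finset (Finset E)} {A D : Finset E} (hA : AffIndep A)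
    (hT : ∀ B ∈ T, B.Nonempty ∧ B ⊆ A) (hDA : D ⊆ A) {x : E}
    (hx : x ∈ convexHull ℝ ((T.image (weightedPoint c) : Finset E) : Set E))
    (hxD : x ∈ convexHull ℝ (D : Set E)) :
    x ∈ convexHull ℝ (((T.filter fun B => B ⊆ D).image (weightedPoint c) : Finset E) : Set E) := by
  obtain ⟨u, hu0, hu1⟩ := exists_affineMap_face hA D
  have hu : ∀ w ∈ A, 0 ≤ u w := fun w hw => by
    by_cases h : w ∈ D
    · exact (hu0 w hw h).ge
    · rw [hu1 w hw h]; norm_num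
  have hux : u x = 0 := by
    refine le_antisymm (affineMap_le_of_mem_convexHull hxD u fun w hw => (hu0 w (hDA hw) hw).le)
      (affineMap_ge_of_mem_convexHull hxD u fun w hw => (hu0 w (hDA hw) hw).ge)
  have hub : ∀ B ∈ T, 0 ≤ u (weightedPoint c B) := fun B hB =>
    affineMap_ge_of_mem_convexHull (hc.weightedPoint_mem (hT B hB).1) u
      fun w hw => hu w ((hT B hB).2 hw)
  refine convexHull_mono ?_ (mem_convexHull_face
    (D' := (T.filter fun B => B ⊆ D).image (weightedPoint c)) hx ?_ ?_ hux)
  · exact_mod_cast Finset.inter_subset_right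
  · intro w hw
    obtain ⟨B, hB, rfl⟩ := Finset.mem_image.1 hw
    exact hub B hB
  · intro w hw hwD
    obtain ⟨B, hB, rfl⟩ := Finset.mem_image.1 hw
    refine lt_of_le_of_ne (hub B hB) fun h => hwD (Finset.mem_image_of_mem _ ?_)
    rw [Finset.mem_filter]
    refine ⟨hB, fun a ha => ?_⟩
    have := hc.eq_zero_of_nonneg (hT B hB).1 (fun w hw => hu w ((hT B hB).2 hw)) h.symm a ha
    by_contra haD
    rw [hu1 a ((hT B hB).2 ha) haD] at this
    norm_num at this

/-- Existence of derived subdivisions. -/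
theorem IsWeights.exists_derived [FiniteDimensional ℝ E] {c : Finset E → E → ℝ}
    (hc : IsWeights c) (K : Geometry.SimplicialComplex ℝ E) (hfin : K.faces.Finite) :
    ∃ K' : Geometry.SimplicialComplex ℝ E, K'.faces = derivedFaces c K.faces ∧
      K'.space = K.space := by
  obtain ⟨Ψ, hΨ⟩ := hc.exists_supported K hfin
  have hne : ∀ T : Finset (Finset E), ↑T ⊆ K.faces → ∀ {D}, (∀ A ∈ T, A ⊆ D) →
      ∀ A ∈ T, A.Nonempty ∧ A ⊆ D := fun T hT D hD A hA =>
    ⟨K.nonempty_of_mem_faces (hT hA), hD A hA⟩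
  refine ⟨
    { faces := derivedFaces c K.faces
      isRelLowerSet_faces := ?_
      indep := ?_
      inter_subset_convexHull := ?_ }, rfl, ?_⟩
  · rintro S ⟨T, hTK, hTne, hT, rfl⟩
    refine ⟨hTne.image _, fun S' hS' hne' => ?_⟩
    refine ⟨T.filter fun A => weightedPoint c A ∈ S', fun A hA => hTK (Finset.mem_filter.1 hA).1,
      ?_, hT.mono (Finset.filter_subset _ _), ?_⟩
    · obtain ⟨w, hw⟩ := hne'
      obtain ⟨A, hA, rfl⟩ := Finset.mem_image.1 (hS' hw)
      exact ⟨A, Finset.mem_filter.2 ⟨hA, hw⟩⟩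
    · ext w
      simp only [Finset.mem_image, Finset.mem_filter]
      refine ⟨fun hw => ?_, ?_⟩
      · obtain ⟨A, hA, rfl⟩ := Finset.mem_image.1 (hS' hw)
        exact ⟨A, ⟨hA, hw⟩, rfl⟩
      · rintro ⟨A, ⟨-, hA⟩, rfl⟩
        exact hA
  · rintro S ⟨T, hTK, hTne, hT, rfl⟩
    obtain ⟨D, hD, hTD⟩ := hT.exists_top hTne
    refine affIndep_of_supported (hΨ D (hTK hD) T hTK hT hTD) fun w hw => ?_
    obtain ⟨A, hA, rfl⟩ := Finset.mem_image.1 hw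
    have : (T.image (weightedPoint c)).erase (weightedPoint c A)
        = (T.erase A).image (weightedPoint c) := by
      ext w
      simp only [Finset.mem_image, Finset.mem_erase]
      constructor
      · rintro ⟨hw, B, hB, rfl⟩
        exact ⟨B, ⟨fun h => hw (by rw [h]), hB⟩, rfl⟩
      · rintro ⟨B, ⟨hBA, hB⟩, rfl⟩
        exact ⟨fun h => hBA (hc.injOn K (hTK hB) (hTK hA) h), B, hB, rfl⟩
    rw [this]
    exact hΨ D (hTK hD) _ (fun B hB => hTK (Finset.mem_of_mem_erase hB))
      (hT.mono (Finset.erase_subset _ _)) fun B hB => hTD B (Finset.mem_of_mem_erase hB)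
  · rintro S S' ⟨T, hTK, hTne, hT, rfl⟩ ⟨T', hTK', hTne', hT', rfl⟩ x ⟨hx, hx'⟩
    obtain ⟨A, hA, hTA⟩ := hT.exists_top hTne
    obtain ⟨A', hA', hTA'⟩ := hT'.exists_top hTne'
    have hxD := K.inter_subset_convexHull (hTK hA) (hTK' hA')
      ⟨convexHull_min (hc.image_subset_convexHull (hne T hTK hTA)) (convex_convexHull ℝ _) hx,
       convexHull_min (hc.image_subset_convexHull (hne T' hTK' hTA')) (convex_convexHull ℝ _) hx'⟩
    rw [← Finset.coe_inter] at hxD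
    have hDne : (A ∩ A').Nonempty := by
      by_contra h
      rw [Finset.not_nonempty_iff_eq_empty] at h
      simp [h] at hxD
    have hD : A ∩ A' ∈ K.faces := K.down_closed (hTK hA) Finset.inter_subset_left hDne
    have h1 := hc.mem_convexHull_filter (K.indep (hTK hA)) (hne T hTK hTA)
      Finset.inter_subset_left hx hxD
    have h2 := hc.mem_convexHull_filter (K.indep (hTK' hA')) (hne T' hTK' hTA')
      Finset.inter_subset_right hx' hxD
    have h3 := (hΨ _ hD (T.filter fun B => B ⊆ A ∩ A')
        (fun B hB => hTK (Finset.mem_filter.1 hB).1)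
        (hT.mono (Finset.filter_subset _ _)) fun B hB => (Finset.mem_filter.1 hB).2).inter_subset
      (hΨ _ hD (T'.filter fun B => B ⊆ A ∩ A')
        (fun B hB => hTK' (Finset.mem_filter.1 hB).1)
        (hT'.mono (Finset.filter_subset _ _)) fun B hB => (Finset.mem_filter.1 hB).2) ⟨h1, h2⟩
    refine convexHull_mono (inter_subset_inter ?_ ?_) h3
    · exact_mod_cast Finset.image_subset_image (Finset.filter_subset _ _)
    · exact_mod_cast Finset.image_subset_image (Finset.filter_subset _ _)
  · ext x
    rw [Geometry.SimplicialComplex.mem_space_iff, Geometry.SimplicialComplex.mem_space_iff]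
    constructor
    · rintro ⟨S, ⟨T, hTK, hTne, hT, rfl⟩, hx⟩
      obtain ⟨A, hA, hTA⟩ := hT.exists_top hTne
      exact ⟨A, hTK hA, convexHull_min (hc.image_subset_convexHull (hne T hTK hTA))
        (convex_convexHull ℝ _) hx⟩
    · rintro ⟨A, hA, hx⟩
      obtain ⟨T, hTne, hT, hTA, hxT⟩ := hc.exists_nested_of_mem A hx
      exact ⟨_, ⟨T, fun B hB => K.down_closed hA (hTA B hB).2 (hTA B hB).1, hTne, hT, rfl⟩, hxT⟩

/-- Every simplex of `B` has an affine support for `Φ` within every simplex of `K`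
containing it. -/
def LocallySupported (K B : Geometry.SimplicialComplex ℝ E) (Φ : E → ℝ) : Prop :=
  ∀ F ∈ B.faces, ∀ A ∈ K.faces, convexHull ℝ (F : Set E) ⊆ convexHull ℝ (A : Set E) →
    ∃ g : E →ᵃ[ℝ] ℝ, (∀ w ∈ F, g w = Φ w) ∧
      ∀ w ∈ B.vertices, w ∈ convexHull ℝ (A : Set E) → w ∉ F → g w < Φ w

/-- No simplex of `B` crosses the hyperplane `ℓ = 0`. -/
def OneSided (ℓ : E → ℝ) (B : Geometry.SimplicialComplex ℝ E) : Prop :=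
  ∀ F ∈ B.faces, (∀ w ∈ F, 0 ≤ ℓ w) ∨ ∀ w ∈ F, ℓ w ≤ 0

theorem locallySupported_self [FiniteDimensional ℝ E] (K : Geometry.SimplicialComplex ℝ E) :
    LocallySupported K K 0 := by
  intro F hF A hA hFA
  have hFA' : F ⊆ A := (K.face_subset_face_iff hF hA).1 hFA
  obtain ⟨u, hu0, hu1⟩ := exists_affineMap_face (K.indep hA) F
  refine ⟨-u, fun w hw => ?_, fun w hw hwA hwF => ?_⟩
  · simp [hu0 w (hFA' hw) hw]
  · have hwA' : w ∈ A := (K.vertex_mem_convexHull_iff hw hA).1 hwA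
    simp [hu1 w hwA' hwF]

theorem IsWeights.isDerivedSubdivision [FiniteDimensional ℝ E] {c : Finset E → E → ℝ}
    (hc : IsWeights c) {B B' : Geometry.SimplicialComplex ℝ E}
    (hB' : B'.faces = derivedFaces c B.faces) : IsDerivedSubdivision B' B :=
  ⟨weightedPoint c, fun s hs => sum_smul_mem_intrinsicInterior (B.indep hs)
    (hc s (B.nonempty_of_mem_faces hs)).1 (hc s (B.nonempty_of_mem_faces hs)).2, hB'⟩

theorem finite_derivedFaces (c : Finset E → E → ℝ) {𝒦 : Set (Finset E)} (h : 𝒦.Finite) :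
    (derivedFaces c 𝒦).Finite := by
  refine ((h.toFinset.powerset.image fun T => T.image (weightedPoint c)).finite_toSet).subset ?_
  rintro S ⟨T, hT, -, -, rfl⟩
  refine Finset.mem_coe.2 (Finset.mem_image_of_mem _ (Finset.mem_powerset.2 fun A hA => ?_))
  exact h.mem_toFinset.2 (hT hA)

theorem mem_vertices_derived {c : Finset E → E → ℝ} {B B' : Geometry.SimplicialComplex ℝ E}
    (hB' : B'.faces = derivedFaces c B.faces) {v : E} :
    v ∈ B'.vertices ↔ ∃ S ∈ B.faces, v = weightedPoint c S := by
  rw [Geometry.SimplicialComplex.mem_vertices, hB']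
  constructor
  · rintro ⟨T, hT, ⟨S, hS⟩, -, h⟩
    refine ⟨S, hT hS, ?_⟩
    have : weightedPoint c S ∈ ({v} : Finset E) := h ▸ Finset.mem_image_of_mem _ hS
    exact (Finset.mem_singleton.1 this).symm
  · rintro ⟨S, hS, rfl⟩
    refine ⟨{S}, by simpa using hS, Finset.singleton_nonempty _, ?_, by simp⟩
    intro A hA B hB
    rw [Finset.mem_singleton.1 hA, Finset.mem_singleton.1 hB]
    exact Or.inl Subset.rfl

theorem derivedFaces_mono (c : Finset E → E → ℝ) {𝒦 𝒦' : Set (Finset E)} (h : 𝒦 ⊆ 𝒦') :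
    derivedFaces c 𝒦 ⊆ derivedFaces c 𝒦' := by
  rintro S ⟨T, hT, h1⟩
  exact ⟨T, hT.trans h, h1⟩

theorem IsWeights.exists_superface {c : Finset E → E → ℝ} (hc : IsWeights c)
    {B : Geometry.SimplicialComplex ℝ E} {S : Finset E} (hS : S ∈ derivedFaces c B.faces) :
    ∃ D ∈ B.faces, (S : Set E) ⊆ convexHull ℝ (D : Set E) := by
  obtain ⟨T, hTK, hTne, hT, rfl⟩ := hS
  obtain ⟨D, hD, hTD⟩ := hT.exists_top hTne
  exact ⟨D, hTK hD, hc.image_subset_convexHull fun A hA =>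
    ⟨B.nonempty_of_mem_faces (hTK hA), hTD A hA⟩⟩

theorem IsWeights.isSubdivision {c : Finset E → E → ℝ} (hc : IsWeights c)
    {K B B' : Geometry.SimplicialComplex ℝ E} (hB : IsSubdivision B K)
    (hB' : B'.faces = derivedFaces c B.faces) (hsp : B'.space = B.space) :
    IsSubdivision B' K := by
  refine ⟨hsp.trans hB.1, fun S hS => ?_⟩
  rw [hB'] at hS
  obtain ⟨D, hD, hSD⟩ := hc.exists_superface hS
  obtain ⟨A, hA, hDA⟩ := hB.2 D hD
  exact ⟨A, hA, (convexHull_min hSD (convex_convexHull ℝ _)).trans hDA⟩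

theorem IsWeights.oneSided {c : Finset E → E → ℝ} (hc : IsWeights c)
    {B B' : Geometry.SimplicialComplex ℝ E} (hB' : B'.faces = derivedFaces c B.faces)
    {ℓ : E →ᵃ[ℝ] ℝ} (hB : OneSided ℓ B) : OneSided ℓ B' := by
  intro S hS
  rw [hB'] at hS
  obtain ⟨D, hD, hSD⟩ := hc.exists_superface hS
  rcases hB D hD with h | h
  · exact Or.inl fun w hw => affineMap_ge_of_mem_convexHull (hSD hw) ℓ h
  · exact Or.inr fun w hw => affineMap_le_of_mem_convexHull (hSD hw) ℓ h

/-- A derived subdivision whose interior points are taken on the hyperplane `ℓ = 0` whenever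
possible is not crossed by this hyperplane. -/
theorem IsWeights.oneSided_derived {c : Finset E → E → ℝ} (hc : IsWeights c)
    {B B' : Geometry.SimplicialComplex ℝ E} (hB' : B'.faces = derivedFaces c B.faces)
    {ℓ : E →ᵃ[ℝ] ℝ} (hℓ : ∀ A : Finset E, (∃ w ∈ A, ℓ w < 0) → (∃ w ∈ A, 0 < ℓ w) →
      ∑ w ∈ A, c A w * ℓ w = 0) : OneSided ℓ B' := by
  intro S hS
  rw [hB'] at hS
  obtain ⟨T, hTK, hTne, hT, rfl⟩ := hS
  by_contra! h
  obtain ⟨⟨w₁, hw₁, h₁⟩, w₂, hw₂, h₂⟩ := h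
  obtain ⟨S₁, hS₁, rfl⟩ := Finset.mem_image.1 hw₁
  obtain ⟨S₂, hS₂, rfl⟩ := Finset.mem_image.1 hw₂
  have hne : ∀ S ∈ T, S.Nonempty := fun S hS => B.nonempty_of_mem_faces (hTK hS)
  have hneg : ∃ w ∈ S₁, ℓ w < 0 := by
    by_contra! h
    exact absurd (affineMap_ge_of_mem_convexHull (hc.weightedPoint_mem (hne S₁ hS₁)) ℓ h)
      (not_le.2 h₁)
  have hpos : ∃ w ∈ S₂, 0 < ℓ w := by
    by_contra! h
    exact absurd (affineMap_le_of_mem_convexHull (hc.weightedPoint_mem (hne S₂ hS₂)) ℓ h)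
      (not_le.2 h₂)
  rcases hT S₁ hS₁ S₂ hS₂ with h | h
  · obtain ⟨w, hw, hlt⟩ := hneg
    have := hℓ S₂ ⟨w, h hw, hlt⟩ hpos
    rw [← hc.affineMap_weightedPoint (hne S₂ hS₂)] at this
    exact h₂.ne' this
  · obtain ⟨w, hw, hlt⟩ := hpos
    have := hℓ S₁ hneg ⟨w, h hw, hlt⟩
    rw [← hc.affineMap_weightedPoint (hne S₁ hS₁)] at this
    exact h₁.ne this

/-- A simplex of a subdivision with an interior point in `A` is contained in `A`. -/
theorem IsWeights.subset_of_isSubdivision [FiniteDimensional ℝ E] {c : Finset E → E → ℝ}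
    (hc : IsWeights c) {K B : Geometry.SimplicialComplex ℝ E} (hB : IsSubdivision B K)
    {D A : Finset E} (hD : D ∈ B.faces) (hA : A ∈ K.faces)
    (h : weightedPoint c D ∈ convexHull ℝ (A : Set E)) :
    convexHull ℝ (D : Set E) ⊆ convexHull ℝ (A : Set E) := by
  obtain ⟨A', hA', hDA'⟩ := hB.2 D hD
  have hDne := B.nonempty_of_mem_faces hD
  have h1 := K.inter_subset_convexHull hA' hA ⟨hDA' (hc.weightedPoint_mem hDne), h⟩
  rw [← Finset.coe_inter] at h1
  refine (convexHull_min (hc.subset_convexHull_face hDne (K.indep hA')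
    ((subset_convexHull ℝ _).trans hDA') Finset.inter_subset_left h1)
    (convex_convexHull ℝ _)).trans (convexHull_mono ?_)
  exact_mod_cast Finset.inter_subset_right

theorem IsWeights.eventually_locallySupported [FiniteDimensional ℝ E] {c : Finset E → E → ℝ}
    (hc : IsWeights c) {K B B' : Geometry.SimplicialComplex ℝ E} {Φ : E → ℝ}
    (hK : K.faces.Finite) (hBfin : B.faces.Finite) (hB : IsSubdivision B K)
    (hΦ : LocallySupported K B Φ) (hB' : B'.faces = derivedFaces c B.faces) {η : ℕ → ℝ}
    (hη : ∀ D ∈ B.faces, ∀ T : Finset (Finset E), ↑T ⊆ B.faces → IsNested T →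
      (∀ A ∈ T, A ⊆ D) → ∃ h, TouchesAt c B.faces η D T h) :
    ∀ᶠ ε : ℝ in nhdsWithin 0 (Ioi 0), ∀ Φ' : E → ℝ, (∀ S ∈ B.faces,
      Φ' (weightedPoint c S) = ∑ w ∈ S, c S w * Φ w + ε * η S.card) →
      LocallySupported K B' Φ' := by
  have key : ∀ T : Finset (Finset E), T ∈ (hBfin.toFinset.powerset : Set (Finset (Finset E))) →
      ∀ A ∈ K.faces, ∀ᶠ ε : ℝ in nhdsWithin 0 (Ioi 0), IsNested T → T.Nonempty →
        ((T.image (weightedPoint c) : Finset E) : Set E) ⊆ convexHull ℝ (A : Set E) →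
        ∃ g : E →ᵃ[ℝ] ℝ,
          (∀ S ∈ T, g (weightedPoint c S) = ∑ w ∈ S, c S w * Φ w + ε * η S.card) ∧
          ∀ S ∈ B.faces, weightedPoint c S ∈ convexHull ℝ (A : Set E) → S ∉ T →
            g (weightedPoint c S) < ∑ w ∈ S, c S w * Φ w + ε * η S.card := by
    intro T hTB A hA
    by_cases hcond : IsNested T ∧ T.Nonempty ∧
        ((T.image (weightedPoint c) : Finset E) : Set E) ⊆ convexHull ℝ (A : Set E)
    swap
    · exact Filter.Eventually.of_forall fun ε h1 h2 h3 => absurd ⟨h1, h2, h3⟩ hcond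
    obtain ⟨hT, hTne, hTA⟩ := hcond
    have hTB' : ↑T ⊆ B.faces := fun S hS =>
      hBfin.mem_toFinset.1 (Finset.mem_powerset.1 (Finset.mem_coe.1 hTB) hS)
    obtain ⟨D, hD, hTD⟩ := hT.exists_top hTne
    have hDA := hc.subset_of_isSubdivision hB (hTB' hD) hA
      (hTA (Finset.mem_coe.2 (Finset.mem_image_of_mem _ hD)))
    obtain ⟨g, hg1, hg2⟩ := hΦ D (hTB' hD) A hA hDA
    obtain ⟨h, hh1, hh2⟩ := hη D (hTB' hD) T hTB' hT hTD
    have hval : ∀ (ε : ℝ) x, (g + ε • h) x = g x + ε * h x := fun ε x => by simp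
    have hgD : ∀ S ∈ B.faces, S ⊆ D →
        g (weightedPoint c S) = ∑ w ∈ S, c S w * Φ w := fun S hS hSD => by
      rw [hc.affineMap_weightedPoint (B.nonempty_of_mem_faces hS)]
      exact Finset.sum_congr rfl fun w hw => by rw [hg1 w (hSD hw)]
    have hlt : ∀ᶠ ε : ℝ in nhdsWithin 0 (Ioi 0), ∀ S ∈ B.faces,
        weightedPoint c S ∈ convexHull ℝ (A : Set E) → S ∉ T →
          (g + ε • h) (weightedPoint c S) < ∑ w ∈ S, c S w * Φ w + ε * η S.card := by
      rw [Filter.eventually_all_finite hBfin]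
      intro S hS
      by_cases hSD : S ⊆ D
      · filter_upwards [self_mem_nhdsWithin] with ε hε _ hST
        rw [hval, hgD S hS hSD]
        have := mul_lt_mul_of_pos_left (hh2 S hS hSD hST) (mem_Ioi.1 hε)
        linarith
      · by_cases hSA : weightedPoint c S ∈ convexHull ℝ (A : Set E)
        swap
        · exact Filter.Eventually.of_forall fun ε h1 => absurd h1 hSA
        have hSne := B.nonempty_of_mem_faces hS
        have hSA' := hc.subset_of_isSubdivision hB hS hA hSA
        have hvert : ∀ w ∈ S, w ∈ B.vertices := fun w hw => by
          rw [Geometry.SimplicialComplex.mem_vertices]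
          exact B.down_closed hS (Finset.singleton_subset_iff.2 hw) (Finset.singleton_nonempty w)
        have hgap : g (weightedPoint c S) < ∑ w ∈ S, c S w * Φ w := by
          rw [hc.affineMap_weightedPoint hSne]
          have hle : ∀ w ∈ S, w ∉ D → g w < Φ w := fun w hw hwD =>
            hg2 w (hvert w hw) (hSA' (subset_convexHull ℝ _ hw)) hwD
          obtain ⟨a, ha, haD⟩ := Finset.not_subset.1 hSD
          refine Finset.sum_lt_sum (fun w hw => ?_)
            ⟨a, ha, mul_lt_mul_of_pos_left (hle a ha haD) ((hc S hSne).1 a ha)⟩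
          refine mul_le_mul_of_nonneg_left ?_ ((hc S hSne).1 w hw).le
          by_cases hwD : w ∈ D
          · exact (hg1 w hwD).le
          · exact (hle w hw hwD).le
        have htend : Filter.Tendsto
            (fun ε : ℝ => ε * (h (weightedPoint c S) - η S.card)) (nhdsWithin 0 (Ioi 0))
            (nhds 0) := by
          have : Continuous fun ε : ℝ => ε * (h (weightedPoint c S) - η S.card) := by fun_prop
          simpa using (this.tendsto 0).mono_left nhdsWithin_le_nhds
        filter_upwards [htend.eventually_lt_const (sub_pos.2 hgap)] with ε hε _ _
        rw [hval]
        linarith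
    filter_upwards [hlt] with ε hε _ _ _
    refine ⟨g + ε • h, fun S hS => ?_, hε⟩
    rw [hval, hgD S (hTB' hS) (hTD S hS), hh1 S hS]
  have key' := (Filter.eventually_all_finite (Finset.finite_toSet _)).2 fun T hT =>
    (Filter.eventually_all_finite hK).2 (key T hT)
  filter_upwards [key'] with ε hε Φ' hΦ' F hF A hA hFA
  rw [hB'] at hF
  obtain ⟨T, hTB, hTne, hT, rfl⟩ := hF
  obtain ⟨g, hg1, hg2⟩ := hε T (Finset.mem_coe.2 (Finset.mem_powerset.2 fun S hS =>
    hBfin.mem_toFinset.2 (hTB hS))) A hA hT hTne ((subset_convexHull ℝ _).trans hFA)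
  refine ⟨g, fun w hw => ?_, fun w hw hwA hwT => ?_⟩
  · obtain ⟨S, hS, rfl⟩ := Finset.mem_image.1 hw
    rw [hg1 S hS, hΦ' S (hTB hS)]
  · obtain ⟨S, hS, rfl⟩ := (mem_vertices_derived hB').1 hw
    rw [hΦ' S hS]
    exact hg2 S hS hwA fun h => hwT (Finset.mem_image_of_mem _ h)

/-- `B` is an `s`-fold derived subdivision of `K`, locally supported by `Φ` and not crossed by
the hyperplanes of `ℋ`. -/
structure GoodSubdivision (ℋ : Finset (E →ᵃ[ℝ] ℝ)) (s : ℕ)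
    (K B : Geometry.SimplicialComplex ℝ E) (Φ : E → ℝ) : Prop where
  iter : IsIterDerived s B K
  finite : B.faces.Finite
  isSubdivision : IsSubdivision B K
  oneSided : ∀ ℓ ∈ ℋ, OneSided ℓ B
  locallySupported : LocallySupported K B Φ

theorem IsWeights.exists_eq [FiniteDimensional ℝ E] {c : Finset E → E → ℝ} (hc : IsWeights c)
    (B : Geometry.SimplicialComplex ℝ E) (f : Finset E → ℝ) :
    ∃ Φ : E → ℝ, ∀ S ∈ B.faces, Φ (weightedPoint c S) = f S := by
  have hinv := (hc.injOn B).leftInvOn_invFunOn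
  exact ⟨fun v => f (Function.invFunOn (weightedPoint c) B.faces v), fun S hS =>
    congrArg f (hinv hS)⟩

theorem GoodSubdivision.derived [FiniteDimensional ℝ E] {ℋ : Finset (E →ᵃ[ℝ] ℝ)} {s : ℕ}
    {K B B' : Geometry.SimplicialComplex ℝ E} {Φ Φ' : E → ℝ} (hB : GoodSubdivision ℋ s K B Φ)
    {c : Finset E → E → ℝ} (hc : IsWeights c) {ℓ : E →ᵃ[ℝ] ℝ}
    (hℓ : ∀ A : Finset E, (∃ w ∈ A, ℓ w < 0) → (∃ w ∈ A, 0 < ℓ w) → ∑ w ∈ A, c A w * ℓ w = 0)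
    (hB' : B'.faces = derivedFaces c B.faces) (hsp : B'.space = B.space)
    (hΦ' : LocallySupported K B' Φ') : GoodSubdivision (insert ℓ ℋ) (s + 1) K B' Φ' where
  iter := ⟨B, hB.iter, hc.isDerivedSubdivision hB'⟩
  finite := hB' ▸ finite_derivedFaces c hB.finite
  isSubdivision := hc.isSubdivision hB.isSubdivision hB' hsp
  oneSided := fun ℓ' hℓ' => by
    rcases Finset.mem_insert.1 hℓ' with rfl | h
    · exact hc.oneSided_derived hB' hℓ
    · exact hc.oneSided hB' (hB.oneSided ℓ' h)
  locallySupported := hΦ'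

/-- Two complexes with a common subcomplex have iterated derived subdivisions, agreeing on the
subcomplex, which are not crossed by given hyperplanes and are locally supported. -/
theorem exists_goodSubdivision [FiniteDimensional ℝ E]
    {K₁ K₂ L : Geometry.SimplicialComplex ℝ E} (hK₁ : K₁.faces.Finite) (hK₂ : K₂.faces.Finite)
    (hL₁ : L.faces ⊆ K₁.faces) (hL₂ : L.faces ⊆ K₂.faces) (ℋ : Finset (E →ᵃ[ℝ] ℝ)) :
    ∃ (s : ℕ) (B₁ B₂ M : Geometry.SimplicialComplex ℝ E) (Φ₁ Φ₂ : E → ℝ),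
      GoodSubdivision ℋ s K₁ B₁ Φ₁ ∧ GoodSubdivision ℋ s K₂ B₂ Φ₂ ∧ IsIterDerived s M L ∧
      M.space = L.space ∧ M.faces ⊆ B₁.faces ∧ M.faces ⊆ B₂.faces ∧
      ∀ v ∈ M.vertices, Φ₁ v = Φ₂ v := by
  induction ℋ using Finset.induction_on with
  | empty =>
    have h : ∀ K : Geometry.SimplicialComplex ℝ E, K.faces.Finite →
        GoodSubdivision ∅ 0 K K 0 := fun K hK =>
      ⟨rfl, hK, ⟨rfl, fun s hs => ⟨s, hs, Subset.rfl⟩⟩, by simp, locallySupported_self K⟩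
    exact ⟨0, K₁, K₂, L, 0, 0, h K₁ hK₁, h K₂ hK₂, rfl, rfl, hL₁, hL₂, fun _ _ => rfl⟩
  | insert ℓ ℋ _ ih =>
    obtain ⟨s, B₁, B₂, M, Φ₁, Φ₂, hB₁, hB₂, hM, hMsp, hM₁, hM₂, hΦ⟩ := ih
    obtain ⟨c, hc, hℓ⟩ := exists_isWeights ℓ
    obtain ⟨η, hη⟩ := hc.exists_heights (hB₁.finite.union hB₂.finite)
      (fun B hB => hB.elim (fun h => B₁.nonempty_of_mem_faces h)
        fun h => B₂.nonempty_of_mem_faces h)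
      (fun D hD => hD.elim (fun h => B₁.indep h) fun h => B₂.indep h)
    obtain ⟨B₁', hB₁', hsp₁⟩ := hc.exists_derived B₁ hB₁.finite
    obtain ⟨B₂', hB₂', hsp₂⟩ := hc.exists_derived B₂ hB₂.finite
    obtain ⟨M', hM', hspM⟩ := hc.exists_derived M (hB₁.finite.subset hM₁)
    have hev₁ := hc.eventually_locallySupported hK₁ hB₁.finite hB₁.isSubdivision
      hB₁.locallySupported hB₁' (η := η) fun D hD T hTB hT hTD => by
        obtain ⟨h, h1, h2⟩ := hη D (Or.inl hD) T (hTB.trans subset_union_left) hT hTD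
        exact ⟨h, h1, fun B hB => h2 B (Or.inl hB)⟩
    have hev₂ := hc.eventually_locallySupported hK₂ hB₂.finite hB₂.isSubdivision
      hB₂.locallySupported hB₂' (η := η) fun D hD T hTB hT hTD => by
        obtain ⟨h, h1, h2⟩ := hη D (Or.inr hD) T (hTB.trans subset_union_right) hT hTD
        exact ⟨h, h1, fun B hB => h2 B (Or.inr hB)⟩
    obtain ⟨ε, hε₁, hε₂⟩ := (hev₁.and hev₂).exists
    obtain ⟨Φ₁', hΦ₁'⟩ := hc.exists_eq B₁ fun S => ∑ w ∈ S, c S w * Φ₁ w + ε * η S.card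
    obtain ⟨Φ₂', hΦ₂'⟩ := hc.exists_eq B₂ fun S => ∑ w ∈ S, c S w * Φ₂ w + ε * η S.card
    refine ⟨s + 1, B₁', B₂', M', Φ₁', Φ₂', hB₁.derived hc hℓ hB₁' hsp₁ (hε₁ _ hΦ₁'),
      hB₂.derived hc hℓ hB₂' hsp₂ (hε₂ _ hΦ₂'), ⟨M, hM, hc.isDerivedSubdivision hM'⟩,
      hspM.trans hMsp, ?_, ?_, fun v hv => ?_⟩
    · rw [hM', hB₁']; exact derivedFaces_mono c hM₁
    · rw [hM', hB₂']; exact derivedFaces_mono c hM₂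
    · obtain ⟨S, hS, rfl⟩ := (mem_vertices_derived hM').1 hv
      rw [hΦ₁' S (hM₁ hS), hΦ₂' S (hM₂ hS)]
      congr 1
      refine Finset.sum_congr rfl fun w hw => ?_
      rw [hΦ w]
      rw [Geometry.SimplicialComplex.mem_vertices]
      exact M.down_closed hS (Finset.singleton_subset_iff.2 hw) (Finset.singleton_nonempty w)

theorem affineMap_sum_apply {ι : Type*} (S : Finset ι) (g : ι → (E →ᵃ[ℝ] ℝ)) (x : E) :
    (∑ i ∈ S, g i) x = ∑ i ∈ S, g i x := by
  induction S using Finset.induction_on with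
  | empty => simp
  | insert a s ha ih => rw [Finset.sum_insert ha, Finset.sum_insert ha, ← ih]; simp

/-- `x` lies weakly on the same side as `F` of every hyperplane of `ℋ` not crossing `F`. -/
def SameSide (ℋ : Finset (E →ᵃ[ℝ] ℝ)) (F : Finset E) (x : E) : Prop :=
  ∀ ℓ ∈ ℋ, ((∀ w ∈ F, 0 ≤ ℓ w) → 0 ≤ ℓ x) ∧ ((∀ w ∈ F, ℓ w ≤ 0) → ℓ x ≤ 0)

/-- A simplex is cut out by finitely many weak affine inequalities. -/
theorem exists_finset_sameSide [FiniteDimensional ℝ E] {A : Finset E} (hA : AffIndep A) :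
    ∃ ℋ : Finset (E →ᵃ[ℝ] ℝ), ∀ F : Finset E, (F : Set E) ⊆ convexHull ℝ (A : Set E) → ∀ x,
      SameSide ℋ F x → x ∈ convexHull ℝ (A : Set E) := by
  obtain ⟨t, hAt, ht, htop⟩ := exists_subset_affineIndependent_affineSpan_eq_top
    (k := ℝ) (s := (A : Set E)) hA
  have hfin : Finite t := finite_set_of_fin_dim_affineIndependent ℝ ht
  let b : AffineBasis t ℝ E := ⟨(↑), ht, by simpa using htop⟩
  have := Fintype.ofFinite t
  have hb : ∀ (i : t) (w : E) (hw : w ∈ A), b.coord i w = if i = ⟨w, hAt hw⟩ then 1 else 0 :=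
    fun i w hw => by
      have : b ⟨w, hAt hw⟩ = w := rfl
      conv_lhs => rw [← this, b.coord_apply]
  refine ⟨Finset.univ.image b.coord, fun F hF x hx => ?_⟩
  have hx' := fun i => hx (b.coord i) (Finset.mem_image_of_mem _ (Finset.mem_univ i))
  have hnn : ∀ i, ∀ w ∈ F, 0 ≤ b.coord i w := fun i w hw =>
    affineMap_ge_of_mem_convexHull (hF hw) _ fun a ha => by
      rw [hb i a ha]; split_ifs <;> norm_num
  rw [← b.linear_combination_coord_eq_self x]
  refine sum_smul_mem_convexHull (fun i _ => (hx' i).1 (hnn i)) (b.sum_coord_apply_eq_one x)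
    fun i _ hi => ?_
  by_contra hiA
  refine hi (le_antisymm ((hx' i).2 fun w hw => ?_) ((hx' i).1 (hnn i)))
  refine affineMap_le_of_mem_convexHull (hF hw) _ fun a ha => ?_
  rw [hb i a ha, if_neg]
  rintro rfl
  exact hiA ha

/-- Finitely many hyperplanes cutting out all simplices of a finite family. -/
theorem exists_finset_forall_sameSide [FiniteDimensional ℝ E] {𝒦 : Set (Finset E)}
    (hfin : 𝒦.Finite) (hI : ∀ A ∈ 𝒦, AffIndep A) :
    ∃ ℋ : Finset (E →ᵃ[ℝ] ℝ), ∀ A ∈ 𝒦, ∀ F : Finset E, (F : Set E) ⊆ convexHull ℝ (A : Set E) →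
      ∀ x, SameSide ℋ F x → x ∈ convexHull ℝ (A : Set E) := by
  have : ∀ A : Finset E, ∃ ℋ : Finset (E →ᵃ[ℝ] ℝ), A ∈ 𝒦 → ∀ F : Finset E,
      (F : Set E) ⊆ convexHull ℝ (A : Set E) →
      ∀ x, SameSide ℋ F x → x ∈ convexHull ℝ (A : Set E) := fun A => by
    by_cases hA : A ∈ 𝒦
    · obtain ⟨ℋ, h⟩ := exists_finset_sameSide (hI A hA)
      exact ⟨ℋ, fun _ => h⟩
    · exact ⟨∅, fun h => absurd h hA⟩
  choose ℋ hℋ using this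
  refine ⟨hfin.toFinset.biUnion ℋ, fun A hA F hF x hx => hℋ A hA F hF x fun ℓ hℓ => hx ℓ ?_⟩
  exact Finset.mem_biUnion.2 ⟨A, hfin.mem_toFinset.2 hA, hℓ⟩

/-- The piecewise linear function folding along the hyperplanes of `ℋ`. -/
def foldHeight (ℋ : Finset (E →ᵃ[ℝ] ℝ)) (x : E) : ℝ := ∑ ℓ ∈ ℋ, |ℓ x|

theorem exists_support_foldHeight {ℋ : Finset (E →ᵃ[ℝ] ℝ)} {F : Finset E}
    (hF : ∀ ℓ ∈ ℋ, (∀ w ∈ F, 0 ≤ ℓ w) ∨ ∀ w ∈ F, ℓ w ≤ 0) :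
    ∃ g : E →ᵃ[ℝ] ℝ, (∀ w ∈ F, g w = foldHeight ℋ w) ∧ (∀ x, g x ≤ foldHeight ℋ x) ∧
      ∀ x, g x = foldHeight ℋ x → SameSide ℋ F x := by
  have key : ∀ ℓ : E →ᵃ[ℝ] ℝ, ∃ s : ℝ, ℓ ∈ ℋ → (∀ w ∈ F, s * ℓ w = |ℓ w|) ∧
      (∀ x, s * ℓ x ≤ |ℓ x|) ∧ ∀ x, s * ℓ x = |ℓ x| →
        ((∀ w ∈ F, 0 ≤ ℓ w) → 0 ≤ ℓ x) ∧ ((∀ w ∈ F, ℓ w ≤ 0) → ℓ x ≤ 0) := by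
    intro ℓ
    by_cases h1 : ∀ w ∈ F, 0 ≤ ℓ w
    · by_cases h2 : ∀ w ∈ F, ℓ w ≤ 0
      · refine ⟨0, fun _ => ⟨fun w hw => ?_, fun x => by simp, fun x hx => ?_⟩⟩
        · simp [le_antisymm (h2 w hw) (h1 w hw)]
        · have : ℓ x = 0 := by simpa using hx.symm
          simp [this]
      · refine ⟨1, fun _ => ⟨fun w hw => ?_, fun x => ?_, fun x hx => ⟨fun _ => ?_, fun h => ?_⟩⟩⟩
        · rw [one_mul, abs_of_nonneg (h1 w hw)]
        · rw [one_mul]; exact le_abs_self _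
        · rw [one_mul] at hx; rw [hx]; exact abs_nonneg _
        · exact absurd h h2
    · refine ⟨-1, fun hℓ => ⟨fun w hw => ?_, fun x => ?_, fun x hx => ⟨fun h => ?_, fun _ => ?_⟩⟩⟩
      · rw [abs_of_nonpos (((hF ℓ hℓ).resolve_left h1) w hw)]; ring
      · rw [neg_one_mul]; exact neg_le_abs _
      · exact absurd h h1
      · have := abs_nonneg (ℓ x); linarith
  choose s hs using key
  have hval : ∀ x, (∑ ℓ ∈ ℋ, s ℓ • ℓ) x = ∑ ℓ ∈ ℋ, s ℓ * ℓ x := fun x => by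
    rw [affineMap_sum_apply]; simp
  refine ⟨∑ ℓ ∈ ℋ, s ℓ • ℓ, fun w hw => ?_, fun x => ?_, fun x hx => ?_⟩
  · rw [hval]
    exact Finset.sum_congr rfl fun ℓ hℓ => (hs ℓ hℓ).1 w hw
  · rw [hval]
    exact Finset.sum_le_sum fun ℓ hℓ => (hs ℓ hℓ).2.1 x
  · rw [hval] at hx
    have := (Finset.sum_eq_sum_iff_of_le fun ℓ hℓ => (hs ℓ hℓ).2.1 x).1 hx
    exact fun ℓ hℓ => (hs ℓ hℓ).2.2 x (this ℓ hℓ)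

/-- Folding along sufficiently many hyperplanes and adding a small multiple of a local support
yields a global support. -/
theorem GoodSubdivision.eventually_supported {ℋ : Finset (E →ᵃ[ℝ] ℝ)} {s : ℕ}
    {K B : Geometry.SimplicialComplex ℝ E} {Φ : E → ℝ} (hB : GoodSubdivision ℋ s K B Φ)
    (hℋ : ∀ A ∈ K.faces, ∀ F : Finset E, (F : Set E) ⊆ convexHull ℝ (A : Set E) →
      ∀ x, SameSide ℋ F x → x ∈ convexHull ℝ (A : Set E))
    {V : Finset E} (hV : ∀ v, v ∈ V ↔ v ∈ B.vertices) :
    ∀ᶠ ε : ℝ in nhdsWithin 0 (Ioi 0), ∀ F ∈ B.faces,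
      Supported V (fun x => foldHeight ℋ x + ε * Φ x) F := by
  rw [Filter.eventually_all_finite hB.finite]
  intro F hF
  obtain ⟨A, hA, hFA⟩ := hB.isSubdivision.2 F hF
  obtain ⟨g, hg1, hg2, hg3⟩ := exists_support_foldHeight fun ℓ hℓ => hB.oneSided ℓ hℓ F hF
  obtain ⟨h, hh1, hh2⟩ := hB.locallySupported F hF A hA hFA
  have hval : ∀ (ε : ℝ) x, (g + ε • h) x = g x + ε * h x := fun ε x => by simp
  have hFV : F ⊆ V := fun w hw => by
    rw [hV, Geometry.SimplicialComplex.mem_vertices]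
    exact B.down_closed hF (Finset.singleton_subset_iff.2 hw) (Finset.singleton_nonempty w)
  have key : ∀ᶠ ε : ℝ in nhdsWithin 0 (Ioi 0), ∀ w ∈ (V : Set E), w ∉ F →
      (g + ε • h) w < foldHeight ℋ w + ε * Φ w := by
    rw [Filter.eventually_all_finite V.finite_toSet]
    intro w hw
    by_cases hwA : w ∈ convexHull ℝ (A : Set E)
    · filter_upwards [self_mem_nhdsWithin] with ε hε hwF
      have := mul_lt_mul_of_pos_left (hh2 w ((hV w).1 hw) hwA hwF) (mem_Ioi.1 hε)
      rw [hval]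
      linarith [hg2 w]
    · have hgap : g w < foldHeight ℋ w := lt_of_le_of_ne (hg2 w) fun heq =>
        hwA (hℋ A hA F ((subset_convexHull ℝ _).trans hFA) w (hg3 w heq))
      have htend : Filter.Tendsto (fun ε : ℝ => ε * (h w - Φ w)) (nhdsWithin 0 (Ioi 0))
          (nhds 0) := by
        have : Continuous fun ε : ℝ => ε * (h w - Φ w) := by fun_prop
        simpa using (this.tendsto 0).mono_left nhdsWithin_le_nhds
      filter_upwards [htend.eventually_lt_const (sub_pos.2 hgap)] with ε hε _
      rw [hval]
      linarith
  filter_upwards [key] with ε hε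
  exact ⟨hFV, g + ε • h, fun w hw => by rw [hval, hg1 w hw, hh1 w hw], fun w hw => hε w hw⟩

/-- Supports persist under small perturbations of the heights. -/
theorem Supported.eventually [FiniteDimensional ℝ E] {V F : Finset E} {Φ : E → ℝ}
    (hF : AffIndep F) (h : Supported V Φ F) :
    ∀ᶠ δ : ℝ in nhdsWithin 0 (Ioi 0), ∀ Φ' : E → ℝ, (∀ w ∈ V, |Φ' w - Φ w| ≤ δ) →
      Supported V Φ' F := by
  obtain ⟨hFV, g, hg1, hg2⟩ := h
  obtain ⟨u, hu, -, -⟩ := exists_affineMap_coord hF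
  have key : ∀ᶠ δ : ℝ in nhdsWithin 0 (Ioi 0), ∀ w ∈ (V : Set E), w ∉ F →
      δ * (1 + ∑ a ∈ F, |u a w|) < Φ w - g w := by
    rw [Filter.eventually_all_finite V.finite_toSet]
    intro w hw
    by_cases hwF : w ∈ F
    · exact Filter.Eventually.of_forall fun δ h => absurd hwF h
    have htend : Filter.Tendsto (fun δ : ℝ => δ * (1 + ∑ a ∈ F, |u a w|))
        (nhdsWithin 0 (Ioi 0)) (nhds 0) := by
      have : Continuous fun δ : ℝ => δ * (1 + ∑ a ∈ F, |u a w|) := by fun_prop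
      simpa using (this.tendsto 0).mono_left nhdsWithin_le_nhds
    filter_upwards [htend.eventually_lt_const (sub_pos.2 (hg2 w hw hwF))] with δ hδ _
    exact hδ
  filter_upwards [key] with δ hδ Φ' hΦ'
  have hval : ∀ x, (g + ∑ a ∈ F, (Φ' a - Φ a) • u a) x
      = g x + ∑ a ∈ F, (Φ' a - Φ a) * u a x := fun x => by
    simp [affineMap_sum_apply]
  refine ⟨hFV, g + ∑ a ∈ F, (Φ' a - Φ a) • u a, fun w hw => ?_, fun w hw hwF => ?_⟩
  · rw [hval, hg1 w hw, Finset.sum_congr rfl fun a _ => by rw [hu a w hw]]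
    simp [hw]
  · rw [hval]
    have h1 : ∑ a ∈ F, (Φ' a - Φ a) * u a w ≤ δ * ∑ a ∈ F, |u a w| := by
      rw [Finset.mul_sum]
      refine Finset.sum_le_sum fun a ha => (le_abs_self _).trans ?_
      rw [abs_mul]
      exact mul_le_mul_of_nonneg_right (hΦ' a (hFV ha)) (abs_nonneg _)
    have h2 := neg_le_of_abs_le (hΦ' w hw)
    have h3 := hδ w hw hwF
    rw [mul_add, mul_one] at h3
    linarith

theorem GeneralPosition.exists_insert {W : Finset E} {Ψ : E → ℝ}
    (h : GeneralPosition W Ψ) (v : E) (a : ℝ) {δ : ℝ} (hδ : 0 < δ) :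
    ∃ z, |z - a| < δ ∧ GeneralPosition (insert v W) (Function.update Ψ v z) := by
  set bad : Set ℝ := ⋃ F ∈ W.powerset, {z | v ∈ affineSpan ℝ (F : Set E) ∧
    ∃ g : E →ᵃ[ℝ] ℝ, (∀ w ∈ F, g w = Ψ w) ∧ z = g v} with hbad
  have hfin : bad.Finite := by
    refine Set.Finite.biUnion (Finset.finite_toSet _) fun F _ => Set.Subsingleton.finite ?_
    rintro _ ⟨hvF, g, hg, rfl⟩ _ ⟨-, g', hg', rfl⟩
    exact affineMap_eq_of_mem_affineSpan hvF fun w hw => (hg w hw).trans (hg' w hw).symm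
  obtain ⟨z, hz, hzbad⟩ := ((Set.Ioo_infinite (show a - δ < a + δ by linarith)).sdiff
    hfin).nonempty
  refine ⟨z, abs_lt.2 ⟨by linarith [hz.1], by linarith [hz.2]⟩, fun F hF g hg => ?_⟩
  have hFW : F.erase v ⊆ W := fun w hw =>
    (Finset.mem_insert.1 (hF (Finset.mem_of_mem_erase hw))).resolve_left (Finset.ne_of_mem_erase hw)
  have hgW : ∀ w ∈ F.erase v, g w = Ψ w := fun w hw => by
    rw [hg w (Finset.mem_of_mem_erase hw), Function.update_of_ne (Finset.ne_of_mem_erase hw)]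
  have hind := h _ hFW g hgW
  by_cases hvF : v ∈ F
  · rw [← Finset.insert_erase hvF]
    refine affineIndependent_insert hind fun hspan => hzbad ?_
    refine Set.mem_biUnion (Finset.mem_coe.2 (Finset.mem_powerset.2 hFW)) ⟨hspan, g, hgW, ?_⟩
    rw [hg v hvF, Function.update_self]
  · rwa [Finset.erase_eq_of_notMem hvF] at hind

/-- Heights in general position on `N` extend to heights in general position on `V`, close to
given ones. -/
theorem GeneralPosition.exists_extend {N : Finset E} {Ψ : E → ℝ}
    (h : GeneralPosition N Ψ) (V : Finset E) (Φ : E → ℝ) {δ : ℝ} (hδ : 0 < δ) :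
    ∃ Ψ' : E → ℝ, (∀ w ∈ N, Ψ' w = Ψ w) ∧ (∀ w ∈ V, w ∉ N → |Ψ' w - Φ w| ≤ δ) ∧
      GeneralPosition (V ∪ N) Ψ' := by
  induction V using Finset.induction_on with
  | empty => exact ⟨Ψ, fun _ _ => rfl, by simp, by simpa using h⟩
  | insert v V _ ih =>
    obtain ⟨Ψ', h1, h2, h3⟩ := ih
    by_cases hvN : v ∈ N
    · refine ⟨Ψ', h1, fun w hw hwN => h2 w ?_ hwN, ?_⟩
      · exact (Finset.mem_insert.1 hw).resolve_left fun h => hwN (h ▸ hvN)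
      · rwa [Finset.insert_union, Finset.insert_eq_of_mem (Finset.mem_union_right _ hvN)]
    · obtain ⟨z, hz, hGP⟩ := h3.exists_insert v (Φ v) hδ
      refine ⟨Function.update Ψ' v z, fun w hw => ?_, fun w hw hwN => ?_, ?_⟩
      · have hwv : w ≠ v := by rintro rfl; exact hvN hw
        rw [Function.update_of_ne hwv, h1 w hw]
      · by_cases hwv : w = v
        · rw [hwv, Function.update_self]; exact hz.le
        · rw [Function.update_of_ne hwv]
          exact h2 w ((Finset.mem_insert.1 hw).resolve_left hwv) hwN
      · rwa [Finset.insert_union]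

theorem generalPosition_empty (Ψ : E → ℝ) : GeneralPosition (∅ : Finset E) Ψ := by
  intro F hF g _
  rw [Finset.subset_empty.1 hF]
  have : IsEmpty {x // x ∈ (∅ : Finset E)} := ⟨fun x => Finset.notMem_empty _ x.2⟩
  exact affineIndependent_of_subsingleton ℝ _

theorem supported_congr {V F : Finset E} {Ψ Ψ' : E → ℝ} (h : ∀ w ∈ V, Ψ w = Ψ' w) :
    Supported V Ψ F ↔ Supported V Ψ' F := by
  refine and_congr_right fun hFV => exists_congr fun g => and_congr ?_ ?_
  · exact forall₂_congr fun w hw => by rw [h w (hFV hw)]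
  · exact forall₂_congr fun w hw => by rw [h w hw]

theorem IsRegularIn.congr {V : Finset E} {Ψ Ψ' : E → ℝ} {P : Set E}
    {K : Geometry.SimplicialComplex ℝ E} (hK : IsRegularIn V Ψ P K)
    (h : ∀ w ∈ V, Ψ w = Ψ' w) : IsRegularIn V Ψ' P K := by
  unfold IsRegularIn at *
  simp only [hK, supported_congr h]

/-- A triangulation of `P` all of whose simplices are lower faces consists of all the lower faces
in `P`. -/
theorem isRegularIn_of_supported {B : Geometry.SimplicialComplex ℝ E} {V : Finset E} {Ψ : E → ℝ}
    (h : ∀ F ∈ B.faces, Supported V Ψ F) : IsRegularIn V Ψ B.space B := by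
  ext F
  refine ⟨fun hF => ⟨B.nonempty_of_mem_faces hF, h F hF, B.convexHull_subset_space hF⟩, ?_⟩
  rintro ⟨hne, hF, hFP⟩
  have hcard : (0 : ℝ) < F.card := by exact_mod_cast hne.card_pos
  have h1 : ∑ _w ∈ F, (F.card : ℝ)⁻¹ = 1 := by
    rw [Finset.sum_const, nsmul_eq_mul, mul_inv_cancel₀ hcard.ne']
  have hy : ∑ w ∈ F, (F.card : ℝ)⁻¹ • w ∈ convexHull ℝ (F : Set E) :=
    sum_smul_mem_convexHull (fun _ _ => by positivity) h1 fun w hw _ => hw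
  obtain ⟨G, hG, hyG⟩ := B.mem_space_iff.1 (hFP hy)
  refine B.down_closed hG (fun w hw => ?_) hne
  by_contra hwG
  have := hF.coord_eq_zero (h G hG) (c := fun _ => (F.card : ℝ)⁻¹) (fun _ _ => by positivity)
    h1 hyG hw hwG
  exact (inv_pos.2 hcard).ne' this

/-- A bounded set lies in the convex hull of its frontier. -/
theorem subset_convexHull_frontier [Nontrivial E] {P : Set E} (hP : Bornology.IsBounded P) :
    P ⊆ convexHull ℝ (frontier P) := by
  intro x hx
  obtain ⟨d, hd⟩ := exists_ne (0 : E)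
  obtain ⟨R, hR⟩ := hP.exists_norm_le
  have hd0 : 0 < ‖d‖ := norm_pos_iff.2 hd
  set t := (R + ‖x‖ + 1) / ‖d‖ with ht
  have htd : ‖t • d‖ = |R + ‖x‖ + 1| := by
    rw [norm_smul, ht, Real.norm_eq_abs, abs_div, abs_of_pos hd0, div_mul_cancel₀ _ hd0.ne']
  have hbig : ∀ e : E, ‖e‖ = |R + ‖x‖ + 1| → x + e ∉ P := fun e he hmem => by
    have h1 := hR _ hmem
    have h2 : ‖e‖ ≤ ‖x + e‖ + ‖x‖ := by
      have := norm_sub_le (x + e) x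
      rwa [add_sub_cancel_left] at this
    linarith [le_abs_self (R + ‖x‖ + 1)]
  obtain ⟨y₁, hy₁, hf₁⟩ := exists_mem_segment_frontier hx (hbig (t • d) htd)
  obtain ⟨y₂, hy₂, hf₂⟩ := exists_mem_segment_frontier hx (hbig (-(t • d)) (by rw [norm_neg, htd]))
  rw [segment_eq_image'] at hy₁ hy₂
  obtain ⟨α, ⟨hα, -⟩, rfl⟩ := hy₁
  obtain ⟨β, ⟨hβ, -⟩, rfl⟩ := hy₂
  simp only [add_sub_cancel_left] at hf₁ hf₂
  have hc := convex_convexHull ℝ (frontier P)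
  have hm₁ := subset_convexHull ℝ _ hf₁
  have hm₂ := subset_convexHull ℝ _ hf₂
  rcases (add_nonneg hα hβ).eq_or_lt with h | h
  · have : α = 0 := by linarith
    simpa [this] using hm₁
  · have := hc hm₁ hm₂ (div_nonneg hβ h.le) (div_nonneg hα h.le)
      (by rw [← add_div, add_comm, div_self h.ne'])
    convert this using 1
    have e : (β / (α + β)) • (x + α • t • d) + (α / (α + β)) • (x + β • -(t • d))
        = (β / (α + β) + α / (α + β)) • x := by
      simp only [smul_add, add_smul, smul_neg, smul_smul]
      rw [show β / (α + β) * (α * t) = α / (α + β) * (β * t) by ring]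
      abel
    rw [e, ← add_div, add_comm β α, div_self h.ne', one_smul]

theorem exists_finset_vertices {B : Geometry.SimplicialComplex ℝ E} (h : B.faces.Finite) :
    ∃ V : Finset E, ∀ v, v ∈ V ↔ v ∈ B.vertices :=
  have hfin : B.vertices.Finite := by
    rw [Geometry.SimplicialComplex.vertices_eq]
    exact h.biUnion fun F _ => F.finite_toSet
  ⟨hfin.toFinset, fun _ => hfin.mem_toFinset⟩

theorem mem_vertices_of_mem_face {B : Geometry.SimplicialComplex ℝ E} {F : Finset E}
    (hF : F ∈ B.faces) {w : E} (hw : w ∈ F) : w ∈ B.vertices :=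
  B.down_closed hF (Finset.singleton_subset_iff.2 hw) (Finset.singleton_nonempty w)

/-- A triangulation all of whose simplices are supported is bistellarly equivalent, relative to a
subcomplex containing the frontier, to the regular triangulation on the vertices of the
subcomplex. -/
theorem bistellarEquiv_of_supported [FiniteDimensional ℝ E] [Nontrivial E] {n : ℕ}
    (hn : Module.finrank ℝ E = n) {P : Set E} (hP : IsCompact P)
    {B M K : Geometry.SimplicialComplex ℝ E} (hB : B.space = P) (hMB : M.faces ⊆ B.faces)
    (hfr : frontier P ⊆ M.space) {V N : Finset E} {Ψ : E → ℝ} (hV : ∀ v, v ∈ V ↔ v ∈ B.vertices)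
    (hN : ∀ v, v ∈ N ↔ v ∈ M.vertices) (hGP : GeneralPosition V Ψ)
    (hsupp : ∀ F ∈ B.faces, Supported V Ψ F) (hK : IsRegularIn N Ψ P K) :
    BistellarEquiv n M B K := by
  have hMN : ∀ F ∈ M.faces, F ⊆ N := fun F hF w hw =>
    (hN w).2 (mem_vertices_of_mem_face hF hw)
  refine bistellarEquiv_of_subset hn (fun v hv => (hV v).2 (hMB ((hN v).1 hv))) hGP hP.isClosed
    (fun v hv hvN => ?_) ?_ (fun F hF => ?_) hfr hMN (fun F hF => hsupp F (hMB hF)) ?_ hK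
  · by_contra hvP_int
    have hvB := (hV v).1 hv
    have hvP : v ∈ P := hB ▸ B.vertices_subset_space hvB
    obtain ⟨F, hF, hvF⟩ := M.mem_space_iff.1 (hfr ⟨subset_closure hvP, hvP_int⟩)
    exact hvN (hMN F hF ((B.vertex_mem_convexHull_iff hvB (hMB hF)).1 hvF))
  · refine (subset_convexHull_frontier hP.isBounded).trans
      (convexHull_min (hfr.trans fun x hx => ?_) (convex_convexHull ℝ _))
    obtain ⟨F, hF, hxF⟩ := M.mem_space_iff.1 hx
    exact convexHull_mono (by exact_mod_cast hMN F hF) hxF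
  · exact hB ▸ B.convexHull_subset_space (hMB hF)
  · exact hB ▸ isRegularIn_of_supported hsupp

/-- All simplices of a finite complex stay supported under small perturbations of the heights. -/
theorem eventually_forall_supported [FiniteDimensional ℝ E] {B : Geometry.SimplicialComplex ℝ E}
    (hB : B.faces.Finite) {V : Finset E} {Φ : E → ℝ} (h : ∀ F ∈ B.faces, Supported V Φ F) :
    ∀ᶠ δ : ℝ in nhdsWithin 0 (Ioi 0), ∀ Φ' : E → ℝ, (∀ w ∈ V, |Φ' w - Φ w| ≤ δ) →
      ∀ F ∈ B.faces, Supported V Φ' F := by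
  have : ∀ᶠ δ : ℝ in nhdsWithin 0 (Ioi 0), ∀ F ∈ B.faces, ∀ Φ' : E → ℝ,
      (∀ w ∈ V, |Φ' w - Φ w| ≤ δ) → Supported V Φ' F := by
    rw [Filter.eventually_all_finite hB]
    exact fun F hF => (h F hF).eventually (B.indep hF)
  filter_upwards [this] with δ hδ Φ' hΦ' F hF using hδ F hF Φ' hΦ'

/-- Heights supporting a complex can be perturbed into general position, extending given heights
on a subset of the vertices. -/
theorem GeneralPosition.exists_extend_supported {B : Geometry.SimplicialComplex ℝ E}
    {V N : Finset E} {Φ Ψ : E → ℝ} {δ : ℝ} (hδ : 0 < δ)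
    (h : ∀ Φ' : E → ℝ, (∀ w ∈ V, |Φ' w - Φ w| ≤ δ) → ∀ F ∈ B.faces, Supported V Φ' F)
    (hΨ : GeneralPosition N Ψ) (hN : ∀ w ∈ N, |Ψ w - Φ w| ≤ δ) :
    ∃ Ψ' : E → ℝ, (∀ w ∈ N, Ψ w = Ψ' w) ∧ GeneralPosition V Ψ' ∧
      ∀ F ∈ B.faces, Supported V Ψ' F := by
  obtain ⟨Ψ', h1, h2, h3⟩ := hΨ.exists_extend V Φ hδ
  refine ⟨Ψ', fun w hw => (h1 w hw).symm, h3.mono Finset.subset_union_left, h Ψ' fun w hw => ?_⟩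
  by_cases hwN : w ∈ N
  · rw [h1 w hwN]
    exact hN w hwN
  · exact h2 w hw hwN

theorem exists_bistellarEquiv_derived [FiniteDimensional ℝ E] [Nontrivial E] {n : ℕ}
    (hn : Module.finrank ℝ E = n) {P : Set E} (hP : IsCompact P)
    {K₁ K₂ L : Geometry.SimplicialComplex ℝ E} (hK₁fin : K₁.faces.Finite)
    (hK₂fin : K₂.faces.Finite) (hK₁ : K₁.space = P) (hK₂ : K₂.space = P)
    (hL₁ : L.faces ⊆ K₁.faces) (hL₂ : L.faces ⊆ K₂.faces) (hfr : frontier P ⊆ L.space) :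
    ∃ (s : ℕ) (B₁ B₂ M : Geometry.SimplicialComplex ℝ E),
      IsIterDerived s B₁ K₁ ∧ IsIterDerived s B₂ K₂ ∧ IsIterDerived s M L ∧
      M.faces ⊆ B₁.faces ∧ M.faces ⊆ B₂.faces ∧ BistellarEquiv n M B₁ B₂ := by
  obtain ⟨ℋ, hℋ⟩ := exists_finset_forall_sameSide (hK₁fin.union hK₂fin) (by
    rintro A (hA | hA)
    exacts [K₁.indep hA, K₂.indep hA])
  obtain ⟨s, B₁, B₂, M, Φ₁, Φ₂, hB₁, hB₂, hM, hML, hMB₁, hMB₂, hΦ⟩ :=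
    exists_goodSubdivision hK₁fin hK₂fin hL₁ hL₂ ℋ
  refine ⟨s, B₁, B₂, M, hB₁.iter, hB₂.iter, hM, hMB₁, hMB₂, ?_⟩
  obtain ⟨V₁, hV₁⟩ := exists_finset_vertices hB₁.finite
  obtain ⟨V₂, hV₂⟩ := exists_finset_vertices hB₂.finite
  obtain ⟨N, hN⟩ := exists_finset_vertices (hB₁.finite.subset hMB₁)
  obtain ⟨ε, hε₁, hε₂⟩ := ((hB₁.eventually_supported (fun A hA => hℋ A (.inl hA)) hV₁).and
    (hB₂.eventually_supported (fun A hA => hℋ A (.inr hA)) hV₂)).exists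
  obtain ⟨δ, ⟨hδ₁, hδ₂⟩, hδ⟩ := (((eventually_forall_supported hB₁.finite hε₁).and
    (eventually_forall_supported hB₂.finite hε₂)).and self_mem_nhdsWithin).exists
  obtain ⟨Ψ, -, hΨ, hGP⟩ := (generalPosition_empty (0 : E → ℝ)).exists_extend N
    (fun x => foldHeight ℋ x + ε * Φ₁ x) hδ
  rw [Finset.union_empty] at hGP
  replace hΨ := fun w hw => hΨ w hw (Finset.notMem_empty w)
  obtain ⟨Ψ₁, h₁, hGP₁, hs₁⟩ := hGP.exists_extend_supported hδ hδ₁ hΨ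
  obtain ⟨Ψ₂, h₂, hGP₂, hs₂⟩ := hGP.exists_extend_supported hδ hδ₂
    (fun w hw => by
      rw [← hΦ w ((hN w).1 hw)]
      exact hΨ w hw)
  obtain ⟨K, hK⟩ := exists_isRegularIn P fun F => hGP.affIndep (F := F)
  have hfrM : frontier P ⊆ M.space := hML ▸ hfr
  exact (bistellarEquiv_of_supported hn hP (hB₁.isSubdivision.1.trans hK₁) hMB₁ hfrM hV₁ hN hGP₁
    hs₁ (hK.congr h₁)).trans
    (bistellarEquiv_of_supported hn hP (hB₂.isSubdivision.1.trans hK₂) hMB₂ hfrM hV₂ hN hGP₂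
    hs₂ (hK.congr h₂)).symm

/-- Let `P ⊂ ℝⁿ` be a compact flat polyhedron whose support is an
`n`-manifold with boundary, and let `K₁`, `K₂` be simplicial triangulations of `P` with a
(possibly empty) common subcomplex `L` with `|L| ⊇ ∂P`. Then there are `s ∈ ℕ` and `s`-fold
derived subdivisions `βˢK₁` and `βˢK₂`, agreeing on a common `s`-fold derived subdivision
`βˢL` of `L`, related by geometric bistellar moves each keeping `βˢL` fixed. -/
theorem statement10 {n : ℕ} [NeZero n] (P : Set (Fin n → ℝ))
    (hPcompact : IsCompact P) (hPflat : (interior P).Nonempty)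
    (hPmanifold : Nonempty (ChartedSpace (EuclideanHalfSpace n) P))
    (K₁ K₂ : Geometry.SimplicialComplex ℝ (Fin n → ℝ))
    (hK₁fin : K₁.faces.Finite) (hK₂fin : K₂.faces.Finite)
    (hK₁ : K₁.space = P) (hK₂ : K₂.space = P)
    (L : Geometry.SimplicialComplex ℝ (Fin n → ℝ))
    (hL : IsCommonSubcomplex L K₁ K₂)
    (hLbd : frontier P ⊆ L.space) :
    ∃ (s : ℕ) (B₁ B₂ BL : Geometry.SimplicialComplex ℝ (Fin n → ℝ)),
      IsIterDerived s B₁ K₁ ∧ IsIterDerived s B₂ K₂ ∧ IsIterDerived s BL L ∧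
      BL.faces ⊆ B₁.faces ∧ BL.faces ⊆ B₂.faces ∧
      Relation.ReflTransGen
        (fun X Y => BistellarMove n X Y ∧ BL.faces ⊆ X.faces ∧ BL.faces ⊆ Y.faces)
        B₁ B₂ := by
  exact exists_bistellarEquiv_derived (by simp) hPcompact hK₁fin hK₂fin hK₁ hK₂ hL.1 hL.2.1 hLbd
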